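/- Let p be an odd prime, G a finite group, H a subgroup of G, and P a Sylow p-subgroup of G with P ≤ H (so P is also a Sylow p-subgroup of H). Let k be a field of characteristic p. Suppose that for every n ≥ 0 and every class ζ ∈ H^n(H,k) there exists an integer r ≥ 0 such that the cup-product power ζ^{p^r} ∈ H^{n·p^r}(H,k) lies in the image of the restriction map res: H^{n·p^r}(G,k) → H^{n·p^r}(H,k). Then H controls p-fusion in G: for every subgroup Q of P and every g ∈ G with gQg⁻¹ ≤ P, there exists h ∈ H such that hxh⁻¹ = gxg⁻¹ for all x ∈ Q. -/

import Mathlib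

/-!
**Statement 0**: Mislin's theorem for odd primes (group-realized case of Theorem 1.1 of
"A theorem of Mislin for cohomology of fusion systems and applications to block algebras
of finite groups").

We set up the standard complex of inhomogeneous cochains with trivial coefficients in a
field `k` of characteristic `p`: `d` is the usual differential, `cocycles`/`coboundaries`
are its kernel/image, `cohomology` is the quotient `H^n(G,k)`, `resCochain` and
`resCohomology` are the restriction maps induced by a group homomorphism (below, the
inclusion of a subgroup), and `cup`/`cupPow` are the cup product and its iterated powers
on cochains.  The hypothesis of the theorem says: every class `ζ ∈ H^n(H,k)` has a
`p^r`-th cup power lying in the image of restriction from `H^{n·p^r}(G,k)`, expressed via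
a cocycle representative `z` of `ζ`: some `G`-cocycle `w` satisfies
`res(w) ≡ z^{⌣ p^r}` modulo coboundaries.  The conclusion is that `H` controls
`p`-fusion in `G`.
-/

namespace MislinExplicit

universe u

variable (k : Type u) [Field k]

/-- The differential on inhomogeneous `n`-cochains of a group `G` with trivial
coefficients in `k`:
`(d F)(g₀, …, gₙ) = F(g₁, …, gₙ) + ∑ᵢ (-1)^{i+1} F(g₀, …, gᵢ₋₁gᵢ, …, gₙ)`
(the last summand being `(-1)^{n+1} F(g₀, …, g_{n-1})`). -/
def d (G : Type u) [Group G] (n : ℕ) : ((Fin n → G) → k) →ₗ[k] ((Fin (n + 1) → G) → k) where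
  toFun F x := F (fun i => x i.succ) +
    ∑ j : Fin (n + 1), (-1 : k) ^ ((j : ℕ) + 1) • F (Fin.contractNth j (· * ·) x)
  map_add' F F' := by
    funext x
    simp only [Pi.add_apply, smul_add, Finset.sum_add_distrib]
    exact add_add_add_comm _ _ _ _
  map_smul' r F := by
    funext x
    simp only [Pi.smul_apply, smul_eq_mul, RingHom.id_apply, mul_add, Finset.mul_sum]
    congr 1
    exact Finset.sum_congr rfl fun j _ => by ring

/-- The `n`-cocycles `Z^n(G,k)`. -/
def cocycles (G : Type u) [Group G] (n : ℕ) : Submodule k ((Fin n → G) → k) :=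
  LinearMap.ker (d k G n)

/-- The `n`-coboundaries `B^n(G,k)`. -/
def coboundaries (G : Type u) [Group G] : (n : ℕ) → Submodule k ((Fin n → G) → k)
  | 0 => ⊥
  | n + 1 => LinearMap.range (d k G n)

/-- The group cohomology `H^n(G,k) = Z^n(G,k)/B^n(G,k)` with trivial coefficients. -/
abbrev cohomology (G : Type u) [Group G] (n : ℕ) :=
  cocycles k G n ⧸ ((coboundaries k G n).comap (cocycles k G n).subtype)

variable {A B : Type u} [Group A] [Group B]

/-- Restriction of cochains along a group homomorphism `f : B →* A`. -/
def resCochain (f : B →* A) (n : ℕ) : ((Fin n → A) → k) →ₗ[k] ((Fin n → B) → k) where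
  toFun F x := F (fun i => f (x i))
  map_add' _ _ := rfl
  map_smul' _ _ := rfl

lemma d_resCochain (f : B →* A) (n : ℕ) (F : (Fin n → A) → k) :
    d k B n (resCochain k f n F) = resCochain k f (n + 1) (d k A n F) := by
  funext x
  simp only [d, resCochain, LinearMap.coe_mk, AddHom.coe_mk]
  congr 1
  refine Finset.sum_congr rfl fun j _ => ?_
  refine congrArg (fun y => ((-1 : k) ^ ((j : ℕ) + 1) • y)) (congrArg F (funext fun i => ?_))
  unfold Fin.contractNth
  split_ifs <;> simp [map_mul]

lemma resCochain_mem_cocycles (f : B →* A) (n : ℕ) {F : (Fin n → A) → k}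
    (hF : F ∈ cocycles k A n) : resCochain k f n F ∈ cocycles k B n := by
  have : d k A n F = 0 := hF
  simp only [cocycles, LinearMap.mem_ker, d_resCochain, this, map_zero]

lemma resCochain_mem_coboundaries (f : B →* A) (n : ℕ) {F : (Fin n → A) → k}
    (hF : F ∈ coboundaries k A n) : resCochain k f n F ∈ coboundaries k B n := by
  match n with
  | 0 =>
    obtain rfl : F = 0 := hF
    simp only [map_zero]
    exact Submodule.zero_mem _
  | n + 1 =>
    obtain ⟨F', rfl⟩ := hF
    exact ⟨resCochain k f n F', d_resCochain k f n F'⟩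

/-- Restriction on cocycles. -/
def resCocycles (f : B →* A) (n : ℕ) : cocycles k A n →ₗ[k] cocycles k B n :=
  (resCochain k f n).restrict fun F hF => resCochain_mem_cocycles k f n hF

/-- The restriction map `res : H^n(A,k) → H^n(B,k)` induced by a group homomorphism
`f : B →* A` (below, the inclusion of a subgroup). -/
def resCohomology (f : B →* A) (n : ℕ) : cohomology k A n →ₗ[k] cohomology k B n :=
  Submodule.mapQ _ _ (resCocycles k f n) fun z hz =>
    resCochain_mem_coboundaries k f n hz

/-- The cup product of an `m`-cochain and an `n`-cochain (trivial coefficients):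
`(F ⌣ F')(g₁, …, g_{m+n}) = F(g₁, …, g_m) · F'(g_{m+1}, …, g_{m+n})`. -/
def cup {G : Type u} {m n : ℕ} (F : (Fin m → G) → k) (F' : (Fin n → G) → k) :
    (Fin (m + n) → G) → k :=
  fun x => F (fun i => x (Fin.castAdd n i)) * F' (fun i => x (Fin.natAdd m i))

/-- Reindexing of cochains along an equality of degrees. -/
def castCochain {G : Type u} {m m' : ℕ} (h : m = m') (F : (Fin m → G) → k) :
    (Fin m' → G) → k :=
  fun x => F (fun i => x (Fin.cast h i))

/-- The `N`-th cup-product power `F^{⌣ N}` of an `n`-cochain `F`, an `n·N`-cochain. -/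
def cupPow {G : Type u} {n : ℕ} (F : (Fin n → G) → k) : (N : ℕ) → ((Fin (n * N) → G) → k)
  | 0 => castCochain k (by ring) (fun _ : Fin 0 → G => (1 : k))
  | N + 1 => castCochain k (by ring) (cup k F (cupPow F N))

section Cochains

variable {Γ M M' : Type*} [Group Γ] [AddCommGroup M'] [AddCommGroup M]

/-- The part of the inhomogeneous differential which does not involve the action. -/
def contrD {n : ℕ} (F : (Fin n → Γ) → M) (x : Fin (n + 1) → Γ) : M :=
  ∑ j : Fin (n + 1), (-1 : ℤ) ^ ((j : ℕ) + 1) • F (Fin.contractNth j (· * ·) x)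

/-- Partial evaluation of a function of `n + 1` variables at its first variable. -/
def slot {X M : Type*} {n : ℕ} (g : X) (F : (Fin (n + 1) → X) → M) (r : Fin n → X) : M :=
  F (Fin.cons g r)

lemma contrD_zero (F : (Fin 0 → Γ) → M) (x : Fin 1 → Γ) : contrD F x = -F ![] := by
  simp [contrD, Subsingleton.elim (Fin.contractNth _ _ x) ![]]

lemma contractNth_zero_cons {n : ℕ} (g : Γ) (r : Fin (n + 1) → Γ) :
    Fin.contractNth 0 (· * ·) (Fin.cons g r : Fin (n + 2) → Γ) =
      (Fin.cons (g * r 0) (Fin.tail r) : Fin (n + 1) → Γ) := by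
  funext i
  refine Fin.cases ?_ (fun i => ?_) i
  · simp [Fin.contractNth]
  · simp [Fin.contractNth, Fin.tail]

lemma contractNth_succ_cons {n : ℕ} (j : Fin (n + 1)) (g : Γ) (r : Fin (n + 1) → Γ) :
    Fin.contractNth j.succ (· * ·) (Fin.cons g r : Fin (n + 2) → Γ) =
      (Fin.cons g (Fin.contractNth j (· * ·) r) : Fin (n + 1) → Γ) := by
  funext i
  refine Fin.cases ?_ (fun i => ?_) i
  · simp [Fin.contractNth]
  · simp only [Fin.contractNth, Fin.val_succ, add_lt_add_iff_right, Fin.cons_succ,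
      add_left_inj, ← Fin.succ_castSucc]

lemma contrD_cons {n : ℕ} (F : (Fin (n + 1) → Γ) → M) (g : Γ) (r : Fin (n + 1) → Γ) :
    contrD F (Fin.cons g r) = -F (Fin.cons (g * r 0) (Fin.tail r)) - contrD (slot g F) r := by
  rw [contrD, Fin.sum_univ_succ, contractNth_zero_cons]
  simp only [contractNth_succ_cons, contrD, slot, Fin.val_succ, sub_eq_add_neg,
    ← Finset.sum_neg_distrib, Fin.val_zero, zero_add, pow_one, neg_smul, one_smul]
  congr 1
  refine Finset.sum_congr rfl fun j _ => ?_
  rw [pow_succ, mul_neg_one, neg_smul]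

lemma contrD_add {n : ℕ} (F F' : (Fin n → Γ) → M) : contrD (F + F') = contrD F + contrD F' := by
  funext x
  simp [contrD, Finset.sum_add_distrib]

lemma contrD_sub {n : ℕ} (F F' : (Fin n → Γ) → M) : contrD (F - F') = contrD F - contrD F' := by
  funext x
  simp [contrD, smul_sub]

lemma contrD_neg {n : ℕ} (F : (Fin n → Γ) → M) : contrD (-F) = -contrD F := by
  funext x
  simp [contrD]

lemma map_contrD {n : ℕ} (f : M →+ M') (F : (Fin n → Γ) → M) (x : Fin (n + 1) → Γ) :
    f (contrD F x) = contrD (fun r => f (F r)) x := by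
  simp only [contrD, map_sum, map_zsmul]

lemma contrD_comp {Δ : Type*} [Group Δ] (ψ : Δ →* Γ) {n : ℕ} (F : (Fin n → Γ) → M)
    (x : Fin (n + 1) → Δ) : contrD F (ψ ∘ x) = contrD (fun r => F (ψ ∘ r)) x := by
  simp only [contrD]
  refine Finset.sum_congr rfl fun j _ => ?_
  rw [Fin.comp_contractNth (· * ·) (· * ·) (map_mul ψ)]

lemma slot_contrD {n : ℕ} (F : (Fin (n + 1) → Γ) → M) (g : Γ) (r : Fin (n + 1) → Γ) :
    slot g (contrD F) r = -slot (g * r 0) F (Fin.tail r) - contrD (slot g F) r :=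
  contrD_cons F g r

lemma contrD_contrD {n : ℕ} (F : (Fin n → Γ) → M) (x : Fin (n + 2) → Γ) :
    contrD (contrD F) x = 0 := by
  induction n with
  | zero =>
    rw [← Fin.cons_self_tail x, contrD_cons, contrD_zero, contrD_zero]
    simp only [slot, contrD_zero, sub_self]
  | succ n ih =>
    obtain ⟨g, r, rfl⟩ : ∃ g r, x = Fin.cons g r := ⟨_, _, (Fin.cons_self_tail x).symm⟩
    obtain ⟨h, s, rfl⟩ : ∃ g s, r = Fin.cons g s := ⟨_, _, (Fin.cons_self_tail r).symm⟩
    have h1 : slot g (contrD F) =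
        (fun r => -slot (g * r 0) F (Fin.tail r)) - contrD (slot g F) := by
      funext r
      exact slot_contrD F g r
    rw [contrD_cons, h1, contrD_sub, Pi.sub_apply, ih (slot g F), sub_zero]
    simp only [Fin.cons_zero, Fin.tail_cons]
    rw [contrD_cons, contrD_cons]
    have h2 : slot h (fun r : Fin (n + 1) → Γ => -slot (g * r 0) F (Fin.tail r)) =
        -slot (g * h) F := by
      funext r
      simp [slot]
    rw [h2, contrD_neg]
    simp only [slot, mul_assoc, Pi.neg_apply, Fin.cons_zero, Fin.tail_cons]
    abel

/-- The inhomogeneous differential with coefficients in a representation. -/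
def dRep {R : Type*} [CommRing R] [Module R M] (ρ : Representation R Γ M) {n : ℕ}
    (F : (Fin n → Γ) → M) (x : Fin (n + 1) → Γ) : M :=
  ρ (x 0) (F (Fin.tail x)) + contrD F x

lemma dRep_dRep {R : Type*} [CommRing R] [Module R M] (ρ : Representation R Γ M) {n : ℕ}
    (F : (Fin n → Γ) → M) (x : Fin (n + 2) → Γ) : dRep ρ (dRep ρ F) x = 0 := by
  obtain ⟨g, r, rfl⟩ : ∃ g r, x = Fin.cons g r := ⟨_, _, (Fin.cons_self_tail x).symm⟩
  have h0 : dRep ρ F = (fun x => ρ (x 0) (F (Fin.tail x))) + contrD F := rfl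
  have h1 : slot g (fun x : Fin (n + 1) → Γ => ρ (x 0) (F (Fin.tail x))) =
      fun r => ρ g (F r) := by
    funext r
    simp [slot]
  rw [dRep, h0, contrD_add, Pi.add_apply, Pi.add_apply, contrD_contrD, contrD_cons, h1]
  have h2 := map_contrD (ρ g).toAddMonoidHom F r
  simp only [LinearMap.toAddMonoidHom_coe] at h2
  simp [h2, map_mul]

lemma d_apply {G : Type u} [Group G] {n : ℕ} (F : (Fin n → G) → k) (x : Fin (n + 1) → G) :
    d k G n F x = F (Fin.tail x) + contrD F x := by
  simp only [d, LinearMap.coe_mk, AddHom.coe_mk, contrD]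
  congr 1
  refine Finset.sum_congr rfl fun j _ => ?_
  rw [zsmul_eq_mul, smul_eq_mul]
  push_cast
  rfl

end Cochains

section Evaluation

variable {R Γ M M' : Type*} [CommRing R] [AddCommGroup M'] [Module R M']
  [AddCommGroup M] [Module R M]

/-- The linear extension of a function to the monoid algebra. -/
noncomputable def pair (φ : Γ → M) : MonoidAlgebra R Γ →ₗ[R] M where
  toFun y := Finsupp.linearCombination R φ y.coeff
  map_add' x y := by simp
  map_smul' c y := by simp

@[simp] lemma pair_single (φ : Γ → M) (g : Γ) (c : R) :
    pair φ (MonoidAlgebra.single g c) = c • φ g := by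
  simp [pair]

lemma map_pair (f : M →ₗ[R] M') (φ : Γ → M) (y : MonoidAlgebra R Γ) :
    f (pair φ y) = pair (fun g => f (φ g)) y := by
  induction y using MonoidAlgebra.induction_linear with
  | zero => simp
  | add x y hx hy => simp [hx, hy]
  | single g c => simp

lemma pair_add (φ φ' : Γ → M) (y : MonoidAlgebra R Γ) :
    pair (fun g => φ g + φ' g) y = pair φ y + pair φ' y := by
  induction y using MonoidAlgebra.induction_linear with
  | zero => simp
  | add x y hx hy => rw [map_add, hx, hy, map_add, map_add]; abel
  | single g c => simp

lemma pair_neg (φ : Γ → M) (y : MonoidAlgebra R Γ) :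
    pair (fun g => -φ g) y = -pair φ y := by
  induction y using MonoidAlgebra.induction_linear with
  | zero => simp
  | add x y hx hy => rw [map_add, hx, hy, map_add]; abel
  | single g c => simp

lemma pair_sub (φ φ' : Γ → M) (y : MonoidAlgebra R Γ) :
    pair (fun g => φ g - φ' g) y = pair φ y - pair φ' y := by
  simp only [sub_eq_add_neg]
  rw [pair_add, pair_neg]

lemma pair_mem {N : Submodule R M} {φ : Γ → M} (h : ∀ g, φ g ∈ N) (y : MonoidAlgebra R Γ) :
    pair φ y ∈ N := by
  induction y using MonoidAlgebra.induction_linear with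
  | zero => simp
  | add x y hx hy => rw [map_add]; exact N.add_mem hx hy
  | single g c => rw [pair_single]; exact N.smul_mem _ (h g)

lemma pair_sum {ι : Type*} (s : Finset ι) (φ : ι → Γ → M) (y : MonoidAlgebra R Γ) :
    pair (fun g => ∑ i ∈ s, φ i g) y = ∑ i ∈ s, pair (φ i) y := by
  induction y using MonoidAlgebra.induction_linear with
  | zero => simp
  | add x y hx hy => simp only [map_add, hx, hy, Finset.sum_add_distrib]
  | single g c => simp [Finset.smul_sum]

lemma pair_apply {Y : Type*} (φ : Γ → Y → M) (y : MonoidAlgebra R Γ) (i : Y) :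
    pair φ y i = pair (fun g => φ g i) y :=
  map_pair (LinearMap.proj (R := R) (φ := fun _ : Y => M) i) φ y

lemma pair_mul_left (c : R) (φ : Γ → R) (y : MonoidAlgebra R Γ) :
    pair (fun g => c * φ g) y = c * pair φ y :=
  (map_pair (LinearMap.mulLeft R c) φ y).symm

lemma pair_mul_right (c : R) (φ : Γ → R) (y : MonoidAlgebra R Γ) :
    pair (fun g => φ g * c) y = pair φ y * c :=
  (map_pair (LinearMap.mulRight R c) φ y).symm

/-- The augmentation of the monoid algebra. -/
noncomputable def aug : MonoidAlgebra R Γ →ₗ[R] R := pair fun _ => 1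

lemma pair_const (m : M) (y : MonoidAlgebra R Γ) :
    pair (fun _ => m) y = aug y • m := by
  induction y using MonoidAlgebra.induction_linear with
  | zero => simp
  | add x y hx hy => rw [map_add, hx, hy, map_add, add_smul]
  | single g c => simp [aug]

/-- Partial evaluation at an element of the monoid algebra. -/
noncomputable def slotAlg {n : ℕ} (y : MonoidAlgebra R Γ) (F : (Fin (n + 1) → Γ) → M)
    (r : Fin n → Γ) : M :=
  pair (fun g => F (Fin.cons g r)) y

/-- The element of the monoid algebra used in the `n`-th step of the evaluation. -/
noncomputable def ys (y z : MonoidAlgebra R Γ) (n : ℕ) : MonoidAlgebra R Γ :=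
  if Even n then y else z

/-- Evaluation of cochains at the alternating sequence `…, z, y, z, y`. -/
noncomputable def ev (y z : MonoidAlgebra R Γ) : (n : ℕ) → ((Fin n → Γ) → M) → M
  | 0, F => F ![]
  | n + 1, F => ev y z n (slotAlg (ys y z n) F)

lemma map_ev (f : M →ₗ[R] M') (y z : MonoidAlgebra R Γ) (n : ℕ) (F : (Fin n → Γ) → M) :
    f (ev y z n F) = ev y z n (fun r => f (F r)) := by
  induction n with
  | zero => rfl
  | succ n ih =>
    rw [ev, ih, ev]
    congr 1
    funext r
    exact map_pair _ _ _

lemma ev_add (y z : MonoidAlgebra R Γ) (n : ℕ) (F F' : (Fin n → Γ) → M) :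
    ev y z n (F + F') = ev y z n F + ev y z n F' := by
  induction n with
  | zero => rfl
  | succ n ih =>
    rw [ev, ev, ev, ← ih]
    congr 1
    funext r
    exact pair_add _ _ _

lemma ev_neg (y z : MonoidAlgebra R Γ) (n : ℕ) (F : (Fin n → Γ) → M) :
    ev y z n (-F) = -ev y z n F := by
  induction n with
  | zero => rfl
  | succ n ih =>
    rw [ev, ev, ← ih]
    congr 1
    funext r
    exact pair_neg _ _

lemma ev_sub (y z : MonoidAlgebra R Γ) (n : ℕ) (F F' : (Fin n → Γ) → M) :
    ev y z n (F - F') = ev y z n F - ev y z n F' := by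
  rw [sub_eq_add_neg, ev_add, ev_neg, sub_eq_add_neg]

lemma ev_mem {N : Submodule R M} (y z : MonoidAlgebra R Γ) (n : ℕ) {F : (Fin n → Γ) → M}
    (h : ∀ r, F r ∈ N) : ev y z n F ∈ N := by
  induction n with
  | zero => exact h _
  | succ n ih => exact ih fun r => pair_mem (fun g => h _) _

lemma slotAlg_slotAlg_mul [Mul Γ] {n : ℕ} (y z : MonoidAlgebra R Γ)
    (G : (Fin (n + 1) → Γ) → M) (r : Fin n → Γ) :
    slotAlg z (fun s : Fin (n + 1) → Γ =>
      pair (fun g => G (Fin.cons (g * s 0) (Fin.tail s))) y) r = slotAlg (y * z) G r := by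
  simp only [slotAlg, Fin.cons_zero, Fin.tail_cons]
  induction z using MonoidAlgebra.induction_linear with
  | zero => simp
  | add x y hx hy => simp only [map_add, mul_add, hx, hy]
  | single h c =>
    rw [pair_single]
    induction y using MonoidAlgebra.induction_linear with
    | zero => simp
    | add x y hx hy => simp only [map_add, add_mul, hx, hy, smul_add]
    | single g c => simp [MonoidAlgebra.single_mul_single, mul_smul, smul_comm c]

variable [Group Γ]

lemma slotAlg_contrD {n : ℕ} (y : MonoidAlgebra R Γ) (G : (Fin (n + 1) → Γ) → M) :
    slotAlg y (contrD G) =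
      -(fun s : Fin (n + 1) → Γ => pair (fun g => G (Fin.cons (g * s 0) (Fin.tail s))) y) -
        contrD (slotAlg y G) := by
  funext s
  simp only [slotAlg, contrD_cons]
  rw [pair_sub, pair_neg]
  simp only [Pi.sub_apply, Pi.neg_apply]
  congr 1
  simp only [contrD, slot]
  induction y using MonoidAlgebra.induction_linear with
  | zero => simp [slotAlg]
  | add x y hx hy => simp only [map_add, hx, hy, slotAlg, smul_add, Finset.sum_add_distrib]
  | single g c => simp [slotAlg, Finset.smul_sum, smul_comm c]

lemma ev_contrD {y z : MonoidAlgebra R Γ} (hy : aug y = 1) (hyz : y * z = z) (hzy : z * y = z)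
    (n : ℕ) (G : (Fin n → Γ) → M) :
    ev y z (n + 1) (contrD G) = if Even n then -ev y z n G else 0 := by
  induction n with
  | zero =>
    simp only [ev, slotAlg, contrD_zero, ys, Even.zero, if_true]
    rw [pair_const, hy, one_smul]
  | succ m ih =>
    have hmul : ys y z (m + 1) * ys y z m = z := by
      by_cases hm : Even m <;> simp [ys, hm, Nat.even_add_one, hyz, hzy]
    rw [ev, slotAlg_contrD, ev_sub, ev_neg, ih, ev, funext (slotAlg_slotAlg_mul _ _ G), hmul]
    by_cases hm : Even m <;> simp [ys, hm, Nat.even_add_one, ev]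

lemma pair_rep (ρ : Representation R Γ M) (y : MonoidAlgebra R Γ) (m : M) :
    pair (fun g => ρ g m) y = ρ.asAlgebraHom y m := by
  induction y using MonoidAlgebra.induction_linear with
  | zero => simp
  | add x y hx hy => simp [hx, hy]
  | single g c => simp

lemma ev_dRep (ρ : Representation R Γ M) {y z : MonoidAlgebra R Γ} (hy : aug y = 1)
    (hyz : y * z = z) (hzy : z * y = z) (n : ℕ) (F : (Fin n → Γ) → M) :
    ev y z (n + 1) (dRep ρ F) = ρ.asAlgebraHom (ys (y - 1) z n) (ev y z n F) := by
  have h0 : dRep ρ F = (fun x => ρ (x 0) (F (Fin.tail x))) + contrD F := rfl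
  rw [h0, ev_add, ev_contrD hy hyz hzy, ev]
  have h1 : slotAlg (ys y z n) (fun x : Fin (n + 1) → Γ => ρ (x 0) (F (Fin.tail x))) =
      fun r => ρ.asAlgebraHom (ys y z n) (F r) := by
    funext r
    simp only [slotAlg, Fin.cons_zero, Fin.tail_cons]
    exact pair_rep _ _ _
  rw [h1, ← map_ev]
  by_cases hn : Even n <;> simp [ys, hn, sub_eq_add_neg]

end Evaluation

section Cup

variable {R Γ : Type*} [CommRing R] {G : Type u}

lemma slot_cup_succ {m n : ℕ} (F : (Fin (m + 1) → G) → k) (F' : (Fin n → G) → k)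
    (h : m + 1 + n = (m + n) + 1) (g : G) :
    slot g (castCochain k h (cup k F F')) = cup k (slot g F) F' := by
  funext r
  simp only [slot, castCochain, cup]
  congr 2
  · funext i
    refine Fin.cases ?_ (fun i => ?_) i
    · rfl
    · have : Fin.cast h (Fin.castAdd n i.succ) = (Fin.castAdd n i).succ := by ext; simp
      simp [this]
  · funext i
    have : Fin.cast h (Fin.natAdd (m + 1) i) = (Fin.natAdd m i).succ := by
      ext; simp; omega
    simp [this]

lemma castCochain_cup_zero {n : ℕ} (F : (Fin 0 → G) → k) (F' : (Fin n → G) → k)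
    (h : 0 + n = n) : castCochain k h (cup k F F') = fun r => F ![] * F' r := by
  funext r
  simp only [castCochain, cup]
  congr 2
  · exact Subsingleton.elim _ _
  · funext i
    congr 1
    ext; simp

lemma ev_castCochain {K : Type u} [Field K] {Γ : Type u} (y z : MonoidAlgebra K Γ) {m m' : ℕ}
    (h : m = m') (F : (Fin m → Γ) → K) : ev y z m' (castCochain K h F) = ev y z m F := by
  subst h
  rfl

lemma ev_cup {K : Type u} [Field K] {Γ : Type u} (y z : MonoidAlgebra K Γ) {m n : ℕ}
    (hn : Even n) (F : (Fin m → Γ) → K) (F' : (Fin n → Γ) → K) :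
    ev y z (m + n) (cup K F F') = ev y z m F * ev y z n F' := by
  induction m with
  | zero =>
    rw [← ev_castCochain y z (zero_add n), castCochain_cup_zero]
    exact (map_ev (LinearMap.mulLeft K (F ![])) y z n F').symm
  | succ m ih =>
    have h : m + 1 + n = (m + n) + 1 := by ring
    rw [← ev_castCochain y z h, ev, ev, ← ih]
    have hys : ys y z (m + n) = ys y z m := by
      simp only [ys, Nat.even_add, hn, iff_true]
    rw [hys]
    congr 1
    funext r
    have h1 : ∀ g, castCochain K h (cup K F F') (Fin.cons g r) = cup K (slot g F) F' r :=
      fun g => congrFun (slot_cup_succ K F F' h g) r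
    simp only [slotAlg, h1, cup, slot]
    exact (map_pair (LinearMap.mulRight K (F' fun i => r (Fin.natAdd m i)))
      (fun g => F (Fin.cons g fun i => r (Fin.castAdd n i))) (ys y z m)).symm

end Cup

/-- The conditions on the two group algebra elements which make evaluation well behaved. -/
structure IsEvPair {K Γ : Type*} [CommRing K] [Group Γ] (y z : MonoidAlgebra K Γ) : Prop where
  aug_fst : aug y = 1
  aug_snd : aug z = 0
  fst_mul : y * z = z
  mul_fst : z * y = z

section EvHom

variable {K : Type u} [Field K] [Algebra k K] {Γ : Type u} {G : Type u}

/-- Evaluation of a cochain of `G` along a map into `G`. -/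
noncomputable def evHom (y z : MonoidAlgebra K Γ) (ψ : Γ → G) {n : ℕ}
    (F : (Fin n → G) → k) : K :=
  ev y z n fun r => algebraMap k K (F (ψ ∘ r))

lemma evHom_sub (y z : MonoidAlgebra K Γ) (ψ : Γ → G) {n : ℕ} (F F' : (Fin n → G) → k) :
    evHom k y z ψ (F - F') = evHom k y z ψ F - evHom k y z ψ F' := by
  rw [evHom, evHom, evHom, ← ev_sub]
  congr 1
  funext r
  simp

lemma evHom_castCochain (y z : MonoidAlgebra K Γ) (ψ : Γ → G) {m m' : ℕ} (h : m = m')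
    (F : (Fin m → G) → k) : evHom k y z ψ (castCochain k h F) = evHom k y z ψ F := by
  subst h
  rfl

lemma evHom_cup (y z : MonoidAlgebra K Γ) (ψ : Γ → G) {m n : ℕ} (hn : Even n)
    (F : (Fin m → G) → k) (F' : (Fin n → G) → k) :
    evHom k y z ψ (cup k F F') = evHom k y z ψ F * evHom k y z ψ F' := by
  rw [evHom, evHom, evHom, ← ev_cup _ _ hn]
  congr 1
  funext r
  simp only [cup, map_mul]
  rfl

lemma evHom_cupPow (y z : MonoidAlgebra K Γ) (ψ : Γ → G) {n : ℕ} (hn : Even n)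
    (F : (Fin n → G) → k) (N : ℕ) :
    evHom k y z ψ (cupPow k F N) = evHom k y z ψ F ^ N := by
  induction N with
  | zero =>
    rw [cupPow, evHom_castCochain, pow_zero]
    exact map_one _
  | succ N ih =>
    rw [cupPow, evHom_castCochain, evHom_cup _ _ _ _ (hn.mul_right N), ih, pow_succ']

variable [Group Γ] [Group G]

lemma asAlgebraHom_one_apply {R M : Type*} [CommRing R] [AddCommGroup M] [Module R M]
    (y : MonoidAlgebra R Γ) (m : M) :
    Representation.asAlgebraHom (1 : Representation R Γ M) y m = aug y • m := by
  rw [← pair_rep, ← pair_const]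
  rfl

lemma aug_one {R : Type*} [CommRing R] : aug (1 : MonoidAlgebra R Γ) = 1 := by
  simp [aug, MonoidAlgebra.one_def]

lemma evHom_d {y z : MonoidAlgebra K Γ} (hyz : IsEvPair y z) (ψ : Γ →* G) {n : ℕ}
    (F : (Fin n → G) → k) : evHom k y z ψ (d k G n F) = 0 := by
  have h : (fun r : Fin (n + 1) → Γ => algebraMap k K (d k G n F (ψ ∘ r))) =
      dRep (1 : Representation K Γ K) (fun r => algebraMap k K (F (ψ ∘ r))) := by
    funext r
    rw [d_apply, contrD_comp, map_add, dRep]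
    exact congrArg _ (map_contrD (algebraMap k K).toAddMonoidHom _ _)
  rw [evHom, h, ev_dRep _ hyz.aug_fst hyz.fst_mul hyz.mul_fst, asAlgebraHom_one_apply]
  by_cases hn : Even n <;> simp [ys, hn, hyz.aug_fst, hyz.aug_snd, aug_one]

lemma evHom_coboundary {y z : MonoidAlgebra K Γ} (hyz : IsEvPair y z) (ψ : Γ →* G) {n : ℕ}
    {F : (Fin n → G) → k} (hF : F ∈ coboundaries k G n) : evHom k y z ψ F = 0 := by
  match n with
  | 0 =>
    obtain rfl : F = 0 := hF
    simp [evHom, ev]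
  | n + 1 =>
    obtain ⟨F', rfl⟩ := hF
    exact evHom_d k hyz ψ F'

end EvHom

section Conjugation

variable {Γ M : Type*} [Group Γ] [AddCommGroup M]

/-- The prism operator giving the homotopy between the identity and conjugation. -/
def prism (γ : Γ) : (n : ℕ) → ((Fin (n + 1) → Γ) → M) → ((Fin n → Γ) → M)
  | 0, F => fun _ => F ![γ]
  | n + 1, F => fun x =>
      F (Fin.cons γ (MulAut.conj γ⁻¹ ∘ x)) - prism γ n (slot (x 0) F) (Fin.tail x)

lemma prism_add (γ : Γ) (n : ℕ) (F F' : (Fin (n + 1) → Γ) → M) :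
    prism γ n (F + F') = prism γ n F + prism γ n F' := by
  induction n with
  | zero => rfl
  | succ n ih =>
    funext x
    have : slot (x 0) (F + F') = slot (x 0) F + slot (x 0) F' := rfl
    simp only [prism, this, ih, Pi.add_apply]
    abel

lemma prism_neg (γ : Γ) (n : ℕ) (F : (Fin (n + 1) → Γ) → M) :
    prism γ n (-F) = -prism γ n F := by
  induction n with
  | zero => rfl
  | succ n ih =>
    funext x
    have : slot (x 0) (-F) = -slot (x 0) F := rfl
    simp only [prism, this, ih, Pi.neg_apply]
    abel

lemma prism_sub (γ : Γ) (n : ℕ) (F F' : (Fin (n + 1) → Γ) → M) :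
    prism γ n (F - F') = prism γ n F - prism γ n F' := by
  rw [sub_eq_add_neg, prism_add, prism_neg, sub_eq_add_neg]

lemma comp_cons' {X Y : Type*} {n : ℕ} (f : X → Y) (a : X) (r : Fin n → X) :
    f ∘ (Fin.cons a r : Fin (n + 1) → X) = Fin.cons (f a) (f ∘ r) := by
  funext i
  refine Fin.cases ?_ (fun i => ?_) i <;> simp

lemma prism_cons (γ : Γ) (n : ℕ) (F : (Fin (n + 2) → Γ) → M) (a : Γ) (r : Fin n → Γ) :
    prism γ (n + 1) F (Fin.cons a r) =
      F (Fin.cons γ (Fin.cons (MulAut.conj γ⁻¹ a) (MulAut.conj γ⁻¹ ∘ r))) -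
        prism γ n (slot a F) r := by
  simp only [prism, comp_cons', Fin.cons_zero, Fin.tail_cons]

lemma prism_contrD (γ : Γ) (n : ℕ) (F : (Fin (n + 1) → Γ) → M) (x : Fin (n + 1) → Γ) :
    prism γ (n + 1) (contrD F) x + contrD (prism γ n F) x = -F x := by
  have hγ : ∀ a, γ * MulAut.conj γ⁻¹ a = a * γ := fun a => by simp [mul_assoc]
  obtain ⟨a, r, rfl⟩ : ∃ g r, x = Fin.cons g r := ⟨_, _, (Fin.cons_self_tail x).symm⟩
  induction n generalizing a with
  | zero =>
    rw [prism_cons, contrD_cons, contrD_zero]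
    simp only [prism, slot, Fin.cons_zero, hγ, contrD_zero]
    have h1 : (![γ] : Fin 1 → Γ) = Fin.cons γ ![] := rfl
    rw [contrD_cons, contrD_zero]
    simp only [slot, Subsingleton.elim r ![], Fin.tail_cons, h1, Fin.cons_zero,
      Subsingleton.elim (Fin.tail (Fin.cons γ ![] : Fin 1 → Γ)) ![],
      Subsingleton.elim ((MulAut.conj γ⁻¹ : Γ → Γ) ∘ (![] : Fin 0 → Γ)) ![]]
    abel
  | succ n ih =>
    obtain ⟨b, t, rfl⟩ : ∃ g s, r = Fin.cons g s := ⟨_, _, (Fin.cons_self_tail r).symm⟩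
    have h1 : slot a (contrD F) =
        -(fun s => F (Fin.cons (a * s 0) (Fin.tail s))) - contrD (slot a F) := by
      funext s
      exact slot_contrD F a s
    have h2 : slot b (fun s : Fin (n + 2) → Γ => F (Fin.cons (a * s 0) (Fin.tail s))) =
        slot (a * b) F := by
      funext s
      simp [slot]
    have h3 : slot a (prism γ (n + 1) F) =
        (fun s => slot (MulAut.conj γ⁻¹ a) (slot γ F) (MulAut.conj γ⁻¹ ∘ s)) -
          prism γ n (slot a F) := by
      funext s
      exact prism_cons γ n F a s
    have h4 := ih (slot a F) b t
    rw [prism_cons, contrD_cons, h1, prism_sub, prism_neg, contrD_cons (prism γ (n + 1) F), h3,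
      contrD_sub]
    simp only [Pi.sub_apply, Pi.neg_apply]
    rw [eq_sub_of_add_eq h4, prism_cons, h2, Fin.cons_zero, Fin.cons_zero, Fin.tail_cons,
      Fin.tail_cons, hγ, comp_cons', contrD_cons (slot γ F)]
    have h5 := contrD_comp (MulAut.conj γ⁻¹).toMonoidHom
      (slot (MulAut.conj γ⁻¹ a) (slot γ F)) (Fin.cons b t)
    have h6 : ((MulAut.conj γ⁻¹).toMonoidHom : Γ → Γ) = MulAut.conj γ⁻¹ := rfl
    rw [h6, comp_cons'] at h5
    rw [← h5, Fin.cons_zero, Fin.tail_cons, prism_cons, map_mul]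
    simp only [Fin.cons_zero, Fin.tail_cons, slot]
    abel

lemma conj_sub_mem_coboundaries {G : Type u} [Group G] (γ : G) {n : ℕ} {w : (Fin n → G) → k}
    (hw : w ∈ cocycles k G n) :
    resCochain k (MulAut.conj γ⁻¹).toMonoidHom n w - w ∈ coboundaries k G n := by
  match n with
  | 0 =>
    have : resCochain k (MulAut.conj γ⁻¹).toMonoidHom 0 w = w := by
      funext x
      exact congrArg w (Subsingleton.elim _ _)
    rw [this, sub_self]
    exact Submodule.zero_mem _
  | n + 1 =>
    refine ⟨prism γ n w, ?_⟩
    have h0 : (fun x : Fin (n + 2) → G => w (Fin.tail x)) + contrD w = 0 := by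
      funext x
      exact (d_apply k w x).symm.trans (congrFun hw x)
    funext x
    have h1 := congrFun (congrArg (prism γ (n + 1)) h0) x
    rw [prism_add, Pi.add_apply, eq_sub_of_add_eq (prism_contrD γ n w x)] at h1
    have h2 : prism γ (n + 1) (0 : (Fin (n + 2) → G) → k) = 0 := by
      have := prism_add γ (n + 1) (0 : (Fin (n + 2) → G) → k) 0
      rwa [add_zero, left_eq_add] at this
    have h3 : prism γ (n + 1) (fun x : Fin (n + 2) → G => w (Fin.tail x)) x =
        w (MulAut.conj γ⁻¹ ∘ x) - prism γ n w (Fin.tail x) := by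
      rw [prism]
      simp only [Fin.tail_cons]
      rfl
    rw [h2, h3] at h1
    rw [d_apply]
    change _ = w (MulAut.conj γ⁻¹ ∘ x) - w x
    simp only [Pi.zero_apply] at h1
    linear_combination -h1

end Conjugation

section PermRep

variable {K Γ Y : Type*} [CommRing K] [Group Γ] [MulAction Γ Y]

/-- The representation on functions on a set with group action. -/
def permRep (K Γ Y : Type*) [CommRing K] [Group Γ] [MulAction Γ Y] :
    Representation K Γ (Y → K) where
  toFun g := LinearMap.funLeft K K fun y => g⁻¹ • y
  map_one' := by
    ext f y
    simp [LinearMap.funLeft]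
  map_mul' g h := by
    refine LinearMap.ext fun f => funext fun y => ?_
    simp [LinearMap.funLeft, mul_smul]

@[simp] lemma permRep_apply (g : Γ) (f : Y → K) (y : Y) : permRep K Γ Y g f y = f (g⁻¹ • y) := rfl

lemma permRep_asAlgebraHom (x : MonoidAlgebra K Γ) (f : Y → K) (y : Y) :
    (permRep K Γ Y).asAlgebraHom x f y = pair (fun g => f (g⁻¹ • y)) x := by
  rw [← pair_rep, pair_apply]
  rfl

end PermRep

section Transfer

variable {Γ : Type*} [Group Γ] (S : Subgroup Γ)

/-- The cocycle `Γ → S` associated with the chosen coset representatives. -/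
noncomputable def kap (y : Γ ⧸ S) (g : Γ) : S :=
  ⟨y.out⁻¹ * g * (g⁻¹ • y).out, by
    have h : ((g * (g⁻¹ • y).out : Γ) : Γ ⧸ S) = y := by
      rw [← smul_eq_mul, MulAction.Quotient.mk_smul_out, smul_inv_smul]
    rw [mul_assoc, ← QuotientGroup.eq, QuotientGroup.out_eq', h]⟩

lemma kap_mul (y : Γ ⧸ S) (g h : Γ) : kap S y g * kap S (g⁻¹ • y) h = kap S y (g * h) := by
  ext
  simp only [kap, Subgroup.coe_mul, mul_inv_rev, mul_smul]
  group

/-- The cocycle `kap` applied to a tuple of group elements. -/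
noncomputable def ktup : (n : ℕ) → (Γ ⧸ S) → (Fin n → Γ) → (Fin n → S)
  | 0, _, _ => ![]
  | n + 1, y, x => Fin.cons (kap S y (x 0)) (ktup n ((x 0)⁻¹ • y) (Fin.tail x))

lemma ktup_cons (n : ℕ) (y : Γ ⧸ S) (g : Γ) (r : Fin n → Γ) :
    ktup S (n + 1) y (Fin.cons g r) = Fin.cons (kap S y g) (ktup S n (g⁻¹ • y) r) := by
  rw [ktup, Fin.cons_zero, Fin.tail_cons]

lemma contrD_ktup {M : Type*} [AddCommGroup M] {n : ℕ} (F : (Fin n → S) → M) (y : Γ ⧸ S)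
    (x : Fin (n + 1) → Γ) :
    contrD (fun r => F (ktup S n y r)) x = contrD F (ktup S (n + 1) y x) := by
  induction n generalizing y with
  | zero =>
    rw [contrD_zero, contrD_zero]
    rfl
  | succ n ih =>
    obtain ⟨g, r, rfl⟩ : ∃ g r, x = Fin.cons g r := ⟨_, _, (Fin.cons_self_tail x).symm⟩
    obtain ⟨h, s, rfl⟩ : ∃ g s, r = Fin.cons g s := ⟨_, _, (Fin.cons_self_tail r).symm⟩
    have h1 : slot g (fun r => F (ktup S (n + 1) y r)) =
        fun r => slot (kap S y g) F (ktup S n (g⁻¹ • y) r) := by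
      funext r
      rw [slot, ktup_cons, slot]
    rw [contrD_cons, h1, ih, ktup_cons S (n + 1), contrD_cons, ktup_cons, ktup_cons,
      Fin.cons_zero, Fin.tail_cons, Fin.cons_zero, Fin.tail_cons, kap_mul, mul_inv_rev, mul_smul]

lemma tail_ktup {n : ℕ} (y : Γ ⧸ S) (x : Fin (n + 1) → Γ) :
    Fin.tail (ktup S (n + 1) y x) = ktup S n ((x 0)⁻¹ • y) (Fin.tail x) := by
  rw [ktup, Fin.tail_cons]

end Transfer

section TransferCochain

variable {Γ : Type u} [Group Γ] [Finite Γ] (S : Subgroup Γ)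

/-- The transfer on cochains. -/
noncomputable def transfer {n : ℕ} (ζ : (Fin n → S) → k) (x : Fin n → Γ) : k :=
  ∑ᶠ y : Γ ⧸ S, ζ (ktup S n y x)

lemma cocycle_eq {n : ℕ} {G : Type u} [Group G] {ζ : (Fin n → G) → k} (hζ : ζ ∈ cocycles k G n)
    (x : Fin (n + 1) → G) : ζ (Fin.tail x) + contrD ζ x = 0 :=
  (d_apply k ζ x).symm.trans (congrFun hζ x)

lemma transfer_mem_cocycles {n : ℕ} {ζ : (Fin n → S) → k} (hζ : ζ ∈ cocycles k S n) :
    transfer k S ζ ∈ cocycles k Γ n := by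
  classical
  have := Fintype.ofFinite (Γ ⧸ S)
  have h0 : transfer k S ζ = fun x => ∑ y : Γ ⧸ S, ζ (ktup S n y x) := by
    funext x
    exact finsum_eq_sum_of_fintype _
  change d k Γ n _ = 0
  funext x
  rw [d_apply, h0]
  have h1 : contrD (M := k) (fun x => ∑ y : Γ ⧸ S, ζ (ktup S n y x)) x =
      ∑ y : Γ ⧸ S, contrD ζ (ktup S (n + 1) y x) := by
    simp only [← contrD_ktup S ζ]
    simp only [contrD, Finset.smul_sum]
    exact Finset.sum_comm
  have h2 : ∀ y : Γ ⧸ S, ζ (ktup S n ((x 0)⁻¹ • y) (Fin.tail x)) +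
      contrD ζ (ktup S (n + 1) y x) = 0 := fun y => by
    rw [← tail_ktup]
    exact cocycle_eq k hζ _
  have h3 : ∑ y : Γ ⧸ S, ζ (ktup S n y (Fin.tail x)) =
      ∑ y : Γ ⧸ S, ζ (ktup S n ((x 0)⁻¹ • y) (Fin.tail x)) :=
    (Equiv.sum_comp (MulAction.toPerm (x 0)⁻¹)
      (fun y : Γ ⧸ S => ζ (ktup S n y (Fin.tail x)))).symm
  rw [h1]
  change ∑ y : Γ ⧸ S, ζ (ktup S n y (Fin.tail x)) + _ = 0
  rw [h3, ← Finset.sum_add_distrib]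
  exact Finset.sum_eq_zero fun y _ => h2 y

end TransferCochain

section ElementaryAbelian

variable {p : ℕ} [hp : Fact p.Prime] {E : Type*} [CommGroup E]

lemma exists_addCharacter {V : Type*} [AddCommGroup V] [Module (ZMod p) V]
    (S : AddSubgroup V) {v : V} (hv : v ∉ S) :
    ∃ f : V →+ ZMod p, (∀ s ∈ S, f s = 0) ∧ f v ≠ 0 := by
  have hv' : v ∉ AddSubgroup.toZModSubmodule p S := hv
  obtain ⟨f, hf, hS⟩ := Submodule.exists_le_ker_of_notMem hv'
  exact ⟨f.toAddMonoidHom, fun s hs => hS hs, hf⟩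

lemma exists_character (hE : ∀ a : E, a ^ p = 1) (S : Subgroup E) {a : E} (ha : a ∉ S) :
    ∃ χ : E →* Multiplicative (ZMod p), (∀ s ∈ S, χ s = 1) ∧ χ a ≠ 1 := by
  let _ := AddCommGroup.zmodModule (n := p) (G := Additive E)
    fun x => congrArg Additive.ofMul (hE x.toMul)
  obtain ⟨f, hS, hf⟩ := exists_addCharacter (p := p) (Subgroup.toAddSubgroup S)
    (v := Additive.ofMul a) ha
  exact ⟨AddMonoidHom.toMultiplicativeRight f,
    fun s hs => congrArg Multiplicative.ofAdd (hS _ hs),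
    fun h => hf (congrArg Multiplicative.toAdd h)⟩

variable {K : Type*} [Field K] [CharP K p]

/-- The linear form on the group algebra given by a homomorphism to `ZMod p`. -/
noncomputable def ell (K : Type*) [Field K] [CharP K p] (χ : E →* Multiplicative (ZMod p)) :
    MonoidAlgebra K E →ₗ[K] K :=
  pair fun a => ZMod.castHom (dvd_refl p) K (χ a).toAdd

variable {Y : Type*} [Fintype Y] [MulAction E Y]

lemma sum_orbit_eq_zero (hE : ∀ a : E, a ^ p = 1) {x : MonoidAlgebra K E} (hx : aug x = 1)
    (hgen : ∀ χ : E →* Multiplicative (ZMod p), χ ≠ 1 → ell K χ x ≠ 0)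
    {f : Y → K} (hf : ∀ y, pair (fun a : E => f (a⁻¹ • y)) x = f y) (y₀ : Y)
    (hy₀ : ∃ a : E, a • y₀ ≠ y₀) [DecidablePred (· ∈ MulAction.orbit E y₀)] :
    ∑ y with y ∈ MulAction.orbit E y₀, f y = 0 := by
  classical
  obtain ⟨a₀, ha₀⟩ := hy₀
  obtain ⟨χ, hχ, hχa⟩ := exists_character hE (MulAction.stabilizer E y₀) (a := a₀) ha₀
  have hℓ := hgen χ fun h => hχa (by rw [h]; rfl)
  let c : E → K := fun a => ZMod.castHom (dvd_refl p) K (χ a).toAdd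
  have hc : ∀ a b, c (a * b) = c a + c b := fun a b => by simp [c]
  have hwd : ∀ a b : E, a • y₀ = b • y₀ → c a = c b := fun a b hab => by
    have : χ (b⁻¹ * a) = 1 := hχ _ (by
      rw [MulAction.mem_stabilizer_iff, mul_smul, hab, inv_smul_smul])
    rw [map_mul, map_inv, inv_mul_eq_one] at this
    simp [c, this]
  let t : Y → K := fun y => if h : ∃ a : E, a • y₀ = y then c h.choose else 0
  have ht : ∀ a : E, t (a • y₀) = c a := fun a => by
    have h : ∃ b : E, b • y₀ = a • y₀ := ⟨a, rfl⟩
    simp only [t, dif_pos h]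
    exact hwd _ _ h.choose_spec
  set O : Finset Y := Finset.univ.filter (· ∈ MulAction.orbit E y₀) with hO
  have hOt : ∀ (a : E), ∀ y ∈ O, t (a • y) = c a + t y := by
    intro a y hy
    obtain ⟨b, rfl⟩ := (Finset.mem_filter.mp hy).2
    change t (a • b • y₀) = c a + t (b • y₀)
    rw [← mul_smul, ht, ht, hc]
  have key : ∀ a : E, ∑ y ∈ O, t y * f (a⁻¹ • y) =
      c a * ∑ y ∈ O, f y + ∑ y ∈ O, t y * f y := by
    intro a
    have : ∑ y ∈ O, t y * f (a⁻¹ • y) = ∑ y ∈ O, t (a • y) * f y := by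
      refine Finset.sum_equiv (MulAction.toPerm a⁻¹) (fun y => ?_) (fun y _ => ?_)
      · simp only [hO, Finset.mem_filter, Finset.mem_univ, true_and, MulAction.toPerm_apply,
          ← MulAction.orbit_eq_iff, MulAction.orbit_smul]
      · simp
    rw [this, Finset.mul_sum, ← Finset.sum_add_distrib]
    exact Finset.sum_congr rfl fun y hy => by rw [hOt a y hy, add_mul]
  have h1 : ∑ y ∈ O, t y * f y = ell K χ x * ∑ y ∈ O, f y + ∑ y ∈ O, t y * f y := by
    conv_lhs => rw [← Finset.sum_congr rfl fun y _ => congrArg (t y * ·) (hf y)]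
    simp only [← pair_mul_left]
    rw [← pair_sum]
    simp only [key]
    rw [pair_add, pair_const, hx, one_smul, pair_mul_right]
    rfl
  exact (mul_eq_zero.mp (right_eq_add.mp h1)).resolve_left hℓ


lemma sum_eq_sum_fixed (hE : ∀ a : E, a ^ p = 1) {x : MonoidAlgebra K E} (hx : aug x = 1)
    (hgen : ∀ χ : E →* Multiplicative (ZMod p), χ ≠ 1 → ell K χ x ≠ 0)
    {f : Y → K} (hf : ∀ y, pair (fun a : E => f (a⁻¹ • y)) x = f y)
    [DecidablePred fun y : Y => ∀ a : E, a • y = y] :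
    ∑ y, f y = ∑ y with ∀ a : E, a • y = y, f y := by
  classical
  rw [← Finset.sum_filter_add_sum_filter_not Finset.univ (fun y : Y => ∀ a : E, a • y = y) f,
    add_eq_left, ← Finset.sum_fiberwise _ (fun y => MulAction.orbit E y)]
  refine Finset.sum_eq_zero fun o _ => ?_
  by_cases h : ∃ y₀ : Y, (¬ ∀ a : E, a • y₀ = y₀) ∧ MulAction.orbit E y₀ = o
  · obtain ⟨y₀, hy₀, rfl⟩ := h
    push Not at hy₀
    rw [← sum_orbit_eq_zero hE hx hgen hf y₀ hy₀, Finset.filter_filter]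
    refine Finset.sum_congr (Finset.filter_congr fun y _ => ?_) fun _ _ => rfl
    rw [MulAction.orbit_eq_iff, and_iff_right_iff_imp]
    rintro ⟨b, rfl⟩ h
    obtain ⟨a, ha⟩ := hy₀
    have h1 := h b⁻¹
    have h2 := h a
    simp only [inv_smul_smul] at h1
    exact ha (by simpa [← h1] using h2)
  · refine Finset.sum_eq_zero fun y hy => ?_
    rw [Finset.mem_filter, Finset.mem_filter] at hy
    exact (h ⟨y, hy.1.2, hy.2⟩).elim

end ElementaryAbelian

section TransferEvaluation

variable {K : Type u} [Field K] [Algebra k K] {E Γ : Type u} [CommGroup E] [Group Γ]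
  {S : Subgroup Γ} (α : E →* Γ)

lemma kap_coe (y : Γ ⧸ S) {g : Γ} (hg : g • y = y) : (kap S y g : Γ) = y.out⁻¹ * g * y.out := by
  change y.out⁻¹ * g * (g⁻¹ • y).out = _
  rw [inv_smul_eq_iff.mpr hg.symm]

/-- The homomorphism to the stabilizer given by a fixed point. -/
noncomputable def kapHom (y : Γ ⧸ S) (hy : ∀ a, α a • y = y) : E →* S where
  toFun a := kap S y (α a)
  map_one' := by
    ext
    rw [kap_coe y (hy 1), map_one]
    simp
  map_mul' a b := by
    rw [map_mul, ← kap_mul, inv_smul_eq_iff.mpr (hy a).symm]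

lemma kapHom_coe (y : Γ ⧸ S) (hy : ∀ a, α a • y = y) (a : E) :
    (kapHom α y hy a : Γ) = y.out⁻¹ * α a * y.out := kap_coe y (hy a)

lemma ktup_of_fixed (y : Γ ⧸ S) (hy : ∀ a, α a • y = y) {n : ℕ} (r : Fin n → E) :
    ktup S n y (α ∘ r) = kapHom α y hy ∘ r := by
  induction n with
  | zero => exact Subsingleton.elim _ _
  | succ n ih =>
    obtain ⟨g, r, rfl⟩ : ∃ g s, r = Fin.cons g s := ⟨_, _, (Fin.cons_self_tail r).symm⟩
    rw [comp_cons', comp_cons', ktup_cons, inv_smul_eq_iff.mpr (hy g).symm, ih]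
    rfl

lemma evHom_transfer {p : ℕ} [Fact p.Prime] [CharP K p] [Finite Γ] (hE : ∀ a : E, a ^ p = 1)
    {y z : MonoidAlgebra K E} (hyz : IsEvPair y z)
    (hgen : ∀ χ : E →* Multiplicative (ZMod p), χ ≠ 1 → ell K χ y ≠ 0)
    {n : ℕ} (hn : Even n) {ζ : (Fin n → S) → k} (hζ : ζ ∈ cocycles k S n)
    [Fintype {x : Γ ⧸ S // ∀ a, α a • x = x}] :
    evHom k y z α (transfer k S ζ) =
      ∑ x : {x : Γ ⧸ S // ∀ a, α a • x = x}, evHom k y z (kapHom α x.1 x.2) ζ := by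
  classical
  have := Fintype.ofFinite (Γ ⧸ S)
  let _ : MulAction E (Γ ⧸ S) := MulAction.compHom _ α
  have hsm : ∀ (a : E) (x : Γ ⧸ S), a • x = α a • x := fun _ _ => rfl
  let F : (Fin n → E) → (Γ ⧸ S → K) := fun r x => algebraMap k K (ζ (ktup S n x (α ∘ r)))
  have hF : dRep (permRep K E (Γ ⧸ S)) F = 0 := by
    funext r x
    have h := congrArg (algebraMap k K) (cocycle_eq k hζ (ktup S (n + 1) x (α ∘ r)))
    rw [tail_ktup, map_add, map_zero] at h
    rw [Pi.zero_apply, Pi.zero_apply, ← h, dRep, Pi.add_apply]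
    congr 1
    · change algebraMap k K (ζ (ktup S n ((r 0)⁻¹ • x) (α ∘ Fin.tail r))) = _
      rw [hsm, map_inv]
      rfl
    · have h1 : contrD F r x = contrD (fun r => F r x) r :=
        map_contrD (Pi.evalAddMonoidHom (fun _ : Γ ⧸ S => K) x) F r
      have h2 : contrD (fun r => F r x) r =
          contrD (fun r => algebraMap k K (ζ (ktup S n x r))) (α ∘ r) :=
        (contrD_comp α (fun r => algebraMap k K (ζ (ktup S n x r))) r).symm
      rw [h1, h2, ← contrD_ktup]
      exact (map_contrD (algebraMap k K).toAddMonoidHom _ _).symm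
  have hf : ∀ x, pair (fun a : E => ev y z n F (a⁻¹ • x)) y = ev y z n F x := by
    intro x
    have h := ev_dRep (permRep K E (Γ ⧸ S)) hyz.aug_fst hyz.fst_mul hyz.mul_fst n F
    rw [hF, ys, if_pos hn, map_sub, map_one] at h
    have h0 : ev y z (n + 1) (0 : (Fin (n + 1) → E) → (Γ ⧸ S → K)) = 0 := by
      simpa using ev_sub y z (n + 1) (0 : (Fin (n + 1) → E) → (Γ ⧸ S → K)) 0
    rw [h0, LinearMap.sub_apply] at h
    have h' := congrFun (sub_eq_zero.mp h.symm) x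
    rw [permRep_asAlgebraHom] at h'
    exact h'
  have hev : ∀ x, ev y z n F x = ev y z n (fun r => F r x) := fun x =>
    map_ev (LinearMap.proj (R := K) (φ := fun _ : Γ ⧸ S => K) x) y z n F
  have hsum : evHom k y z α (transfer k S ζ) = ∑ x, ev y z n F x := by
    have h := map_ev (∑ x, LinearMap.proj (R := K) (φ := fun _ : Γ ⧸ S => K) x) y z n F
    simp only [LinearMap.sum_apply, LinearMap.proj_apply] at h
    rw [h, evHom]
    congr 1
    funext r
    rw [transfer, finsum_eq_sum_of_fintype, map_sum]
  rw [hsum, sum_eq_sum_fixed hE hyz.aug_fst hgen hf]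
  rw [Finset.sum_subtype (p := fun x : Γ ⧸ S => ∀ a, α a • x = x) _ (fun x => by
    rw [Finset.mem_filter]; simp [hsm])]
  refine Finset.sum_congr rfl fun x _ => ?_
  rw [hev, evHom]
  congr 1
  funext r
  simp only [F]
  rw [ktup_of_fixed α x.1 x.2]

end TransferEvaluation

section Chains

variable {X R : Type*} [CommRing R]

lemma slot_add {n : ℕ} (a : X) (c c' : (Fin (n + 1) → X) → R) :
    slot a (c + c') = slot a c + slot a c' := rfl

/-- Alternating functions on tuples. -/
def Alt : (n : ℕ) → ((Fin n → X) → R) → Prop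
  | 0, _ => True
  | 1, _ => True
  | n + 2, c => (∀ a, Alt (n + 1) (slot a c)) ∧
      (∀ a b r, c (Fin.cons a (Fin.cons b r)) = -c (Fin.cons b (Fin.cons a r))) ∧
      ∀ a r, c (Fin.cons a (Fin.cons a r)) = 0

lemma Alt.zero (n : ℕ) : Alt n (0 : (Fin n → X) → R) := by
  induction n with
  | zero => trivial
  | succ n ih =>
    match n with
    | 0 => trivial
    | n + 1 => exact ⟨fun a => ih, by simp, by simp⟩

lemma Alt.add {n : ℕ} {c c' : (Fin n → X) → R} (h : Alt n c) (h' : Alt n c') :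
    Alt n (c + c') := by
  induction n with
  | zero => trivial
  | succ n ih =>
    match n with
    | 0 => trivial
    | n + 1 =>
      refine ⟨fun a => ih (h.1 a) (h'.1 a), fun a b r => ?_, fun a r => ?_⟩
      · rw [Pi.add_apply, h.2.1, h'.2.1, Pi.add_apply, neg_add]
      · rw [Pi.add_apply, h.2.2, h'.2.2, add_zero]

lemma Alt.smul {n : ℕ} (t : R) {c : (Fin n → X) → R} (h : Alt n c) : Alt n (t • c) := by
  induction n with
  | zero => trivial
  | succ n ih =>
    match n with
    | 0 => trivial
    | n + 1 =>
      refine ⟨fun a => ih (h.1 a), fun a b r => ?_, fun a r => ?_⟩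
      · rw [Pi.smul_apply, h.2.1, Pi.smul_apply, smul_neg]
      · rw [Pi.smul_apply, h.2.2, smul_zero]

lemma Alt.alt_slot {n : ℕ} {c : (Fin (n + 1) → X) → R} (h : Alt (n + 1) c) (a : X) :
    Alt n (slot a c) := by
  match n with
  | 0 => trivial
  | n + 1 => exact h.1 a

lemma Alt.slot_slot {n : ℕ} {c : (Fin (n + 2) → X) → R} (h : Alt (n + 2) c) (a b : X) :
    slot a (slot b c) =
      -slot b (slot a c) :=
  funext fun r => h.2.1 b a r

lemma Alt.slot_self {n : ℕ} {c : (Fin (n + 2) → X) → R} (h : Alt (n + 2) c) (a : X) :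
    slot a (slot a c) = 0 :=
  funext fun r => h.2.2 a r

lemma Alt.notMem_range {n : ℕ} {c : (Fin (n + 1) → X) → R} (h : Alt (n + 1) c) {v : X}
    (hv : slot v c = 0) {x : Fin (n + 1) → X} (hx : c x ≠ 0) :
    v ∉ Set.range x := by
  induction n with
  | zero =>
    obtain ⟨a, r, rfl⟩ : ∃ g r, x = Fin.cons g r := ⟨_, _, (Fin.cons_self_tail x).symm⟩
    rw [Fin.range_cons, Set.mem_insert_iff, not_or]
    refine ⟨?_, fun ⟨i, _⟩ => i.elim0⟩
    rintro rfl
    exact hx (congrFun hv r)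
  | succ n ih =>
    obtain ⟨a, r, rfl⟩ : ∃ g r, x = Fin.cons g r := ⟨_, _, (Fin.cons_self_tail x).symm⟩
    rw [Fin.range_cons, Set.mem_insert_iff, not_or]
    refine ⟨?_, ?_⟩
    · rintro rfl
      exact hx (congrFun hv r)
    · refine ih (h.alt_slot a) ?_ hx
      rw [h.slot_slot, hv]
      exact neg_zero

lemma Alt.notMem_range_of_slot {n : ℕ} {c : (Fin (n + 1) → X) → R} (h : Alt (n + 1) c) {v : X}
    {x : Fin n → X} (hx : slot v c x ≠ 0) : v ∉ Set.range x := by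
  match n with
  | 0 =>
    rintro ⟨i, -⟩
    exact i.elim0
  | n + 1 => exact (h.alt_slot v).notMem_range (h.slot_self v) hx

lemma Alt.injective {n : ℕ} {c : (Fin n → X) → R} (h : Alt n c)
    {x : Fin n → X} (hx : c x ≠ 0) : Function.Injective x := by
  induction n with
  | zero => exact Function.injective_of_subsingleton x
  | succ n ih =>
    obtain ⟨a, r, rfl⟩ : ∃ g r, x = Fin.cons g r := ⟨_, _, (Fin.cons_self_tail x).symm⟩
    exact Fin.cons_injective_iff.mpr ⟨h.notMem_range_of_slot hx, ih (h.alt_slot a) hx⟩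

/-- The chains of an abstract simplicial complex, given by the predicate `C` on sets of vertices. -/
def chains (R : Type*) [CommRing R] (C : Set X → Prop) (n : ℕ) : Submodule R ((Fin n → X) → R) where
  carrier := {c | Alt n c ∧ ∀ x, c x ≠ 0 → C (Set.range x)}
  add_mem' := fun {a b} ha hb => ⟨ha.1.add hb.1, fun x hx => by
    by_cases h : a x = 0
    · exact hb.2 x fun h' => hx (by rw [Pi.add_apply, h, h', add_zero])
    · exact ha.2 x h⟩
  zero_mem' := ⟨Alt.zero n, fun x hx => (hx rfl).elim⟩
  smul_mem' := fun t c hc => ⟨hc.1.smul t, fun x hx => hc.2 x fun h => hx (by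
    rw [Pi.smul_apply, h, smul_zero])⟩

lemma chains_mono {C D : Set X → Prop} (h : ∀ s, C s → D s) (n : ℕ) :
    chains R C n ≤ chains R D n :=
  fun _ hc => ⟨hc.1, fun x hx => h _ (hc.2 x hx)⟩

lemma slot_mem_chains {C : Set X → Prop} {n : ℕ} {c : (Fin (n + 1) → X) → R}
    (hc : c ∈ chains R C (n + 1)) (v : X) :
    slot v c ∈ chains R (fun s => C (insert v s) ∧ v ∉ s) n :=
  ⟨hc.1.alt_slot v, fun x hx =>
    ⟨by simpa [Fin.range_cons] using hc.2 _ hx, hc.1.notMem_range_of_slot hx⟩⟩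

lemma mem_chains_del {C : Set X → Prop} {n : ℕ} {c : (Fin (n + 1) → X) → R}
    (hc : c ∈ chains R C (n + 1)) {v : X} (hv : slot v c = 0) :
    c ∈ chains R (fun s => C s ∧ v ∉ s) (n + 1) :=
  ⟨hc.1, fun x hx => ⟨hc.2 x hx, hc.1.notMem_range hv hx⟩⟩

lemma eq_zero_of_ncard_lt {C : Set X → Prop} {n : ℕ} (hC : ∀ s, C s → s.ncard < n)
    {c : (Fin n → X) → R} (hc : c ∈ chains R C n) : c = 0 := by
  funext x
  by_contra hx
  have h := hC _ (hc.2 x hx)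
  rw [← Set.image_univ, Set.ncard_image_of_injective _ (hc.1.injective hx), Set.ncard_univ,
    Nat.card_eq_fintype_card, Fintype.card_fin] at h
  exact h.false

section Wedge

variable [DecidableEq X]

/-- Exterior multiplication by a vertex. -/
def wedge (v : X) : (n : ℕ) → ((Fin n → X) → R) → ((Fin (n + 1) → X) → R)
  | 0, c => fun x => if x 0 = v then c ![] else 0
  | n + 1, c => fun x => (if x 0 = v then c (Fin.tail x) else 0) -
      wedge v n (slot (x 0) c) (Fin.tail x)

lemma slot_wedge (v : X) (n : ℕ) (c : (Fin (n + 1) → X) → R) (a : X) :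
    slot a (wedge v (n + 1) c) = (if a = v then c else 0) - wedge v n (slot a c) := by
  funext r
  simp only [slot, wedge, Fin.cons_zero, Fin.tail_cons, Pi.sub_apply]
  split_ifs <;> rfl

lemma wedge_add (v : X) (n : ℕ) (c c' : (Fin n → X) → R) :
    wedge v n (c + c') = wedge v n c + wedge v n c' := by
  induction n with
  | zero =>
    funext x
    simp only [wedge, Pi.add_apply]
    split_ifs <;> simp
  | succ n ih =>
    funext x
    simp only [wedge, slot_add, ih, Pi.add_apply]
    split_ifs <;> ring

lemma wedge_zero (v : X) (n : ℕ) : wedge v n (0 : (Fin n → X) → R) = 0 := by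
  simpa using wedge_add v n (0 : (Fin n → X) → R) 0

lemma wedge_sum (v : X) (n : ℕ) {ι : Type*} (s : Finset ι) (c : ι → (Fin n → X) → R) :
    wedge v n (∑ i ∈ s, c i) = ∑ i ∈ s, wedge v n (c i) :=
  map_sum (AddMonoidHom.mk' (wedge v n) (wedge_add (R := R) v n)) c s

lemma Alt.alt_wedge {n : ℕ} {c : (Fin n → X) → R} (h : Alt n c) (v : X) :
    Alt (n + 1) (wedge v n c) := by
  induction n with
  | zero => trivial
  | succ n ih =>
    have h2 : ∀ a b (r : Fin n → X), wedge v (n + 1) c (Fin.cons a (Fin.cons b r)) =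
        (if a = v then c (Fin.cons b r) else 0) - (slot b
          (wedge v n (slot a c))) r := fun a b r => by
      simp only [wedge, Fin.cons_zero, Fin.tail_cons]
      rfl
    refine ⟨fun a => ?_, fun a b r => ?_, fun a r => ?_⟩
    · rw [slot_wedge, sub_eq_add_neg, ← neg_one_smul R (wedge v n _)]
      refine Alt.add ?_ ((ih (h.alt_slot a)).smul _)
      split_ifs
      · exact h
      · exact Alt.zero _
    · rw [h2, h2]
      match n with
      | 0 =>
        simp only [slot, wedge, Fin.cons_zero]
        rw [Subsingleton.elim r ![]]
        split_ifs <;> simp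
      | n + 1 =>
        rw [slot_wedge, slot_wedge, h.slot_slot b a]
        have h3 : wedge v n (-slot a (slot b c)) =
            -wedge v n (slot a (slot b c)) := by
          rw [eq_neg_iff_add_eq_zero, ← wedge_add, neg_add_cancel, wedge_zero]
        rw [h3]
        split_ifs <;> (simp [slot]; try ring)
    · rw [h2]
      match n with
      | 0 =>
        simp only [slot, wedge, Fin.cons_zero]
        rw [Subsingleton.elim r ![]]
        split_ifs <;> simp
      | n + 1 =>
        rw [slot_wedge, h.slot_self a, wedge_zero]
        split_ifs <;> simp [slot]

lemma wedge_supp {C D : Set X → Prop} {v : X} (hCD : ∀ s, C s → D (insert v s)) {n : ℕ}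
    {c : (Fin n → X) → R} (hc : ∀ x, c x ≠ 0 → C (Set.range x)) {x : Fin (n + 1) → X}
    (hx : wedge v n c x ≠ 0) : D (Set.range x) := by
  induction n generalizing C D with
  | zero =>
    simp only [wedge, ne_eq, ite_eq_right_iff, Classical.not_imp] at hx
    have h := hCD _ (hc _ hx.2)
    rwa [← hx.1, ← Fin.range_cons, Subsingleton.elim ![] (Fin.tail x), Fin.cons_self_tail] at h
  | succ n ih =>
    obtain ⟨a, r, rfl⟩ : ∃ g r, x = Fin.cons g r := ⟨_, _, (Fin.cons_self_tail x).symm⟩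
    simp only [wedge, Fin.cons_zero, Fin.tail_cons] at hx
    rw [Fin.range_cons]
    by_cases h : wedge v n (slot a c) r = 0
    · rw [h, sub_zero] at hx
      simp only [ne_eq, ite_eq_right_iff, Classical.not_imp] at hx
      rw [hx.1]
      exact hCD _ (hc _ hx.2)
    · refine ih (C := fun s => C (insert a s)) (D := fun s => D (insert a s)) (fun s hs => ?_)
        (fun y hy => ?_) h
      · rw [Set.insert_comm]
        exact hCD _ hs
      · rw [← Fin.range_cons]
        exact hc _ hy

lemma wedge_mem_chains {C D : Set X → Prop} {v : X} (hCD : ∀ s, C s → D (insert v s)) {n : ℕ}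
    {c : (Fin n → X) → R} (hc : c ∈ chains R C n) : wedge v n c ∈ chains R D (n + 1) :=
  ⟨hc.1.alt_wedge v, fun _ hx => wedge_supp hCD hc.2 hx⟩

end Wedge

variable [Fintype X]

/-- The boundary map of the augmented chain complex. -/
def bd {n : ℕ} : ((Fin (n + 1) → X) → R) →ₗ[R] ((Fin n → X) → R) where
  toFun c r := ∑ x, c (Fin.cons x r)
  map_add' c c' := by
    funext r
    simp [Finset.sum_add_distrib]
  map_smul' t c := by
    funext r
    simp [Finset.mul_sum]

lemma bd_apply {n : ℕ} (c : (Fin (n + 1) → X) → R) (r : Fin n → X) :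
    bd c r = ∑ x, c (Fin.cons x r) := rfl

lemma bd_eq_sum {n : ℕ} (c : (Fin (n + 1) → X) → R) : bd c = ∑ x, slot x c := by
  funext r
  rw [Finset.sum_apply]
  rfl

lemma Alt.bd_slot {n : ℕ} {c : (Fin (n + 2) → X) → R} (h : Alt (n + 2) c) (a : X) :
    bd (slot a c) = -slot a (bd c) := by
  funext r
  simp only [bd_apply, slot, Pi.neg_apply, ← Finset.sum_neg_distrib]
  exact Finset.sum_congr rfl fun x _ => h.2.1 a x r

lemma Alt.alt_bd {n : ℕ} {c : (Fin (n + 1) → X) → R} (h : Alt (n + 1) c) : Alt n (bd c) := by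
  induction n with
  | zero => trivial
  | succ n ih =>
    match n with
    | 0 => trivial
    | n + 1 =>
      refine ⟨fun a => ?_, fun a b r => ?_, fun a r => ?_⟩
      · rw [← neg_neg (slot a _), ← h.bd_slot, ← neg_one_smul R]
        exact (ih (h.alt_slot a)).smul _
      · simp only [bd_apply, ← Finset.sum_neg_distrib]
        exact Finset.sum_congr rfl fun x _ => (h.alt_slot x).2.1 a b r
      · exact Finset.sum_eq_zero fun x _ => (h.alt_slot x).2.2 a r

lemma Alt.bd_bd {n : ℕ} {c : (Fin (n + 2) → X) → R} (h : Alt (n + 2) c) :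
    bd (bd c) = 0 := by
  classical
  funext r
  simp only [bd_apply, Pi.zero_apply]
  rw [← Finset.sum_product']
  refine Finset.sum_involution (fun x _ => x.swap) (fun x _ => ?_) (fun x _ hx hx' => hx ?_)
    (fun x _ => Finset.mem_univ _) (fun x _ => rfl)
  · rw [h.2.1]
    exact neg_add_cancel _
  · have : x.1 = x.2 := congrArg Prod.snd hx'
    rw [this]
    exact h.2.2 _ _

lemma bd_mem_chains {C : Set X → Prop} (hC : ∀ s t, s ⊆ t → C t → C s) {n : ℕ}
    {c : (Fin (n + 1) → X) → R} (hc : c ∈ chains R C (n + 1)) : bd c ∈ chains R C n := by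
  refine ⟨hc.1.alt_bd, fun x hx => ?_⟩
  obtain ⟨a, -, ha⟩ := Finset.exists_ne_zero_of_sum_ne_zero hx
  refine hC _ _ ?_ (hc.2 _ ha)
  rw [Fin.range_cons]
  exact Set.subset_insert _ _

/-- The cycles of the augmented chain complex. -/
def IsCycle : (n : ℕ) → ((Fin n → X) → R) → Prop
  | 0, _ => True
  | _ + 1, c => bd c = 0

lemma IsCycle.isCycle_slot {n : ℕ} {c : (Fin (n + 1) → X) → R} (h : IsCycle (n + 1) c)
    (hc : Alt (n + 1) c) (a : X) : IsCycle n (slot a c) := by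
  match n with
  | 0 => trivial
  | n + 1 =>
    have h' : bd c = 0 := h
    change bd _ = 0
    rw [hc.bd_slot, h']
    exact neg_zero

variable [DecidableEq X]

lemma bd_wedge (v : X) (n : ℕ) (c : (Fin (n + 1) → X) → R) :
    bd (wedge v (n + 1) c) = c - wedge v n (bd c) := by
  rw [bd_eq_sum, bd_eq_sum, wedge_sum]
  simp only [slot_wedge, Finset.sum_sub_distrib, Finset.sum_ite_eq', Finset.mem_univ, if_true]

lemma bd_wedge_zero (v : X) (c : (Fin 0 → X) → R) : bd (wedge v 0 c) = c := by
  funext r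
  simp [bd_apply, wedge, Subsingleton.elim ![] r]

lemma bd_wedge_of_isCycle (v : X) {n : ℕ} {c : (Fin n → X) → R} (h : IsCycle n c) :
    bd (wedge v n c) = c := by
  match n with
  | 0 => exact bd_wedge_zero v c
  | n + 1 =>
    have h' : bd c = 0 := h
    rw [bd_wedge, h', wedge_zero, sub_zero]

end Chains

section Exactness

variable {X : Type*} [Fintype X]

/-- Exactness of the augmented chain complex at the chains on tuples of length `n`. -/
def ExactAt (R : Type*) [CommRing R] (C : Set X → Prop) (n : ℕ) : Prop :=
  ∀ c ∈ chains R C n, IsCycle n c → ∃ b ∈ chains R C (n + 1), bd b = c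

/-- Cycles are determined by their value at a certain tuple. -/
def InjAt (R : Type*) [CommRing R] (C : Set X → Prop) (n : ℕ) (τ : Fin n → X) : Prop :=
  ∀ c ∈ chains R C n, IsCycle n c → c τ = 0 → c = 0

variable {R : Type*} [CommRing R]

lemma injAt_succ {C : Set X → Prop} {v : X} {n : ℕ} {τ : Fin n → X}
    (h1 : InjAt R (fun s => C (insert v s) ∧ v ∉ s) n τ)
    (h2 : ExactAt R (fun s => C s ∧ v ∉ s) (n + 1))
    (h3 : ∀ b ∈ chains R (fun s => C s ∧ v ∉ s) (n + 2), b = 0) :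
    InjAt R C (n + 1) (Fin.cons v τ) := by
  intro c hc hcyc hτ
  have hv := h1 _ (slot_mem_chains hc v) (hcyc.isCycle_slot hc.1 v) hτ
  obtain ⟨b, hb, hbd⟩ := h2 _ (mem_chains_del hc hv) hcyc
  rw [← hbd, h3 b hb, map_zero]

variable [DecidableEq X]

lemma exactAt_cone {C : Set X → Prop} {w : X} (hw : ∀ s, C s → C (insert w s)) (n : ℕ) :
    ExactAt R C n :=
  fun c hc h => ⟨wedge w n c, wedge_mem_chains hw hc, bd_wedge_of_isCycle w h⟩

lemma exactAt_zero {C : Set X → Prop} {w : X} (hw : C {w}) : ExactAt R C 0 := by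
  intro c hc h
  refine ⟨wedge w 0 c, wedge_mem_chains (C := fun s => s = ∅) ?_ ⟨hc.1, fun x _ => ?_⟩,
    bd_wedge_of_isCycle w h⟩
  · rintro s rfl
    simpa using hw
  · simp

lemma exactAt_succ {C : Set X → Prop} (hC : ∀ s t, s ⊆ t → C t → C s) (v : X) {n : ℕ}
    (h1 : ExactAt R (fun s => C (insert v s) ∧ v ∉ s) n)
    (h2 : ExactAt R (fun s => C s ∧ v ∉ s) (n + 1)) : ExactAt R C (n + 1) := by
  intro c hc hcyc
  obtain ⟨b, hb, hbd⟩ := h1 _ (slot_mem_chains hc v) (hcyc.isCycle_slot hc.1 v)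
  have hwb : wedge v (n + 1) b ∈ chains R C (n + 2) := wedge_mem_chains (fun s hs => hs.1) hb
  have hbC : b ∈ chains R C (n + 1) :=
    chains_mono (fun s hs => hC _ _ (Set.subset_insert v s) hs.1) _ hb
  have hbv : slot v b = 0 := by
    funext r
    by_contra h
    exact (hb.2 _ h).2 (by simp [Fin.range_cons])
  have hslot : slot v (c + bd (wedge v (n + 1) b)) = 0 := by
    rw [bd_wedge, hbd, slot_add]
    have h3 : slot v (b - wedge v n (slot v c)) = slot v b - slot v (wedge v n (slot v c)) := rfl
    rw [h3, hbv]
    match n with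
    | 0 =>
      funext r
      simp [slot, wedge, Subsingleton.elim r ![]]
    | n + 1 =>
      rw [slot_wedge, hc.1.slot_self, wedge_zero]
      simp
  have hmem := mem_chains_del (Submodule.add_mem _ hc (bd_mem_chains hC hwb)) hslot
  obtain ⟨b', hb', hbd'⟩ := h2 _ hmem (by
    have h' : bd c = 0 := hcyc
    change bd _ = 0
    rw [map_add, h', hwb.1.bd_bd, add_zero])
  refine ⟨b' - wedge v (n + 1) b,
    Submodule.sub_mem _ (chains_mono (fun s hs => hs.1) _ hb') hwb, ?_⟩
  rw [map_sub, hbd', add_sub_cancel_right]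

end Exactness

section Circles

variable {T : Type*} {p : ℕ}

/-- The join of circles, one `p`-gon for each element of `V`. -/
def Circ (V : Finset T) (s : Set (T × ZMod p)) : Prop :=
  (∀ x ∈ s, x.1 ∈ V) ∧ ∀ t, ∃ i, ∀ j, (t, j) ∈ s → j = i ∨ j = i + 1

lemma Circ.mono {V : Finset T} {s t : Set (T × ZMod p)} (h : s ⊆ t) (ht : Circ V t) : Circ V s :=
  ⟨fun x hx => ht.1 x (h hx), fun a => (ht.2 a).imp fun _ hi j hj => hi j (h hj)⟩

lemma Circ.insert_iff {V : Finset T} {t₀ : T} (ht₀ : t₀ ∈ V) (i : ZMod p)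
    (s : Set (T × ZMod p)) : Circ V (insert (t₀, i) s) ↔
      Circ V s ∧ ∃ a, ∀ j, (j = i ∨ (t₀, j) ∈ s) → j = a ∨ j = a + 1 := by
  refine ⟨fun h => ⟨h.mono (Set.subset_insert _ _), ?_⟩, fun ⟨h, a, ha⟩ => ⟨?_, fun t => ?_⟩⟩
  · obtain ⟨a, ha⟩ := h.2 t₀
    refine ⟨a, fun j hj => ha j ?_⟩
    simpa using hj
  · rintro x (rfl | hx)
    · exact ht₀
    · exact h.1 x hx
  · by_cases ht : t = t₀
    · subst ht
      exact ⟨a, fun j hj => ha j (by simpa using hj)⟩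
    · obtain ⟨b, hb⟩ := h.2 t
      exact ⟨b, fun j hj => hb j (by simpa [ht] using hj)⟩

lemma Circ.insert_of_notMem [DecidableEq T] {V : Finset T} {t₀ : T} (ht₀ : t₀ ∉ V)
    {s : Set (T × ZMod p)} :
    Circ V s ↔ Circ (insert t₀ V) s ∧ ∀ j, (t₀, j) ∉ s := by
  refine ⟨fun h => ⟨⟨fun x hx => Finset.mem_insert_of_mem (h.1 x hx), h.2⟩,
    fun j hj => ht₀ (h.1 _ hj)⟩, fun ⟨h, h'⟩ => ⟨fun x hx => ?_, h.2⟩⟩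
  refine (Finset.mem_insert.mp (h.1 x hx)).resolve_left ?_
  rintro rfl
  exact h' x.2 hx

lemma Circ.ncard_le {V : Finset T} {s : Set (T × ZMod p)} (h : Circ V s) :
    s.ncard ≤ 2 * V.card := by
  classical
  choose i hi using h.2
  let F : Finset (T × ZMod p) :=
    V.image (fun t => (t, i t)) ∪ V.image (fun t => (t, i t + 1))
  have hF : s ⊆ F := by
    rintro ⟨t, j⟩ hx
    have ht := h.1 _ hx
    rcases hi t j hx with rfl | rfl <;> simp_all [F]
  calc s.ncard ≤ (F : Set (T × ZMod p)).ncard := Set.ncard_le_ncard hF F.finite_toSet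
    _ = F.card := Set.ncard_coe_finset F
    _ ≤ _ := Finset.card_union_le _ _
    _ ≤ V.card + V.card := Nat.add_le_add Finset.card_image_le Finset.card_image_le
    _ = 2 * V.card := (two_mul _).symm

lemma circ_link_mono {V : Finset T} {t₀ : T} (s t : Set (T × ZMod p)) (h : s ⊆ t)
    (ht : Circ V (insert (t₀, 0) t) ∧ (t₀, 0) ∉ t) : Circ V (insert (t₀, 0) s) ∧ (t₀, 0) ∉ s :=
  ⟨ht.1.mono (Set.insert_subset_insert h), fun h' => ht.2 (h h')⟩

variable [DecidableEq T] [Fact p.Prime]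

section Link

lemma two_ne_zero_zmod (hp : 2 < p) : (1 : ZMod p) + 1 ≠ 0 := by
  intro h
  have h1 : (1 : ZMod p) + 1 = ((2 : ℕ) : ZMod p) := by norm_num
  have h2 := ZMod.val_natCast_of_lt hp
  rw [← h1, h, ZMod.val_zero] at h2
  omega

lemma circ_link_link (hp : 2 < p) {V : Finset T} {t₀ : T} (ht₀ : t₀ ∉ V) (s : Set (T × ZMod p)) :
    ((Circ (insert t₀ V) (insert (t₀, 0) (insert (t₀, 1) s)) ∧ (t₀, 0) ∉ insert (t₀, 1) s) ∧
      (t₀, 1) ∉ s) ↔ Circ V s := by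
  have h2 := two_ne_zero_zmod hp
  rw [Circ.insert_of_notMem ht₀, Circ.insert_iff (Finset.mem_insert_self _ _),
    Circ.insert_iff (Finset.mem_insert_self _ _)]
  constructor
  · rintro ⟨⟨⟨⟨hc, -⟩, a, ha⟩, h0⟩, h1⟩
    refine ⟨hc, fun j hj => ?_⟩
    have hj0 : j ≠ 0 := by
      rintro rfl
      exact h0 (Set.mem_insert_of_mem _ hj)
    have hj1 : j ≠ 1 := by
      rintro rfl
      exact h1 hj
    have e0 := ha 0 (Or.inl rfl)
    have e1 := ha 1 (Or.inr (Set.mem_insert _ _))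
    have ej := ha j (Or.inr (Set.mem_insert_of_mem _ hj))
    rcases e0 with e0 | e0
    · rw [← e0, zero_add] at ej
      exact ej.elim hj0 hj1
    · rcases e1 with e1 | e1
      · rw [← e1] at e0
        exact h2 e0.symm
      · rw [← e0] at e1
        exact one_ne_zero e1
  · rintro ⟨hc, h⟩
    refine ⟨⟨⟨⟨hc, 1, ?_⟩, 0, ?_⟩, ?_⟩, h 1⟩
    · rintro j (rfl | hj)
      · exact Or.inl rfl
      · exact (h j hj).elim
    · rintro j (rfl | hj)
      · exact Or.inl rfl
      · simp only [Set.mem_insert_iff, Prod.mk.injEq, true_and] at hj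
        rcases hj with rfl | hj
        · exact Or.inr (zero_add _).symm
        · exact (h j hj).elim
    · simp only [Set.mem_insert_iff, Prod.mk.injEq, true_and, not_or]
      exact ⟨zero_ne_one, h 0⟩

end Link

variable [Fintype T]

lemma circ_path_exactAt (R : Type*) [CommRing R] {V : Finset T} {t₀ : T} (ht₀ : t₀ ∈ V) (m : ℕ) :
    ∀ i : ℕ, 1 ≤ i → i + m + 1 = p → ∀ n, ExactAt R
      (fun s : Set (T × ZMod p) => Circ V s ∧ ∀ j : ZMod p, (t₀, j) ∈ s → i ≤ j.val) n := by
  induction m with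
  | zero =>
    intro i h1 hi n
    have hiv : (i : ZMod p).val = i := ZMod.val_natCast_of_lt (by omega)
    refine exactAt_cone (w := (t₀, (i : ZMod p))) (fun s hs => ⟨?_, ?_⟩) n
    · rw [Circ.insert_iff ht₀]
      refine ⟨hs.1, i, ?_⟩
      rintro j (rfl | hj)
      · exact Or.inl rfl
      · left
        apply ZMod.val_injective p
        have := hs.2 j hj
        have := ZMod.val_lt j
        omega
    · intro j hj
      simp only [Set.mem_insert_iff, Prod.mk.injEq, true_and] at hj
      rcases hj with rfl | hj
      · rw [hiv]
      · exact hs.2 j hj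
  | succ m ih =>
    intro i h1 hi n
    have hiv : (i : ZMod p).val = i := ZMod.val_natCast_of_lt (by omega)
    have hiv' : ((i : ZMod p) + 1).val = i + 1 := by
      rw [← Nat.cast_succ]
      exact ZMod.val_natCast_of_lt (by omega)
    match n with
    | 0 =>
      refine exactAt_zero (w := (t₀, (i : ZMod p))) ⟨⟨?_, fun t => ⟨i, ?_⟩⟩, ?_⟩
      · simpa using ht₀
      · simp
      · simp [hiv]
    | n + 1 =>
      refine exactAt_succ (fun s t hst ht => ⟨ht.1.mono hst, fun j hj => ht.2 j (hst hj)⟩)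
        (t₀, (i : ZMod p)) (exactAt_cone (w := (t₀, (i : ZMod p) + 1)) (fun s hs => ?_) n) ?_
      · obtain ⟨⟨hc, hv⟩, hi'⟩ := hs
        rw [Circ.insert_iff ht₀] at hc
        obtain ⟨hc, a, ha⟩ := hc
        have hs' : ∀ j, (t₀, j) ∈ s → j = (i : ZMod p) + 1 := by
          intro j hj
          have hj1 := hv j (Set.mem_insert_of_mem _ hj)
          have hji : j ≠ i := by
            rintro rfl
            exact hi' hj
          rcases ha i (Or.inl rfl) with hia | hia <;> rcases ha j (Or.inr hj) with hja | hja
          · exact (hji (hja.trans hia.symm)).elim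
          · rw [hia, hja]
          · have hj' : j = ((i - 1 : ℕ) : ZMod p) := by
              rw [Nat.cast_sub h1, hia, hja]
              simp
            have : j.val = i - 1 := by
              rw [hj']
              exact ZMod.val_natCast_of_lt (by omega)
            omega
          · exact (hji (hja.trans hia.symm)).elim
        refine ⟨⟨?_, ?_⟩, ?_⟩
        · rw [Circ.insert_iff ht₀, Circ.insert_iff ht₀]
          refine ⟨⟨hc, i + 1, ?_⟩, i, ?_⟩
          · rintro j (rfl | hj)
            · exact Or.inl rfl
            · exact Or.inl (hs' j hj)
          · rintro j (rfl | hj)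
            · exact Or.inl rfl
            · simp only [Set.mem_insert_iff, Prod.mk.injEq, true_and] at hj
              exact Or.inr (hj.elim id (hs' j))
        · intro j hj
          simp only [Set.mem_insert_iff, Prod.mk.injEq, true_and] at hj
          rcases hj with rfl | rfl | hj
          · rw [hiv]
          · rw [hiv']
            omega
          · exact hv j (Set.mem_insert_of_mem _ hj)
        · rw [Set.mem_insert_iff, not_or]
          refine ⟨fun h => ?_, hi'⟩
          have := congrArg ZMod.val (congrArg Prod.snd h)
          simp only [hiv, hiv'] at this
          omega
      · have := ih (i + 1) (by omega) (by omega) (n + 1)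
        convert this using 2 with s
        refine ⟨fun h => ⟨h.1.1, fun j hj => ?_⟩, fun h => ⟨⟨h.1, fun j hj => ?_⟩, fun hj => ?_⟩⟩
        · refine Nat.lt_of_le_of_ne (h.1.2 j hj) fun h' => h.2 ?_
          rwa [h', ZMod.natCast_zmod_val]
        · exact Nat.le_of_succ_le (h.2 j hj)
        · have := h.2 _ hj
          omega

lemma circ_del_exactAt (hp : 2 < p) (R : Type*) [CommRing R] {V : Finset T} {t₀ : T} (ht₀ : t₀ ∈ V)
    (n : ℕ) : ExactAt R (fun s : Set (T × ZMod p) => Circ V s ∧ (t₀, 0) ∉ s) n := by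
  have := circ_path_exactAt (p := p) R ht₀ (p - 2) 1 le_rfl (by omega) n
  convert this using 2 with s
  refine ⟨fun h => ⟨h.1, fun j hj => ?_⟩, fun h => ⟨h.1, fun hj => ?_⟩⟩
  · rw [Nat.one_le_iff_ne_zero, Ne, ZMod.val_eq_zero]
    rintro rfl
    exact h.2 hj
  · simpa using h.2 _ hj

lemma circ_link_del_exactAt (hp : 2 < p) (R : Type*) [CommRing R] {V : Finset T} {t₀ : T}
    (ht₀ : t₀ ∈ V) (n : ℕ) : ExactAt R (fun s : Set (T × ZMod p) =>
      (Circ V (insert (t₀, 0) s) ∧ (t₀, 0) ∉ s) ∧ (t₀, 1) ∉ s) n := by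
  refine exactAt_cone (w := (t₀, -1)) (fun s hs => ?_) n
  obtain ⟨⟨hc, h0⟩, h1⟩ := hs
  rw [Circ.insert_iff ht₀] at hc
  obtain ⟨hc, a, ha⟩ := hc
  have h2 := two_ne_zero_zmod hp
  have hs : ∀ j, (t₀, j) ∈ s → j = -1 := by
    intro j hj
    have hj0 : j ≠ 0 := by
      rintro rfl
      exact h0 hj
    have hj1 : j ≠ 1 := by
      rintro rfl
      exact h1 hj
    rcases ha 0 (Or.inl rfl) with ha0 | ha0 <;> rcases ha j (Or.inr hj) with hja | hja
    · exact (hj0 (hja.trans ha0.symm)).elim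
    · exact (hj1 (by rw [hja, ← ha0, zero_add])).elim
    · rw [hja]
      exact eq_neg_of_add_eq_zero_left ha0.symm
    · exact (hj0 (hja.trans ha0.symm)).elim
  refine ⟨⟨?_, ?_⟩, ?_⟩
  · rw [Circ.insert_iff ht₀, Circ.insert_iff ht₀]
    refine ⟨⟨hc, -1, ?_⟩, -1, ?_⟩
    · rintro j (rfl | hj)
      · exact Or.inl rfl
      · exact Or.inl (hs j hj)
    · rintro j (rfl | hj)
      · exact Or.inr (by simp)
      · simp only [Set.mem_insert_iff, Prod.mk.injEq, true_and] at hj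
        exact Or.inl (hj.elim id (hs j))
  · simp only [Set.mem_insert_iff, Prod.mk.injEq, true_and, not_or]
    exact ⟨by simp [eq_comm], h0⟩
  · simp only [Set.mem_insert_iff, Prod.mk.injEq, true_and, not_or]
    exact ⟨fun h => h2 (by rw [← sub_neg_eq_add, ← h, sub_self]), h1⟩

lemma circ_exactAt (hp : 2 < p) (R : Type*) [CommRing R] (V : Finset T) :
    ∀ n, n < 2 * V.card → ExactAt R (Circ (p := p) V) n := by
  induction V using Finset.induction with
  | empty =>
    intro n hn
    simp at hn
  | insert t₀ V ht₀ ih =>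
    intro n hn
    rw [Finset.card_insert_of_notMem ht₀] at hn
    have hm := Finset.mem_insert_self t₀ V
    match n with
    | 0 =>
      refine exactAt_zero (w := (t₀, 0)) ⟨by simp, fun t => ⟨0, by simp⟩⟩
    | n + 1 =>
      refine exactAt_succ (fun s t => Circ.mono) (t₀, 0) ?_ (circ_del_exactAt hp R hm _)
      match n with
      | 0 =>
        refine exactAt_zero (w := (t₀, 1)) ⟨?_, by simp⟩
        rw [Circ.insert_iff hm]
        refine ⟨⟨by simp, fun t => ⟨1, by simp⟩⟩, 0, ?_⟩
        simp
      | n + 1 =>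
        refine exactAt_succ (circ_link_mono) (t₀, 1) ?_ (circ_link_del_exactAt hp R hm _)
        simp only [circ_link_link hp ht₀]
        exact ih n (by omega)

lemma circ_injAt (hp : 2 < p) (V : Finset T) :
    ∃ τ : Fin (2 * V.card) → T × ZMod p, ∀ (R : Type u) [CommRing R],
      InjAt R (Circ V) (2 * V.card) τ := by
  induction V using Finset.induction with
  | empty =>
    refine ⟨Fin.elim0, fun R _ c _ _ hτ => funext fun x => ?_⟩
    rw [Pi.zero_apply, ← hτ]
    exact congrArg c (funext fun i => i.elim0)
  | insert t₀ V ht₀ ih =>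
    obtain ⟨τ, hτ⟩ := ih
    have hm := Finset.mem_insert_self t₀ V
    have hcard : 2 * (insert t₀ V).card = 2 * V.card + 1 + 1 := by
      rw [Finset.card_insert_of_notMem ht₀]
      ring
    rw [hcard]
    refine ⟨Fin.cons (t₀, 0) (Fin.cons (t₀, 1) τ), fun R _ => injAt_succ (injAt_succ ?_
      (circ_link_del_exactAt hp R hm _) ?_) (circ_del_exactAt hp R hm _) ?_⟩
    · simp only [circ_link_link hp ht₀]
      exact hτ R
    · intro b hb
      refine eq_zero_of_ncard_lt (fun s hs => ?_) hb
      have h1 := hs.1.1.ncard_le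
      rw [hcard, Set.ncard_insert_of_notMem hs.1.2 (Set.toFinite s)] at h1
      omega
    · intro b hb
      refine eq_zero_of_ncard_lt (fun s hs => ?_) hb
      have h1 := hs.1.ncard_le
      omega

end Circles

section Operators

variable {K Γ X : Type*} [CommRing K] [Group Γ] [MulAction Γ X]

/-- The action of the group algebra on functions on tuples. -/
noncomputable def opr (x : MonoidAlgebra K Γ) (n : ℕ) :
    ((Fin n → X) → K) →ₗ[K] ((Fin n → X) → K) :=
  (permRep K Γ (Fin n → X)).asAlgebraHom x

lemma opr_apply (x : MonoidAlgebra K Γ) (n : ℕ) (c : (Fin n → X) → K) (r : Fin n → X) :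
    opr x n c r = pair (fun g => c (g⁻¹ • r)) x := permRep_asAlgebraHom x c r

lemma opr_eq_pair (x : MonoidAlgebra K Γ) (n : ℕ) (c : (Fin n → X) → K) :
    opr x n c = pair (fun g => permRep K Γ (Fin n → X) g c) x := (pair_rep _ _ _).symm

lemma opr_mul_apply (x y : MonoidAlgebra K Γ) (n : ℕ) (c : (Fin n → X) → K) :
    opr (x * y) n c = opr x n (opr y n c) := by
  simp [opr]

lemma opr_zero_apply (n : ℕ) (c : (Fin n → X) → K) : opr (0 : MonoidAlgebra K Γ) n c = 0 := by
  simp [opr]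

lemma opr_single (g : Γ) (t : K) (n : ℕ) (c : (Fin n → X) → K) :
    opr (MonoidAlgebra.single g t) n c = t • permRep K Γ (Fin n → X) g c := by
  simp [opr]

lemma opr_degree_zero (x : MonoidAlgebra K Γ) (c : (Fin 0 → X) → K) :
    opr x 0 c = aug x • c := by
  funext r
  rw [opr_apply, ← pair_const]
  simp only [Subsingleton.elim _ r]
  rw [pair_const, pair_const]
  rfl

lemma permRep_mem_chains {C : Set X → Prop} (hC : ∀ (g : Γ) s, C s → C ((g • ·) '' s)) {n : ℕ}
    {c : (Fin n → X) → K} (hc : c ∈ chains K C n) (g : Γ) :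
    permRep K Γ (Fin n → X) g c ∈ chains K C n := by
  have hcons : ∀ {n : ℕ} (a : X) (r : Fin n → X),
      g⁻¹ • (Fin.cons a r : Fin (n + 1) → X) = Fin.cons (g⁻¹ • a) (g⁻¹ • r) := fun a r =>
    comp_cons' (g⁻¹ • ·) a r
  refine ⟨?_, fun x hx => ?_⟩
  · have h := hc.1
    clear hc
    induction n with
    | zero => trivial
    | succ n ih =>
      match n with
      | 0 => trivial
      | n + 1 =>
        have hs : ∀ a, slot a (permRep K Γ (Fin (n + 2) → X) g c) =
            permRep K Γ (Fin (n + 1) → X) g (slot (g⁻¹ • a) c) := by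
          intro a
          funext r
          simp only [slot, permRep_apply, hcons]
        refine ⟨fun a => ?_, fun a b r => ?_, fun a r => ?_⟩
        · rw [hs]
          exact ih (h.alt_slot _)
        · simp only [permRep_apply, hcons]
          exact h.2.1 _ _ _
        · simp only [permRep_apply, hcons]
          exact h.2.2 _ _
  · have h := hC g _ (hc.2 _ hx)
    rw [← Set.range_comp] at h
    convert h using 2
    funext i
    simp

lemma opr_mem_chains {C : Set X → Prop} (hC : ∀ (g : Γ) s, C s → C ((g • ·) '' s)) {n : ℕ}
    {c : (Fin n → X) → K} (hc : c ∈ chains K C n) (x : MonoidAlgebra K Γ) :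
    opr x n c ∈ chains K C n := by
  rw [opr_eq_pair]
  exact pair_mem (permRep_mem_chains hC hc) x

lemma one_mem_chains {X : Type*} {C : Set X → Prop} (hC : C ∅) :
    (1 : (Fin 0 → X) → K) ∈ chains K C 0 :=
  ⟨trivial, fun x _ => by simpa using hC⟩

variable [Fintype X]

lemma bd_permRep (g : Γ) {n : ℕ} (c : (Fin (n + 1) → X) → K) :
    bd (permRep K Γ (Fin (n + 1) → X) g c) = permRep K Γ (Fin n → X) g (bd c) := by
  funext r
  simp only [bd_apply, permRep_apply]
  refine Eq.trans ?_ (Equiv.sum_comp (MulAction.toPerm g⁻¹) fun a => c (Fin.cons a (g⁻¹ • r)))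
  refine Finset.sum_congr rfl fun a _ => congrArg c ?_
  exact comp_cons' (g⁻¹ • ·) a r

lemma bd_opr (x : MonoidAlgebra K Γ) {n : ℕ} (c : (Fin (n + 1) → X) → K) :
    bd (opr x (n + 1) c) = opr x n (bd c) := by
  rw [opr_eq_pair, opr_eq_pair, map_pair]
  simp only [bd_permRep]

end Operators

section Zigzag

variable {K Γ X : Type*} [Field K] [Group Γ] [MulAction Γ X] [Fintype X]

/-- The properties of the chains of a simplicial sphere which are used in the construction of
cohomology classes. -/
structure IsSphere (K : Type*) [CommRing K] (C : Set X → Prop) (M : ℕ) (τ : Fin (M + 1) → X) :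
    Prop where
  mono : ∀ s t, s ⊆ t → C t → C s
  empty : C ∅
  exactAt : ∀ n ≤ M, ExactAt K C n
  injAt : InjAt K C (M + 1) τ
  ncard_le : ∀ s, C s → s.ncard ≤ M + 1

lemma permRep_eq_self {p : ℕ} [Fact p.Prime] [CharP K p] (hΓ : IsPGroup p Γ) {C : Set X → Prop}
    {M : ℕ} {τ : Fin (M + 1) → X} (hinj : InjAt K C (M + 1) τ)
    (hC : ∀ (g : Γ) s, C s → C ((g • ·) '' s)) {c : (Fin (M + 1) → X) → K}
    (hc : c ∈ chains K C (M + 1)) (hbd : bd c = 0) (g : Γ) :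
    permRep K Γ (Fin (M + 1) → X) g c = c := by
  by_cases hτ : c τ = 0
  · rw [hinj c hc hbd hτ, map_zero]
  set t : K := permRep K Γ (Fin (M + 1) → X) g c τ / c τ with ht
  have h1 : permRep K Γ (Fin (M + 1) → X) g c = t • c := by
    rw [← sub_eq_zero]
    refine hinj _ (Submodule.sub_mem _ (permRep_mem_chains hC hc g) (Submodule.smul_mem _ _ hc)) ?_ ?_
    · change bd _ = 0
      rw [map_sub, bd_permRep, map_smul, hbd]
      simp
    · rw [Pi.sub_apply, Pi.smul_apply, smul_eq_mul, ht, div_mul_cancel₀ _ hτ, sub_self]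
  have h2 : ∀ n : ℕ, permRep K Γ (Fin (M + 1) → X) (g ^ n) c = t ^ n • c := by
    intro n
    induction n with
    | zero => rw [pow_zero, pow_zero, map_one, one_smul, Module.End.one_apply]
    | succ n ih =>
      rw [pow_succ, map_mul, Module.End.mul_apply, h1, map_smul, ih, smul_smul, pow_succ, mul_comm]
  obtain ⟨n, hn⟩ := hΓ g
  have h3 := congrFun (h2 (p ^ n)) τ
  rw [hn, map_one, Module.End.one_apply, Pi.smul_apply, smul_eq_mul] at h3
  have h4 : t ^ p ^ n = 1 := (mul_eq_right₀ hτ).mp h3.symm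
  have h5 : t = 1 := by
    have h : (t - 1) ^ p ^ n = 0 := by rw [sub_pow_char_pow, h4, one_pow, sub_self]
    exact sub_eq_zero.mp (pow_eq_zero_iff (pow_ne_zero _ (Fact.out (p := p.Prime)).ne_zero) |>.mp h)
  rw [h1, h5, one_smul]

lemma opr_eq_aug_smul {p : ℕ} [Fact p.Prime] [CharP K p] (hΓ : IsPGroup p Γ) {C : Set X → Prop}
    {M : ℕ} {τ : Fin (M + 1) → X} (hinj : InjAt K C (M + 1) τ)
    (hC : ∀ (g : Γ) s, C s → C ((g • ·) '' s)) {c : (Fin (M + 1) → X) → K}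
    (hc : c ∈ chains K C (M + 1)) (hbd : bd c = 0) (x : MonoidAlgebra K Γ) :
    opr x (M + 1) c = aug x • c := by
  rw [opr_eq_pair, ← pair_const]
  exact congrArg (fun φ => pair φ x) (funext fun g => permRep_eq_self hΓ hinj hC hc hbd g)

lemma ys_succ_mul {y z : MonoidAlgebra K Γ} (hyz : IsEvPair y z) (j : ℕ) :
    ys (y - 1) z (j + 1) * ys (y - 1) z j = 0 := by
  by_cases hj : Even j
  · simp [ys, hj, Nat.even_add_one, mul_sub, hyz.mul_fst]
  · simp [ys, hj, Nat.even_add_one, sub_mul, hyz.fst_mul]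

lemma aug_ys {y z : MonoidAlgebra K Γ} (hyz : IsEvPair y z) (j : ℕ) :
    aug (ys (y - 1) z j) = 0 := by
  by_cases hj : Even j
  · simp [ys, hj, hyz.aug_fst, aug_one]
  · simp [ys, hj, hyz.aug_snd]

/-- A sequence of chains lifting the augmentation, for the periodic pair of operators
`y - 1`, `z`. -/
structure IsZigzag (C : Set X → Prop) (M : ℕ) (y z : MonoidAlgebra K Γ)
    (a : (j : ℕ) → (Fin (j + 1) → X) → K) : Prop where
  mem : ∀ j ≤ M, a j ∈ chains K C (j + 1)
  bd_zero : bd (a 0) = 1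
  bd_succ : ∀ j < M, bd (a (j + 1)) = opr (ys (y - 1) z j) (j + 1) (a j)

lemma IsZigzag.isCycle {C : Set X → Prop} {M : ℕ} {y z : MonoidAlgebra K Γ} (hyz : IsEvPair y z)
    {a : (j : ℕ) → (Fin (j + 1) → X) → K} (ha : IsZigzag C M y z a) {j : ℕ} (hj : j ≤ M) :
    bd (opr (ys (y - 1) z j) (j + 1) (a j)) = 0 := by
  rw [bd_opr]
  match j with
  | 0 => rw [ha.bd_zero, opr_degree_zero, aug_ys hyz, zero_smul]
  | j + 1 => rw [ha.bd_succ j hj, ← opr_mul_apply, ys_succ_mul hyz, opr_zero_apply]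

lemma IsZigzag.eq {p : ℕ} [Fact p.Prime] [CharP K p] (hΓ : IsPGroup p Γ) {C : Set X → Prop}
    {M : ℕ} {τ : Fin (M + 1) → X} (hS : IsSphere K C M τ)
    (hC : ∀ (g : Γ) s, C s → C ((g • ·) '' s)) {y z : MonoidAlgebra K Γ} (hyz : IsEvPair y z)
    {a a' : (j : ℕ) → (Fin (j + 1) → X) → K} (ha : IsZigzag C M y z a)
    (ha' : IsZigzag C M y z a') :
    opr (ys (y - 1) z M) (M + 1) (a M) = opr (ys (y - 1) z M) (M + 1) (a' M) := by
  have key : ∀ j ≤ M, ∃ e ∈ chains K C (j + 1), bd e = 0 ∧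
      opr (ys (y - 1) z j) (j + 1) (a j - a' j) = opr (ys (y - 1) z j) (j + 1) e := by
    intro j
    induction j with
    | zero =>
      intro h0
      refine ⟨a 0 - a' 0, Submodule.sub_mem _ (ha.mem 0 h0) (ha'.mem 0 h0), ?_, rfl⟩
      rw [map_sub, ha.bd_zero, ha'.bd_zero, sub_self]
    | succ j ih =>
      intro hj
      obtain ⟨e, he, hbd, h⟩ := ih (by omega)
      obtain ⟨b, hb, hb'⟩ := hS.exactAt (j + 1) hj e he hbd
      refine ⟨a (j + 1) - a' (j + 1) - opr (ys (y - 1) z j) (j + 2) b,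
        Submodule.sub_mem _ (Submodule.sub_mem _ (ha.mem _ hj) (ha'.mem _ hj))
          (opr_mem_chains hC hb _), ?_, ?_⟩
      · rw [map_sub, map_sub, ha.bd_succ j hj, ha'.bd_succ j hj, bd_opr, hb', ← h, map_sub,
          sub_self]
      · rw [map_sub _ _ (opr _ _ b), ← opr_mul_apply, ys_succ_mul hyz, opr_zero_apply, sub_zero]
  obtain ⟨e, he, hbd, h⟩ := key M le_rfl
  rw [← sub_eq_zero, ← map_sub, h, opr_eq_aug_smul hΓ hS.injAt hC he hbd, aug_ys hyz, zero_smul]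

/-- A chosen chain with given boundary. -/
noncomputable def prim (C : Set X → Prop) (n : ℕ) (c : (Fin n → X) → K) : (Fin (n + 1) → X) → K :=
  open Classical in
  if h : ∃ b ∈ chains K C (n + 1), bd b = c then h.choose else 0

lemma prim_mem (C : Set X → Prop) (n : ℕ) (c : (Fin n → X) → K) :
    prim C n c ∈ chains K C (n + 1) := by
  rw [prim]
  split_ifs with h
  · exact h.choose_spec.1
  · exact Submodule.zero_mem _

lemma bd_prim {C : Set X → Prop} {n : ℕ} (hC : ExactAt K C n) {c : (Fin n → X) → K}
    (hc : c ∈ chains K C n) (h : IsCycle n c) : bd (prim C n c) = c := by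
  have h' := hC c hc h
  rw [prim, dif_pos h']
  exact h'.choose_spec.2

lemma exists_isZigzag {C : Set X → Prop} {M : ℕ} {τ : Fin (M + 1) → X} (hS : IsSphere K C M τ)
    (hC : ∀ (g : Γ) s, C s → C ((g • ·) '' s)) {y z : MonoidAlgebra K Γ} (hyz : IsEvPair y z) :
    ∃ a, IsZigzag C M y z a := by
  let a : (j : ℕ) → (Fin (j + 1) → X) → K := fun j => j.rec (prim C 0 1)
    fun j c => prim C (j + 1) (opr (ys (y - 1) z j) (j + 1) c)
  have hmem : ∀ j, a j ∈ chains K C (j + 1) := fun j => by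
    cases j <;> exact prim_mem _ _ _
  have h0 : bd (a 0) = 1 := bd_prim (hS.exactAt 0 (Nat.zero_le _)) (one_mem_chains hS.empty) trivial
  have h : ∀ j ≤ M, IsZigzag C j y z a := by
    intro j
    induction j with
    | zero => exact fun _ => ⟨fun j _ => hmem j, h0, fun j hj => (Nat.not_lt_zero j hj).elim⟩
    | succ j ih =>
      intro hj
      have hj' := ih (by omega)
      refine ⟨fun j _ => hmem j, h0, fun i hi => ?_⟩
      rcases Nat.lt_succ_iff_lt_or_eq.mp hi with hi | rfl
      · exact hj'.bd_succ i hi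
      · exact bd_prim (hS.exactAt _ hj) (opr_mem_chains hC (hmem _) _) (hj'.isCycle hyz le_rfl)
  exact ⟨a, h M le_rfl⟩

lemma IsZigzag.eq_zero_of_orbit [DecidableEq X] {p : ℕ} [Fact p.Prime] [CharP K p]
    (hΓ : IsPGroup p Γ) {C : Set X → Prop}
    {M : ℕ} {τ : Fin (M + 1) → X} (hS : IsSphere K C M τ)
    (hC : ∀ (g : Γ) s, C s → C ((g • ·) '' s)) {y z : MonoidAlgebra K Γ} (hyz : IsEvPair y z)
    {a : (j : ℕ) → (Fin (j + 1) → X) → K} (ha : IsZigzag C M y z a) (x₀ : X)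
    (hx₀ : C (MulAction.orbit Γ x₀)) :
    opr (ys (y - 1) z M) (M + 1) (a M) = 0 := by
  let D : Set X → Prop := fun s => s ⊆ MulAction.orbit Γ x₀
  have hDC : ∀ s, D s → C s := fun s hs => hS.mono _ _ hs hx₀
  have hD : ∀ s, D s → D (insert x₀ s) := fun s hs =>
    Set.insert_subset (MulAction.mem_orbit_self x₀) hs
  have hDinv : ∀ (g : Γ) s, D s → D ((g • ·) '' s) := by
    rintro g s hs _ ⟨x, hx, rfl⟩
    exact (MulAction.mem_orbit_of_mem_orbit g (hs hx))
  let b : (j : ℕ) → (Fin (j + 1) → X) → K := fun j => j.rec (wedge x₀ 0 1)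
    fun j c => wedge x₀ (j + 1) (opr (ys (y - 1) z j) (j + 1) c)
  have hb : ∀ j, b j ∈ chains K D (j + 1) := by
    intro j
    induction j with
    | zero => exact wedge_mem_chains hD (one_mem_chains (Set.empty_subset _))
    | succ j ih => exact wedge_mem_chains hD (opr_mem_chains hDinv ih _)
  have h0 : bd (b 0) = 1 := bd_wedge_zero _ _
  have hcyc : ∀ j, bd (opr (ys (y - 1) z j) (j + 1) (b j)) = 0 := by
    intro j
    induction j with
    | zero => rw [bd_opr, h0, opr_degree_zero, aug_ys hyz, zero_smul]
    | succ j ih =>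
      have : bd (b (j + 1)) = opr (ys (y - 1) z j) (j + 1) (b j) := bd_wedge_of_isCycle (n := j + 1) _ ih
      rw [bd_opr, this, ← opr_mul_apply, ys_succ_mul hyz, opr_zero_apply]
  have hbz : IsZigzag C M y z b :=
    ⟨fun j _ => chains_mono hDC _ (hb j), h0, fun j _ => bd_wedge_of_isCycle (n := j + 1) _ (hcyc j)⟩
  rw [ha.eq hΓ hS hC hyz hbz, ← bd_wedge_of_isCycle (n := M + 1) x₀ (hcyc M)]
  have hw : wedge x₀ (M + 1) (opr (ys (y - 1) z M) (M + 1) (b M)) = 0 := by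
    refine eq_zero_of_ncard_lt (C := D) (fun s hs => ?_)
      (wedge_mem_chains hD (opr_mem_chains hDinv (hb M) _))
    exact Nat.lt_succ_of_le (hS.ncard_le s (hDC s hs))
  rw [hw, map_zero]

end Zigzag

section MapChains

variable {R R' X : Type*} [CommRing R'] [CommRing R]

/-- Change of coefficients for functions on tuples. -/
def mapC (φ : R →+* R') (n : ℕ) : ((Fin n → X) → R) →+ ((Fin n → X) → R') where
  toFun c t := φ (c t)
  map_zero' := funext fun _ => map_zero φ
  map_add' _ _ := funext fun _ => map_add φ _ _

lemma mapC_apply (φ : R →+* R') (n : ℕ) (c : (Fin n → X) → R) (t : Fin n → X) :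
    mapC φ n c t = φ (c t) := rfl

lemma Alt.mapC (φ : R →+* R') {n : ℕ} {c : (Fin n → X) → R} (h : Alt n c) :
    Alt n (mapC φ n c) := by
  induction n with
  | zero => trivial
  | succ n ih =>
    match n with
    | 0 => trivial
    | n + 1 =>
      refine ⟨fun a => ih (h.alt_slot a), fun a b r => ?_, fun a r => ?_⟩
      · rw [mapC_apply, mapC_apply, h.2.1 a b r, map_neg]
      · rw [mapC_apply, h.2.2 a r, map_zero]

lemma mapC_mem (φ : R →+* R') {C : Set X → Prop} {n : ℕ} {c : (Fin n → X) → R}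
    (h : c ∈ chains R C n) : mapC φ n c ∈ chains R' C n :=
  ⟨h.1.mapC φ, fun x hx => h.2 x fun h0 => hx (by rw [mapC_apply, h0, map_zero])⟩

lemma mapC_permRep {Γ Δ : Type*} [Group Γ] [MulAction Γ X] [Group Δ] [MulAction Δ X] {ψ : Γ →* Δ}
    (hψ : ∀ (g : Γ) (x : X), g • x = ψ g • x) (φ : R →+* R') {n : ℕ} (c : (Fin n → X) → R)
    (g : Γ) : mapC φ n (permRep R Δ (Fin n → X) (ψ g) c) =
      permRep R' Γ (Fin n → X) g (mapC φ n c) := by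
  funext t
  rw [mapC_apply, permRep_apply, permRep_apply, mapC_apply]
  refine congrArg (fun t => φ (c t)) (funext fun i => ?_)
  rw [Pi.smul_apply, Pi.smul_apply, hψ, map_inv]

lemma bd_mapC [Fintype X] (φ : R →+* R') {n : ℕ} (c : (Fin (n + 1) → X) → R) :
    bd (mapC φ (n + 1) c) = mapC φ n (bd c) := by
  funext t
  simp [bd_apply, mapC_apply]

lemma contrD_mem {Γ M : Type*} [Group Γ] [AddCommGroup M] [Module R M] {N : Submodule R M} {n : ℕ}
    {F : (Fin n → Γ) → M} (h : ∀ x, F x ∈ N) (x : Fin (n + 1) → Γ) : contrD F x ∈ N := by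
  rw [contrD]
  exact Submodule.sum_mem _ fun j _ => N.toAddSubgroup.zsmul_mem (h _) _

lemma map_dRep {Γ Γ' M M' : Type*} [Group Γ] [Group Γ'] [AddCommGroup M] [AddCommGroup M']
    [Module R M] [Module R' M'] (ρ : Representation R Γ M) (ρ' : Representation R' Γ' M')
    (ψ : Γ' →* Γ) (f : M →+ M') (hf : ∀ g m, f (ρ (ψ g) m) = ρ' g (f m)) {n : ℕ}
    (F : (Fin n → Γ) → M) (x : Fin (n + 1) → Γ') :
    f (dRep ρ F (ψ ∘ x)) = dRep ρ' (fun r => f (F (ψ ∘ r))) x := by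
  rw [dRep, dRep, map_add, contrD_comp, map_contrD]
  exact congrArg (· + _) (hf _ _)

lemma dRep_permRep_mem {Γ : Type*} [Group Γ] [MulAction Γ X] {C : Set X → Prop}
    (hC : ∀ (g : Γ) s, C s → C ((g • ·) '' s)) {n m : ℕ} {F : (Fin n → Γ) → (Fin m → X) → R}
    (h : ∀ x, F x ∈ chains R C m) (x : Fin (n + 1) → Γ) :
    dRep (permRep R Γ (Fin m → X)) F x ∈ chains R C m :=
  Submodule.add_mem _ (permRep_mem_chains hC (h _) _) (contrD_mem h x)

end MapChains

section SphereClass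

variable (S : Type u) [Group S] {X : Type*} [Fintype X] [MulAction S X]

/-- Cochains with values in the chains on `X`, lifting the augmentation. -/
noncomputable def lift (C : Set X → Prop) : (j : ℕ) → (Fin j → S) → (Fin (j + 1) → X) → k
  | 0, _ => prim C 0 1
  | j + 1, x => prim C (j + 1) (dRep (permRep k S (Fin (j + 1) → X)) (lift C j) x)

/-- The cochain obtained from `lift` in the top dimension of a sphere. -/
noncomputable def sphereClass (C : Set X → Prop) (M : ℕ) (τ : Fin (M + 1) → X)
    (x : Fin (M + 1) → S) : k :=
  dRep (permRep k S (Fin (M + 1) → X)) (lift k S C M) x τ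

lemma lift_mem (C : Set X → Prop) (j : ℕ) (x : Fin j → S) :
    lift k S C j x ∈ chains k C (j + 1) := by
  cases j <;> exact prim_mem _ _ _

variable {S} {C : Set X → Prop} {M : ℕ} {τ : Fin (M + 1) → X}

lemma bd_lift_zero (hS : IsSphere k C M τ) (x : Fin 0 → S) : bd (lift k S C 0 x) = 1 :=
  bd_prim (hS.exactAt 0 (Nat.zero_le _)) (one_mem_chains hS.empty) trivial

lemma bd_dRep {j m : ℕ} (F : (Fin j → S) → (Fin (m + 1) → X) → k) (x : Fin (j + 1) → S) :
    bd (dRep (permRep k S (Fin (m + 1) → X)) F x) =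
      dRep (permRep k S (Fin m → X)) (fun r => bd (F r)) x :=
  map_dRep (R := k) (R' := k) _ _ (MonoidHom.id S) (bd (R := k)).toAddMonoidHom
    (fun g c => bd_permRep g c) F x

lemma bd_dRep_lift (hS : IsSphere k C M τ) (hC : ∀ (g : S) s, C s → C ((g • ·) '' s))
    {j : ℕ} (hj : j ≤ M) (x : Fin (j + 1) → S) :
    bd (dRep (permRep k S (Fin (j + 1) → X)) (lift k S C j) x) = 0 := by
  induction j with
  | zero =>
    rw [bd_dRep]
    simp only [bd_lift_zero k hS]
    funext r
    simp [dRep, contrD]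
  | succ j ih =>
    have h : ∀ x, bd (lift k S C (j + 1) x) =
        dRep (permRep k S (Fin (j + 1) → X)) (lift k S C j) x := fun x =>
      bd_prim (hS.exactAt _ hj) (dRep_permRep_mem hC (lift_mem k S C j) x) (ih (by omega) x)
    rw [bd_dRep]
    simp only [h]
    exact dRep_dRep _ _ x

lemma bd_lift_succ (hS : IsSphere k C M τ) (hC : ∀ (g : S) s, C s → C ((g • ·) '' s))
    {j : ℕ} (hj : j < M) (x : Fin (j + 1) → S) :
    bd (lift k S C (j + 1) x) = dRep (permRep k S (Fin (j + 1) → X)) (lift k S C j) x :=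
  bd_prim (hS.exactAt _ hj) (dRep_permRep_mem hC (lift_mem k S C j) x)
    (bd_dRep_lift k hS hC hj.le x)

lemma sphereClass_mem_cocycles {p : ℕ} [Fact p.Prime] [CharP k p] (hp : IsPGroup p S)
    (hS : IsSphere k C M τ) (hC : ∀ (g : S) s, C s → C ((g • ·) '' s)) :
    sphereClass k S C M τ ∈ cocycles k S (M + 1) := by
  refine LinearMap.mem_ker.mpr (funext fun x => ?_)
  have h := congrFun (dRep_dRep (permRep k S (Fin (M + 1) → X)) (lift k S C M) x) τ
  rw [dRep, permRep_eq_self hp hS.injAt hC (dRep_permRep_mem hC (lift_mem k S C M) _)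
    (bd_dRep_lift k hS hC le_rfl _), Pi.add_apply] at h
  rw [d_apply]
  have h' := map_contrD (LinearMap.proj (R := k) (φ := fun _ => k) τ).toAddMonoidHom
    (dRep (permRep k S (Fin (M + 1) → X)) (lift k S C M)) x
  exact (congrArg _ h'.symm).trans h

variable {K : Type u} [Field K] [Algebra k K] {E : Type u} [Group E] [MulAction E X]

lemma isZigzag_lift (hS : IsSphere k C M τ) (hC : ∀ (g : S) s, C s → C ((g • ·) '' s))
    (ψ : E →* S) (hψ : ∀ (e : E) (x : X), e • x = ψ e • x) {y z : MonoidAlgebra K E}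
    (hyz : IsEvPair y z) :
    IsZigzag C M y z fun j => ev y z j fun r =>
      mapC (algebraMap k K) (j + 1) (lift k S C j (ψ ∘ r)) where
  mem j _ := ev_mem _ _ _ fun r => mapC_mem _ (lift_mem k S C j _)
  bd_zero := by
    rw [map_ev]
    simp only [bd_mapC, bd_lift_zero k hS]
    exact funext fun t => map_one (algebraMap k K)
  bd_succ j hj := by
    rw [map_ev]
    simp only [bd_mapC, bd_lift_succ k hS hC hj]
    rw [opr, ← ev_dRep _ hyz.aug_fst hyz.fst_mul hyz.mul_fst]
    refine congrArg (ev y z (j + 1)) (funext fun x => ?_)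
    exact map_dRep _ _ ψ _ (fun g m => mapC_permRep hψ _ m g) _ x

lemma evHom_sphereClass (ψ : E →* S) (hψ : ∀ (e : E) (x : X), e • x = ψ e • x)
    {y z : MonoidAlgebra K E} (hyz : IsEvPair y z) :
    evHom k y z ψ (sphereClass k S C M τ) = opr (ys (y - 1) z M) (M + 1)
      (ev y z M fun r => mapC (algebraMap k K) (M + 1) (lift k S C M (ψ ∘ r))) τ := by
  rw [opr, ← ev_dRep _ hyz.aug_fst hyz.fst_mul hyz.mul_fst]
  refine Eq.trans ?_
    (map_ev (LinearMap.proj (R := K) (φ := fun _ => K) τ) y z (M + 1) _).symm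
  refine congrArg (ev y z (M + 1)) (funext fun x => ?_)
  exact congrFun (map_dRep (permRep k S (Fin (M + 1) → X)) (permRep K E (Fin (M + 1) → X)) ψ
    (mapC (algebraMap k K) (M + 1)) (fun g m => mapC_permRep hψ _ m g) (lift k S C M) x) τ

end SphereClass

section Higman

variable {K Γ X : Type*} [Field K] [Group Γ] [MulAction Γ X]

/-- The sum of all group elements. -/
noncomputable def normElt (K Γ : Type*) [Field K] [Fintype Γ] : MonoidAlgebra K Γ :=
  ∑ g, MonoidAlgebra.single g 1

lemma aug_normElt {K Γ : Type*} [Field K] [Fintype Γ] :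
    aug (normElt K Γ) = (Fintype.card Γ : K) := by
  simp [normElt, aug]

/-- Multiplication of a function on tuples by a function of the underlying set. -/
def mulC (ε : Set X → K) {n : ℕ} (c : (Fin n → X) → K) (r : Fin n → X) : K :=
  ε (Set.range r) * c r

lemma range_cons_cons_comm {n : ℕ} (a b : X) (r : Fin n → X) :
    Set.range (Fin.cons a (Fin.cons b r) : Fin (n + 2) → X) =
      Set.range (Fin.cons b (Fin.cons a r) : Fin (n + 2) → X) := by
  rw [Fin.range_cons, Fin.range_cons, Fin.range_cons, Fin.range_cons, Set.insert_comm]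

lemma Alt.mulC {n : ℕ} {c : (Fin n → X) → K} (h : Alt n c) (ε : Set X → K) :
    Alt n (mulC ε c) := by
  induction n generalizing ε with
  | zero => trivial
  | succ n ih =>
    match n with
    | 0 => trivial
    | n + 1 =>
      refine ⟨fun a => ?_, fun a b r => ?_, fun a r => ?_⟩
      · convert ih (h.alt_slot a) (fun s => ε (insert a s)) using 1
        funext r
        simp only [slot, MislinExplicit.mulC, Fin.range_cons]
      · rw [MislinExplicit.mulC, MislinExplicit.mulC, h.2.1 a b r, range_cons_cons_comm, mul_neg]
      · rw [MislinExplicit.mulC, h.2.2 a r, mul_zero]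

lemma mulC_mem {C : Set X → Prop} {n : ℕ} {c : (Fin n → X) → K} (h : c ∈ chains K C n)
    (ε : Set X → K) : mulC ε c ∈ chains K C n :=
  ⟨h.1.mulC ε, fun x hx => h.2 x (right_ne_zero_of_mul hx)⟩

lemma range_smul (g : Γ) {n : ℕ} (r : Fin n → X) :
    Set.range (g • r) = (g • ·) '' Set.range r := Set.range_comp (g • ·) r

lemma permRep_eq_of_opr_sub_one {σ : Γ} (hσ : ∀ g, g ∈ Submonoid.powers σ) {n : ℕ}
    {c : (Fin n → X) → K} (h : opr (MonoidAlgebra.single σ 1 - 1) n c = 0) (g : Γ) :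
    permRep K Γ (Fin n → X) g c = c := by
  have h1 : permRep K Γ (Fin n → X) σ c = c := by
    rw [← sub_eq_zero, ← h]
    simp [opr]
  obtain ⟨m, rfl⟩ := hσ g
  induction m with
  | zero => simp
  | succ m ih =>
    simp only [pow_succ, map_mul, Module.End.mul_apply, h1] at ih ⊢
    exact ih

variable [Fintype Γ]

lemma opr_normElt {n : ℕ} (c : (Fin n → X) → K) (r : Fin n → X) :
    opr (normElt K Γ) n c r = ∑ g : Γ, c (g • r) := by
  rw [opr_apply, normElt, map_sum]
  simp only [pair_single, one_smul]
  exact Equiv.sum_comp (Equiv.inv Γ) fun g => c (g • r)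

variable {C : Set X → Prop} {ε : Set X → K}

lemma opr_normElt_mulC (hε : ∀ s, C s → s.Nonempty → ∑ g : Γ, ε ((g • ·) '' s) = 1) {n : ℕ}
    {c : (Fin (n + 1) → X) → K} (hc : c ∈ chains K C (n + 1))
    (h : ∀ g : Γ, permRep K Γ (Fin (n + 1) → X) g c = c) :
    opr (normElt K Γ) (n + 1) (mulC ε c) = c := by
  funext r
  have h' : ∀ g : Γ, c (g • r) = c r := fun g => by
    simpa using congrFun (h g⁻¹) r
  simp only [opr_normElt, mulC, h', range_smul, ← Finset.sum_mul]
  by_cases h0 : c r = 0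
  · rw [h0, mul_zero]
  · rw [hε _ (hc.2 r h0) (Set.range_nonempty r), one_mul]

lemma sum_permRep_mulC (hε : ∀ s, C s → s.Nonempty → ∑ g : Γ, ε ((g • ·) '' s) = 1) {n : ℕ}
    {c : (Fin (n + 1) → X) → K} (hc : c ∈ chains K C (n + 1)) :
    ∑ g : Γ, permRep K Γ (Fin (n + 1) → X) g
      (mulC ε (permRep K Γ (Fin (n + 1) → X) g⁻¹ c)) = c := by
  funext r
  simp only [Finset.sum_apply, permRep_apply, mulC, inv_inv, smul_inv_smul, range_smul,
    ← Finset.sum_mul]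
  have h := Equiv.sum_comp (Equiv.inv Γ) fun g => ε ((g • ·) '' Set.range r)
  simp only [Equiv.inv_apply] at h
  rw [h]
  by_cases h0 : c r = 0
  · rw [h0, mul_zero]
  · rw [hε _ (hc.2 r h0) (Set.range_nonempty r), one_mul]

lemma exists_eq_opr_sub_one (hε : ∀ s, C s → s.Nonempty → ∑ g : Γ, ε ((g • ·) '' s) = 1)
    (hC : ∀ (g : Γ) s, C s → C ((g • ·) '' s)) {σ : Γ} (hσ : ∀ g, g ∈ Submonoid.powers σ) {n : ℕ}
    {c : (Fin (n + 1) → X) → K} (hc : c ∈ chains K C (n + 1))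
    (h : opr (normElt K Γ) (n + 1) c = 0) :
    ∃ e ∈ chains K C (n + 1), opr (MonoidAlgebra.single σ 1 - 1) (n + 1) e = c := by
  have hw : ∀ g : Γ, ∃ w : MonoidAlgebra K Γ,
      MonoidAlgebra.single g 1 - 1 = (MonoidAlgebra.single σ 1 - 1) * w := by
    intro g
    obtain ⟨n, rfl⟩ := hσ g
    refine ⟨∑ i ∈ Finset.range n, MonoidAlgebra.single σ 1 ^ i, ?_⟩
    rw [mul_geom_sum, MonoidAlgebra.single_pow, one_pow]
  choose w hw using hw
  refine ⟨∑ g : Γ, opr (w g) (n + 1) (mulC ε (permRep K Γ (Fin (n + 1) → X) g⁻¹ c)),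
    Submodule.sum_mem _ fun g _ => opr_mem_chains hC (mulC_mem (permRep_mem_chains hC hc _) _) _, ?_⟩
  rw [map_sum]
  simp only [← opr_mul_apply, ← hw]
  have h1 : ∀ g : Γ, opr (MonoidAlgebra.single g 1 - 1) (n + 1)
      (mulC ε (permRep K Γ (Fin (n + 1) → X) g⁻¹ c)) =
      permRep K Γ (Fin (n + 1) → X) g (mulC ε (permRep K Γ (Fin (n + 1) → X) g⁻¹ c)) -
        mulC ε (permRep K Γ (Fin (n + 1) → X) g⁻¹ c) := by
    intro g
    simp [opr]
  simp only [h1, Finset.sum_sub_distrib]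
  rw [sum_permRep_mulC hε hc, sub_eq_self]
  funext r
  simp only [Finset.sum_apply, mulC, permRep_apply, inv_inv, ← Finset.mul_sum]
  have h2 := congrFun h r
  rw [opr_normElt] at h2
  rw [h2, Pi.zero_apply, mul_zero]

lemma exists_eq_opr_ys (hε : ∀ s, C s → s.Nonempty → ∑ g : Γ, ε ((g • ·) '' s) = 1)
    (hC : ∀ (g : Γ) s, C s → C ((g • ·) '' s)) {σ : Γ} (hσ : ∀ g, g ∈ Submonoid.powers σ)
    {j n : ℕ} {c : (Fin (n + 1) → X) → K} (hc : c ∈ chains K C (n + 1))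
    (h : opr (ys (MonoidAlgebra.single σ 1 - 1) (normElt K Γ) j) (n + 1) c = 0) :
    ∃ e ∈ chains K C (n + 1),
      opr (ys (MonoidAlgebra.single σ 1 - 1) (normElt K Γ) (j + 1)) (n + 1) e = c := by
  by_cases hj : Even j
  · simp only [ys, hj, Nat.even_add_one, if_true, not_true, if_false] at h ⊢
    exact ⟨mulC ε c, mulC_mem hc ε, opr_normElt_mulC hε hc (permRep_eq_of_opr_sub_one hσ h)⟩
  · simp only [ys, hj, Nat.even_add_one, if_true, not_false_eq_true, if_false] at h ⊢
    exact exists_eq_opr_sub_one hε hC hσ hc h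

lemma IsZigzag.ne_zero [Fintype X] (hmono : ∀ s t, s ⊆ t → C t → C s)
    (hε : ∀ s, C s → s.Nonempty → ∑ g : Γ, ε ((g • ·) '' s) = 1)
    (hC : ∀ (g : Γ) s, C s → C ((g • ·) '' s)) {σ : Γ} (hσ : ∀ g, g ∈ Submonoid.powers σ)
    (hK : (Fintype.card Γ : K) = 0) {M : ℕ} {b : (j : ℕ) → (Fin (j + 1) → X) → K}
    (hb : IsZigzag C M (MonoidAlgebra.single σ 1) (normElt K Γ) b) :
    opr (ys (MonoidAlgebra.single σ 1 - 1) (normElt K Γ) M) (M + 1) (b M) ≠ 0 := by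
  intro h0
  have key : ∀ i j, i + j = M → ∃ c ∈ chains K C (j + 2), ∃ e ∈ chains K C (j + 1),
      b j = bd c + opr (ys (MonoidAlgebra.single σ 1 - 1) (normElt K Γ) (j + 1)) (j + 1) e := by
    intro i
    induction i with
    | zero =>
      rintro j hj
      obtain rfl : j = M := by omega
      obtain ⟨e, he, h⟩ := exists_eq_opr_ys hε hC hσ (hb.mem j le_rfl) h0
      exact ⟨0, Submodule.zero_mem _, e, he, by rw [h, map_zero, zero_add]⟩
    | succ i ih =>
      intro j hj
      obtain ⟨c, hc, e, he, h⟩ := ih (j + 1) (by omega)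
      have h1 : ys (MonoidAlgebra.single σ 1 - 1) (normElt K Γ) (j + 1 + 1) =
          ys (MonoidAlgebra.single σ 1 - 1) (normElt K Γ) j := by
        simp only [ys, Nat.even_add_one, not_not]
      have h2 := congrArg bd h
      rw [hb.bd_succ j (by omega), map_add, hc.1.bd_bd, zero_add, bd_opr, h1, ← sub_eq_zero,
        ← map_sub] at h2
      obtain ⟨e', he', h3⟩ := exists_eq_opr_ys hε hC hσ (Submodule.sub_mem _
        (hb.mem j (by omega)) (bd_mem_chains hmono he)) h2
      exact ⟨e, he, e', he', by rw [h3, add_sub_cancel]⟩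
  obtain ⟨c, hc, e, he, h⟩ := key M 0 rfl
  have h1 := congrArg bd h
  rw [hb.bd_zero, map_add, hc.1.bd_bd, zero_add, bd_opr, opr_degree_zero] at h1
  have h2 := congrFun h1 ![]
  simp [ys, aug_normElt, hK] at h2

end Higman

lemma charP_monoidAlgebra {K Γ : Type*} [Field K] [CommGroup Γ] {p : ℕ} [CharP K p] :
    CharP (MonoidAlgebra K Γ) p :=
  charP_of_injective_algebraMap' K p

section PowerElements

variable {K Γ : Type*} [Field K] [CommGroup Γ] {p : ℕ} [Fact p.Prime] [CharP K p]

lemma pow_char_eq_single (hΓ : ∀ a : Γ, a ^ p = 1) (x : MonoidAlgebra K Γ) :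
    x ^ p = MonoidAlgebra.single 1 (aug x ^ p) := by
  have := charP_monoidAlgebra (K := K) (Γ := Γ) (p := p)
  induction x using MonoidAlgebra.induction_linear with
  | zero => simp [(Fact.out (p := p.Prime)).ne_zero]
  | add x y hx hy => rw [add_pow_char, hx, hy, map_add, add_pow_char, MonoidAlgebra.single_add]
  | single g c => rw [MonoidAlgebra.single_pow, hΓ]; simp [aug]

lemma aug_mul (x y : MonoidAlgebra K Γ) : aug (x * y) = aug x * aug y := by
  induction x using MonoidAlgebra.induction_linear with
  | zero => simp
  | add x x' hx hx' => rw [add_mul, map_add, hx, hx', map_add, add_mul]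
  | single g c =>
    induction y using MonoidAlgebra.induction_linear with
    | zero => simp
    | add y y' hy hy' => rw [mul_add, map_add, hy, hy', map_add, mul_add]
    | single h c' => simp [aug, MonoidAlgebra.single_mul_single]

lemma isEvPair_pow (hΓ : ∀ a : Γ, a ^ p = 1) (hp : 1 < p) {x : MonoidAlgebra K Γ}
    (hx : aug x = 1) : IsEvPair x ((x - 1) ^ (p - 1)) := by
  have h0 : aug (x - 1) = 0 := by rw [map_sub, hx, aug_one, sub_self]
  have h1 : (x - 1) * (x - 1) ^ (p - 1) = 0 := by
    rw [← pow_succ', Nat.sub_add_cancel hp.le, pow_char_eq_single hΓ, h0, zero_pow (by omega),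
      MonoidAlgebra.single_zero]
  have h2 : x * (x - 1) ^ (p - 1) = (x - 1) ^ (p - 1) := by
    rw [← sub_eq_zero, ← h1, sub_mul, one_mul]
  refine ⟨hx, ?_, h2, by rw [mul_comm, h2]⟩
  obtain ⟨q, hq⟩ : ∃ q, p - 1 = q + 1 := ⟨p - 2, by omega⟩
  rw [hq, pow_succ, aug_mul, h0, mul_zero]

end PowerElements

lemma geom_sum_eq_sub_one_pow {R : Type*} [CommRing R] {p : ℕ} [Fact p.Prime] [CharP R p] (x : R) :
    ∑ i ∈ Finset.range p, x ^ i = (x - 1) ^ (p - 1) := by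
  have h : ∑ i ∈ Finset.range p, (Polynomial.X : Polynomial (ZMod p)) ^ i =
      (Polynomial.X - 1) ^ (p - 1) := by
    have h0 : (Polynomial.X - 1 : Polynomial (ZMod p)) ≠ 0 := by
      simpa using Polynomial.X_sub_C_ne_zero (1 : ZMod p)
    refine mul_left_cancel₀ h0 ?_
    rw [mul_geom_sum, ← pow_succ', Nat.sub_add_cancel (Fact.out (p := p.Prime)).one_lt.le,
      sub_pow_char, one_pow]
  have h' := congrArg (Polynomial.eval₂RingHom (ZMod.castHom (dvd_refl p) R) x) h
  rw [map_sum, map_pow, map_sub] at h'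
  simpa using h'

section Cyclic

variable {p : ℕ} [Fact p.Prime]

/-- The generator of the cyclic group of order `p`. -/
def zgen (p : ℕ) : Multiplicative (ZMod p) := Multiplicative.ofAdd 1

lemma zgen_pow (n : ℕ) : zgen p ^ n = Multiplicative.ofAdd (n : ZMod p) := by
  rw [zgen, ← ofAdd_nsmul, nsmul_one]

lemma zgen_pow_val (g : Multiplicative (ZMod p)) : zgen p ^ g.toAdd.val = g := by
  rw [zgen_pow, ZMod.natCast_zmod_val, ofAdd_toAdd]

lemma pow_zmod (g : Multiplicative (ZMod p)) : g ^ p = 1 := by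
  rw [← ofAdd_toAdd g, ← ofAdd_nsmul]
  simp

variable {K : Type*} [Field K] [CharP K p]

lemma normElt_zmod : normElt K (Multiplicative (ZMod p)) =
    (MonoidAlgebra.single (zgen p) 1 - 1) ^ (p - 1) := by
  have := charP_monoidAlgebra (K := K) (Γ := Multiplicative (ZMod p)) (p := p)
  rw [← geom_sum_eq_sub_one_pow, normElt]
  refine (Finset.sum_bij (fun i _ => zgen p ^ i) (fun i _ => Finset.mem_univ _)
    (fun i hi j hj h => ?_) (fun g _ => ?_) fun i _ => ?_).symm
  · rw [zgen_pow, zgen_pow, Multiplicative.ofAdd.injective.eq_iff, ZMod.natCast_eq_natCast_iff] at h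
    exact Nat.ModEq.eq_of_lt_of_lt h (Finset.mem_range.mp hi) (Finset.mem_range.mp hj)
  · exact ⟨g.toAdd.val, Finset.mem_range.mpr (ZMod.val_lt _), zgen_pow_val g⟩
  · rw [MonoidAlgebra.single_pow, one_pow]

lemma exists_sub_one_eq {x : MonoidAlgebra K (Multiplicative (ZMod p))} (hx : aug x = 1) :
    ∃ v : MonoidAlgebra K (Multiplicative (ZMod p)),
      x - 1 = v * (MonoidAlgebra.single (zgen p) 1 - 1) ∧
      v ^ p = MonoidAlgebra.single 1 (ell K (MonoidHom.id _) x ^ p) := by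
  let w : Multiplicative (ZMod p) → MonoidAlgebra K (Multiplicative (ZMod p)) := fun g =>
    ∑ i ∈ Finset.range g.toAdd.val, MonoidAlgebra.single (zgen p) 1 ^ i
  have hw : ∀ g, (MonoidAlgebra.single (zgen p) 1 - 1) * w g = MonoidAlgebra.single g 1 - 1 := by
    intro g
    rw [mul_geom_sum, MonoidAlgebra.single_pow, zgen_pow_val, one_pow]
  have hs : ∀ x : MonoidAlgebra K (Multiplicative (ZMod p)),
      pair (fun g => MonoidAlgebra.single g 1) x = x := by
    intro x
    induction x using MonoidAlgebra.induction_linear with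
    | zero => simp
    | add x y hx hy => rw [map_add, hx, hy]
    | single g c => simp
  refine ⟨pair w x, ?_, ?_⟩
  · have h := map_pair (LinearMap.mulLeft K (MonoidAlgebra.single (zgen p) (1 : K) - 1)) w x
    simp only [LinearMap.mulLeft_apply, hw] at h
    rw [mul_comm, h, pair_sub, pair_const, hs, hx, one_smul]
  · rw [pow_char_eq_single pow_zmod, map_pair aug w x, ell]
    have h : ∀ g, aug (w g) = ZMod.castHom (dvd_refl p) K g.toAdd := by
      intro g
      simp only [w, map_sum, MonoidAlgebra.single_pow, one_pow]
      simp [aug]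
    simp only [h]
    rfl

variable {X : Type*} [Fintype X] [MulAction (Multiplicative (ZMod p)) X]

lemma exists_isZigzag_mul {C : Set X → Prop} {M : ℕ}
    (hC : ∀ (g : Multiplicative (ZMod p)) s, C s → C ((g • ·) '' s))
    {b : (j : ℕ) → (Fin (j + 1) → X) → K}
    (hb : IsZigzag C M (MonoidAlgebra.single (zgen p) 1) (normElt K _) b)
    {x : MonoidAlgebra K (Multiplicative (ZMod p))} (hx : aug x = 1) {N : ℕ} (hN : M + 1 = 2 * N) :
    ∃ a, IsZigzag C M x ((x - 1) ^ (p - 1)) a ∧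
      opr (ys (x - 1) ((x - 1) ^ (p - 1)) M) (M + 1) (a M) =
        ell K (MonoidHom.id _) x ^ (p * N) •
          opr (ys (MonoidAlgebra.single (zgen p) 1 - 1) (normElt K _) M) (M + 1) (b M) := by
  obtain ⟨v, hv, hvp⟩ := exists_sub_one_eq hx
  let g : ℕ → MonoidAlgebra K (Multiplicative (ZMod p)) := fun j =>
    if Even j then v ^ (p * (j / 2)) else v ^ (p * (j / 2) + 1)
  have hp := (Fact.out (p := p.Prime)).one_lt
  have hg : ∀ j, ys (x - 1) ((x - 1) ^ (p - 1)) j * g j =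
      g (j + 1) * ys (MonoidAlgebra.single (zgen p) 1 - 1) (normElt K _) j := by
    intro j
    rcases Nat.even_or_odd' j with ⟨i, rfl | rfl⟩
    · have h1 : (2 * i + 1) / 2 = i := by omega
      simp only [ys, g, even_two_mul, if_true, Nat.even_add_one, not_true, if_false, h1,
        Nat.mul_div_cancel_left i two_pos]
      rw [hv, pow_succ]
      ring
    · have h1 : (2 * i + 1) / 2 = i := by omega
      have h2 : (2 * i + 1 + 1) / 2 = i + 1 := by omega
      simp only [ys, g, even_two_mul, Nat.even_add_one, not_true, if_false, h1, h2,
        not_false_eq_true, if_true]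
      rw [normElt_zmod, hv, mul_pow, mul_add p i 1, mul_one, pow_succ, pow_add]
      have h3 : v ^ p = v ^ (p - 1) * v := by rw [← pow_succ, Nat.sub_add_cancel hp.le]
      rw [h3]
      ring
  have h0 : g 0 = 1 := by simp [g]
  refine ⟨fun j => opr (g j) (j + 1) (b j), ⟨fun j hj => opr_mem_chains hC (hb.mem j hj) _, ?_,
    fun j hj => ?_⟩, ?_⟩
  · rw [h0, bd_opr, hb.bd_zero, opr_degree_zero, aug_one, one_smul]
  · rw [bd_opr, hb.bd_succ j hj, ← opr_mul_apply, ← opr_mul_apply, hg]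
  · rw [← opr_mul_apply, hg, opr_mul_apply]
    have h1 : g (M + 1) = MonoidAlgebra.single 1 (ell K (MonoidHom.id _) x ^ (p * N)) := by
      simp only [g, hN, even_two_mul, if_true, Nat.mul_div_cancel_left N two_pos]
      rw [pow_mul, hvp, MonoidAlgebra.single_pow, one_pow, ← pow_mul]
    rw [h1, opr_single, map_one, Module.End.one_apply]

end Cyclic

section Shift

variable {T : Type*} {p : ℕ}

/-- The cyclic group acts on `T × ZMod p` by translations. -/
instance shiftAction : MulAction (Multiplicative (ZMod p)) (T × ZMod p) where
  smul g x := (x.1, x.2 + g.toAdd)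
  one_smul x := Prod.ext rfl (add_zero x.2)
  mul_smul g h x := Prod.ext rfl (by
    change x.2 + (g * h).toAdd = x.2 + h.toAdd + g.toAdd
    rw [toAdd_mul, add_assoc, add_comm g.toAdd])

lemma shift_def (g : Multiplicative (ZMod p)) (x : T × ZMod p) : g • x = (x.1, x.2 + g.toAdd) := rfl

lemma mem_shift_image (g : Multiplicative (ZMod p)) (s : Set (T × ZMod p)) (t : T) (i : ZMod p) :
    (t, i) ∈ (g • ·) '' s ↔ (t, i - g.toAdd) ∈ s := by
  constructor
  · rintro ⟨x, hx, h⟩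
    obtain ⟨rfl, rfl⟩ := Prod.ext_iff.mp h
    simpa [shift_def] using hx
  · intro h
    exact ⟨_, h, by simp [shift_def]⟩

lemma Circ.shift {V : Finset T} (g : Multiplicative (ZMod p)) {s : Set (T × ZMod p)}
    (hs : Circ V s) : Circ V ((g • ·) '' s) := by
  refine ⟨?_, fun t => ?_⟩
  · rintro _ ⟨x, hx, rfl⟩
    exact hs.1 x hx
  · obtain ⟨i, hi⟩ := hs.2 t
    refine ⟨i + g.toAdd, fun j hj => ?_⟩
    rcases hi _ ((mem_shift_image g s t j).mp hj) with h | h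
    · left
      rw [← h, sub_add_cancel]
    · right
      rw [sub_eq_iff_eq_add] at h
      rw [h]
      ring

/-- A chosen element of a nonempty set. -/
noncomputable def chosen [Nonempty T] (s : Set T) : T :=
  open Classical in if h : s.Nonempty then h.some else Classical.arbitrary T

lemma chosen_mem [Nonempty T] {s : Set T} (h : s.Nonempty) : chosen s ∈ s := by
  rw [chosen, dif_pos h]
  exact h.some_mem

/-- A function on subsets of `T × ZMod p` whose sums over orbits are `1`. -/
noncomputable def epsC [Nonempty T] (K : Type*) [Field K] (s : Set (T × ZMod p)) : K :=
  open Classical in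
  if (chosen (Prod.fst '' s), 0) ∈ s ∧ (chosen (Prod.fst '' s), -1) ∉ s then 1 else 0

lemma sum_epsC [Nonempty T] [Fact p.Prime] (hp : 2 < p) (K : Type*) [Field K] {V : Finset T}
    (s : Set (T × ZMod p)) (hs : Circ V s) (hne : s.Nonempty) :
    ∑ g : Multiplicative (ZMod p), epsC K ((g • ·) '' s) = 1 := by
  classical
  have h2 := two_ne_zero_zmod hp
  have h1 : (1 : ZMod p) ≠ 0 := one_ne_zero
  set t := chosen (Prod.fst '' s) with ht
  have hfst : ∀ g : Multiplicative (ZMod p), Prod.fst '' ((g • ·) '' s) = Prod.fst '' s := by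
    intro g
    rw [Set.image_image]
    rfl
  obtain ⟨⟨t', j⟩, hj, hj'⟩ := chosen_mem (hne.image Prod.fst)
  obtain rfl : t' = t := hj'
  have key : ∃ i, (t, i) ∈ s ∧ (t, i - 1) ∉ s ∧
      ∀ l, (t, l) ∈ s → (t, l - 1) ∉ s → l = i := by
    obtain ⟨i, hi⟩ := hs.2 t
    by_cases h : (t, i) ∈ s
    · refine ⟨i, h, fun h' => ?_, fun l hl hl' => ?_⟩
      · rcases hi _ h' with h'' | h''
        · exact h1 (by linear_combination -h'')
        · exact h2 (by linear_combination -h'')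
      · rcases hi _ hl with rfl | rfl
        · rfl
        · rw [add_sub_cancel_right] at hl'
          exact (hl' h).elim
    · have h3 : ∀ l, (t, l) ∈ s → l = i + 1 := fun l hl =>
        (hi l hl).resolve_left fun h' => h (h' ▸ hl)
      refine ⟨i + 1, h3 j hj ▸ hj, by rwa [add_sub_cancel_right], fun l hl _ => h3 l hl⟩
  obtain ⟨i, hi, hi', huniq⟩ := key
  have heps : ∀ g : Multiplicative (ZMod p), epsC K ((g • ·) '' s) =
      if g = Multiplicative.ofAdd (-i) then 1 else 0 := by
    intro g
    rw [epsC, hfst, ← ht]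
    simp only [mem_shift_image]
    refine if_congr ⟨fun h => ?_, ?_⟩ rfl rfl
    · have := huniq (0 - g.toAdd) h.1 (by
        have h' := h.2
        rwa [show -1 - g.toAdd = 0 - g.toAdd - 1 by ring] at h')
      rw [← this, zero_sub, neg_neg, ofAdd_toAdd]
    · rintro rfl
      rw [toAdd_ofAdd, zero_sub, neg_neg, sub_neg_eq_add, neg_add_eq_sub]
      exact ⟨hi, hi'⟩
  simp only [heps]
  simp

lemma exists_isSphere [Fintype T] [Nonempty T] [Fact p.Prime] (hp : 2 < p) {M : ℕ}
    (hM : M + 1 = 2 * Fintype.card T) : ∃ τ : Fin (M + 1) → T × ZMod p,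
      ∀ (R : Type u) [Field R], IsSphere R (Circ (Finset.univ : Finset T)) M τ := by
  classical
  have h := circ_injAt.{u} hp (Finset.univ : Finset T)
  rw [Finset.card_univ, ← hM] at h
  obtain ⟨τ, hτ⟩ := h
  refine ⟨τ, fun R _ => ⟨fun s t h ht => ht.mono h, ?_, fun n hn => ?_, hτ R, fun s hs => ?_⟩⟩
  · exact ⟨fun x hx => hx.elim, fun t => ⟨0, fun j hj => hj.elim⟩⟩
  · refine circ_exactAt hp R _ n ?_
    rw [Finset.card_univ, ← hM]
    omega
  · have := hs.ncard_le
    rwa [Finset.card_univ, ← hM] at this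

end Shift

section Class

variable {S : Type u} [Group S] {T : Type*} [Fintype T] [Nonempty T] {p : ℕ} [Fact p.Prime]
  [CharP k p] [MulAction S (T × ZMod p)] {E : Type u} [CommGroup E]

lemma pair_mapDomain {K Γ Δ M : Type*} [CommRing K] [AddCommGroup M] [Module K M] [Group Γ]
    [Group Δ] (χ : Γ →* Δ) (φ : Δ → M) (x : MonoidAlgebra K Γ) :
    pair φ (MonoidAlgebra.mapDomainAlgHom K K χ x) = pair (fun g => φ (χ g)) x := by
  induction x using MonoidAlgebra.induction_linear with
  | zero => simp
  | add x y hx hy => rw [map_add, map_add, hx, hy, map_add]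
  | single g c => simp

lemma opr_mapDomain {K Γ Δ X : Type*} [CommRing K] [Group Γ] [Group Δ] [MulAction Γ X]
    [MulAction Δ X] (χ : Γ →* Δ) (h : ∀ (g : Γ) (x : X), g • x = χ g • x) (x : MonoidAlgebra K Γ)
    (n : ℕ) (c : (Fin n → X) → K) :
    opr x n c = opr (MonoidAlgebra.mapDomainAlgHom K K χ x) n c := by
  funext r
  rw [opr_apply, opr_apply, pair_mapDomain]
  refine congrArg (fun φ => pair φ x) (funext fun g => congrArg c (funext fun i => ?_))
  rw [Pi.smul_apply, Pi.smul_apply, h, map_inv]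

theorem exists_sphere_cocycle (hp : 2 < p) (hS : IsPGroup p S)
    (hC : ∀ (g : S) (s : Set (T × ZMod p)),
      Circ Finset.univ s → Circ Finset.univ ((g • ·) '' s))
    (K : Type u) [Field K] [Algebra k K] [CharP K p] (hE : ∀ a : E, a ^ p = 1) :
    ∃ ζ ∈ cocycles k S (2 * Fintype.card T), ∃ c : K, c ≠ 0 ∧
      ∀ (y : MonoidAlgebra K E), aug y = 1 → ∀ ψ : E →* S,
        (∀ x₀ : T × ZMod p, Circ Finset.univ (Set.range fun e => ψ e • x₀) →
          evHom k y ((y - 1) ^ (p - 1)) ψ ζ = 0) ∧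
        ∀ χ : E →* Multiplicative (ZMod p), (∀ e (x : T × ZMod p), ψ e • x = χ e • x) →
          evHom k y ((y - 1) ^ (p - 1)) ψ ζ = ell K χ y ^ (p * Fintype.card T) * c := by
  classical
  obtain ⟨M, hM⟩ : ∃ M, M + 1 = 2 * Fintype.card T :=
    ⟨2 * Fintype.card T - 1, by have := Fintype.card_pos (α := T); omega⟩
  rw [← hM]
  obtain ⟨τ, hτ⟩ := exists_isSphere.{u} hp hM
  have hCZ : ∀ (g : Multiplicative (ZMod p)) (s : Set (T × ZMod p)),
      Circ Finset.univ s → Circ Finset.univ ((g • ·) '' s) := fun g s hs => hs.shift g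
  have hσ : ∀ g, g ∈ Submonoid.powers (zgen p) := fun g => ⟨_, zgen_pow_val g⟩
  have hK : (Fintype.card (Multiplicative (ZMod p)) : K) = 0 := by simp
  have hZ : IsEvPair (MonoidAlgebra.single (zgen p) (1 : K)) (normElt K _) := by
    rw [normElt_zmod]
    exact isEvPair_pow pow_zmod (by omega) (by simp [aug])
  obtain ⟨b, hb⟩ := exists_isZigzag (hτ K) hCZ hZ
  have hb0 := hb.ne_zero (fun s t h ht => ht.mono h)
    (fun s hs hne => sum_epsC hp K s hs hne) hCZ hσ hK
  refine ⟨sphereClass k S (Circ Finset.univ) M τ, sphereClass_mem_cocycles k hS (hτ k) hC,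
    opr (ys (MonoidAlgebra.single (zgen p) 1 - 1) (normElt K _) M) (M + 1) (b M) τ,
    fun h => hb0 ((hτ K).injAt _ (opr_mem_chains hCZ (hb.mem M le_rfl) _) (hb.isCycle hZ le_rfl) h),
    fun y hy ψ => ?_⟩
  have hyz : IsEvPair y ((y - 1) ^ (p - 1)) := isEvPair_pow hE (by omega) hy
  have hEp : IsPGroup p E := fun a => ⟨1, by rw [pow_one, hE]⟩
  let _ : MulAction E (T × ZMod p) := MulAction.compHom _ ψ
  have hψ : ∀ (e : E) (x : T × ZMod p), e • x = ψ e • x := fun _ _ => rfl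
  have hCE : ∀ (g : E) (s : Set (T × ZMod p)),
      Circ Finset.univ s → Circ Finset.univ ((g • ·) '' s) := fun g => hC (ψ g)
  have hl := isZigzag_lift k (hτ k) hC ψ hψ hyz
  rw [evHom_sphereClass k ψ hψ hyz]
  refine ⟨fun x₀ hx₀ => ?_, fun χ hχ => ?_⟩
  · rw [hl.eq_zero_of_orbit hEp (hτ K) hCE hyz x₀ hx₀]
    rfl
  · set f := MonoidAlgebra.mapDomainAlgHom K K χ with hf
    have hop : ∀ (x : MonoidAlgebra K E) (n : ℕ) (c : (Fin n → T × ZMod p) → K),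
        opr x n c = opr (f x) n c := opr_mapDomain χ hχ
    have hfy : aug (f y) = 1 := (pair_mapDomain χ _ y).trans hy
    have hys : ∀ j, f (ys (y - 1) ((y - 1) ^ (p - 1)) j) =
        ys (f y - 1) ((f y - 1) ^ (p - 1)) j := by
      intro j
      by_cases hj : Even j <;> simp [ys, hj]
    obtain ⟨a, ha, haM⟩ := exists_isZigzag_mul hCZ hb hfy hM
    have ha' : IsZigzag (Circ Finset.univ) M y ((y - 1) ^ (p - 1)) a :=
      ⟨ha.mem, ha.bd_zero, fun j hj => by rw [hop, hys]; exact ha.bd_succ j hj⟩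
    have hell : ell K (MonoidHom.id _) (f y) = ell K χ y := pair_mapDomain χ _ y
    rw [hl.eq hEp (hτ K) hCE hyz ha', hop, hys, haM, hell]
    rfl

end Class

section CupCocycle

variable {G : Type u} [Group G]

lemma slot_castCochain_cup {G : Type u} {m n N : ℕ} (F : (Fin (m + 1) → G) → k)
    (F' : (Fin n → G) → k) (h : m + 1 + n = N + 1) (h' : m + n = N) (g : G) :
    slot g (castCochain k h (cup k F F')) = castCochain k h' (cup k (slot g F) F') := by
  subst h'
  exact slot_cup_succ k F F' h g

lemma contrD_cup {m n N : ℕ} (F : (Fin m → G) → k) {F' : (Fin n → G) → k}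
    (hF' : F' ∈ cocycles k G n) (h : m + n = N) (x : Fin (N + 1) → G) :
    contrD (castCochain k h (cup k F F')) x =
      castCochain k (by omega : m + 1 + n = N + 1) (cup k (contrD F) F') x := by
  induction m generalizing N with
  | zero =>
    obtain rfl : n = N := by omega
    rw [castCochain_cup_zero]
    have h1 := map_contrD (AddMonoidHom.mulLeft (F ![])) F' x
    simp only [AddMonoidHom.coe_mulLeft] at h1
    rw [← h1, castCochain, cup, contrD_zero, eq_neg_of_add_eq_zero_right (cocycle_eq k hF' x),
      mul_neg, neg_mul]
    congr 3
    funext i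
    rw [Fin.tail]
    congr 1
    ext
    simp
  | succ m ih =>
    obtain ⟨N, rfl⟩ : ∃ N', N = N' + 1 := ⟨m + n, by omega⟩
    obtain ⟨g, r, rfl⟩ : ∃ g r, x = Fin.cons g r := ⟨_, _, (Fin.cons_self_tail x).symm⟩
    have h' : m + n = N := by omega
    have h1 : castCochain k h (cup k F F') (Fin.cons (g * r 0) (Fin.tail r)) =
        castCochain k h' (cup k (slot (g * r 0) F) F') (Fin.tail r) :=
      congrFun (slot_castCochain_cup k F F' h h' _) _
    have h2 : castCochain k (by omega : m + 1 + 1 + n = N + 1 + 1) (cup k (contrD F) F')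
        (Fin.cons g r) = castCochain k (by omega : m + 1 + n = N + 1)
          (cup k (slot g (contrD F)) F') r :=
      congrFun (slot_castCochain_cup k (contrD F) F' _ _ g) r
    rw [contrD_cons, slot_castCochain_cup k F F' h h', ih, h1, h2]
    simp only [castCochain, cup, slot_contrD]
    rw [sub_mul, neg_mul]
    congr 4
    · funext i
      simp only [Fin.tail]
      congr 1
      ext
      simp
      omega

lemma cup_mem_cocycles {m n : ℕ} {F : (Fin m → G) → k} {F' : (Fin n → G) → k}
    (hF : F ∈ cocycles k G m) (hF' : F' ∈ cocycles k G n) :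
    cup k F F' ∈ cocycles k G (m + n) := by
  refine LinearMap.mem_ker.mpr (funext fun x => ?_)
  have h1 := contrD_cup k F hF' rfl x
  have h2 := cocycle_eq k hF fun i => x (Fin.cast (by omega) (Fin.castAdd n i))
  rw [d_apply]
  change _ + contrD (castCochain k rfl (cup k F F')) x = 0
  rw [h1]
  simp only [castCochain, cup]
  rw [eq_neg_of_add_eq_zero_right h2, neg_mul]
  refine add_eq_zero_iff_eq_neg.mpr ?_
  rw [neg_neg]
  congr 2
  funext i
  simp only [Fin.tail]
  congr 1
  ext
  simp
  omega

end CupCocycle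

section Generic

variable {E : Type u} [CommGroup E] {p : ℕ} [Fact p.Prime]

lemma ell_mul (K : Type*) [Field K] [CharP K p] (χ χ' : E →* Multiplicative (ZMod p))
    (y : MonoidAlgebra K E) : ell K (χ * χ') y = ell K χ y + ell K χ' y := by
  rw [ell, ell, ell, ← pair_add]
  congr 2
  funext a
  simp

lemma ell_injective {K : Type*} [Field K] [CharP K p] {y : MonoidAlgebra K E}
    (hgen : ∀ χ : E →* Multiplicative (ZMod p), χ ≠ 1 → ell K χ y ≠ 0)
    {χ χ' : E →* Multiplicative (ZMod p)} (h : ell K χ y = ell K χ' y) : χ = χ' := by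
  by_contra hne
  refine hgen (χ * χ'⁻¹) (fun h1 => hne (mul_inv_eq_one.mp h1)) ?_
  have h2 := ell_mul K (χ * χ'⁻¹) χ' y
  rw [inv_mul_cancel_right, h] at h2
  exact right_eq_add.mp h2

lemma exists_generic [CharP k p] [Finite E] : ∃ (K : Type u) (_ : Field K) (_ : Algebra k K)
    (_ : CharP K p) (y : MonoidAlgebra K E), aug y = 1 ∧
      ∀ χ : E →* Multiplicative (ZMod p), χ ≠ 1 → ell K χ y ≠ 0 := by
  classical
  have := Fintype.ofFinite E
  let R := MvPolynomial E k
  let K := FractionRing R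
  have hK : CharP K p := charP_of_injective_algebraMap (algebraMap k K).injective p
  let X : E → K := fun a => algebraMap R K (MvPolynomial.X a)
  refine ⟨K, inferInstance, inferInstance, hK, MonoidAlgebra.single 1 1 +
    ∑ a, MonoidAlgebra.single a (X a) - MonoidAlgebra.single 1 (∑ a, X a), ?_, ?_⟩
  · simp [aug]
  · intro χ hχ h0
    have h1 : ∑ a, X a * ZMod.castHom (dvd_refl p) K (χ a).toAdd = 0 := by
      simpa [ell] using h0
    have h2 : algebraMap R K (∑ a, MvPolynomial.X a *
        ZMod.castHom (dvd_refl p) R (χ a).toAdd) = 0 := by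
      rw [← h1, map_sum]
      refine Finset.sum_congr rfl fun a _ => ?_
      rw [map_mul]
      congr 1
      exact congrArg (fun f : ZMod p →+* K => f (χ a).toAdd) (Subsingleton.elim
        ((algebraMap R K).comp (ZMod.castHom (dvd_refl p) R)) (ZMod.castHom (dvd_refl p) K))
    have h3 := (IsFractionRing.injective R K) (h2.trans (map_zero _).symm)
    refine hχ (MonoidHom.ext fun b => ?_)
    have h4 := congrArg (MvPolynomial.eval (Pi.single b 1)) h3
    rw [map_sum, Finset.sum_eq_single b, map_mul, MvPolynomial.eval_X, Pi.single_eq_same, one_mul,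
      map_zero] at h4
    · have h5 : ((MvPolynomial.eval (Pi.single b (1 : k))).comp (ZMod.castHom (dvd_refl p) R))
          (χ b).toAdd = 0 := h4
      exact (map_eq_zero _).mp h5
    · intro a _ hab
      rw [map_mul, MvPolynomial.eval_X, Pi.single_eq_of_ne hab, zero_mul]
    · simp

end Generic

section Monomial

variable {S : Type u} [Group S] {Z : Subgroup S} {p : ℕ} [Fact p.Prime]

/-- The monomial action on `S ⧸ Z × ZMod p` induced from a character of `Z`. -/
@[reducible] noncomputable def monomialAction (χ : Z →* Multiplicative (ZMod p)) :
    MulAction S ((S ⧸ Z) × ZMod p) where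
  smul s x := (s • x.1, x.2 + (χ (kap Z (s • x.1) s)).toAdd)
  one_smul x := by
    have h : kap Z ((1 : S) • x.1) 1 = 1 := by
      ext
      rw [kap_coe _ (one_smul _ _)]
      simp
    refine Prod.ext (one_smul _ _) ?_
    change x.2 + (χ (kap Z ((1 : S) • x.1) 1)).toAdd = x.2
    rw [h, map_one, toAdd_one, add_zero]
  mul_smul s t x := by
    refine Prod.ext (mul_smul _ _ _) ?_
    change x.2 + (χ (kap Z ((s * t) • x.1) (s * t))).toAdd =
      x.2 + (χ (kap Z (t • x.1) t)).toAdd + (χ (kap Z (s • t • x.1) s)).toAdd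
    rw [← kap_mul, map_mul, toAdd_mul, mul_smul, inv_smul_smul, add_comm (χ (kap Z _ s)).toAdd,
      add_assoc]

lemma circ_monomial [Fintype (S ⧸ Z)] (χ : Z →* Multiplicative (ZMod p)) (g : S)
    (s : Set ((S ⧸ Z) × ZMod p)) (hs : Circ Finset.univ s) :
    letI := monomialAction χ
    Circ Finset.univ ((g • ·) '' s) := by
  let _ := monomialAction χ
  refine ⟨fun _ _ => Finset.mem_univ _, fun t => ?_⟩
  obtain ⟨i, hi⟩ := hs.2 (g⁻¹ • t)
  refine ⟨i + (χ (kap Z t g)).toAdd, ?_⟩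
  rintro j ⟨⟨t', i'⟩, hx, hj⟩
  obtain ⟨h1, h2⟩ := Prod.ext_iff.mp hj
  change g • t' = t at h1
  change i' + (χ (kap Z (g • t') g)).toAdd = j at h2
  rw [h1] at h2
  rw [← h1, inv_smul_smul] at hi
  rcases hi _ hx with rfl | rfl
  · exact Or.inl h2.symm
  · right
    rw [← h2]
    ring

lemma monomial_smul_of_mem (hZ : Z ≤ Subgroup.center S) (χ : Z →* Multiplicative (ZMod p)) (z : Z)
    (x : (S ⧸ Z) × ZMod p) :
    letI := monomialAction χ
    (z : S) • x = χ z • x := by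
  have hfix : (z : S) • x.1 = x.1 := by
    obtain ⟨t, ht⟩ := QuotientGroup.mk_surjective x.1
    rw [← ht, MulAction.Quotient.smul_mk, smul_eq_mul, QuotientGroup.eq,
      ← (Subgroup.mem_center_iff.mp (hZ z.2)) t]
    simp [mul_assoc]
  have hk : kap Z x.1 z = z := by
    ext
    rw [kap_coe _ hfix, mul_assoc, ← (Subgroup.mem_center_iff.mp (hZ z.2)), inv_mul_cancel_left]
  refine Prod.ext hfix ?_
  change x.2 + (χ (kap Z ((z : S) • x.1) z)).toAdd = x.2 + (χ z).toAdd
  rw [hfix, hk]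

lemma circ_orbit_monomial [Fintype (S ⧸ Z)] (hZ : Z ≤ Subgroup.center S)
    (χ : Z →* Multiplicative (ZMod p)) {E : Type*} [Group E] (ψ : E →* S)
    (hψ : ∀ z : Z, (z : S) ∈ ψ.range → χ z = 1) (x₀ : (S ⧸ Z) × ZMod p) :
    letI := monomialAction χ
    Circ Finset.univ (Set.range fun e => ψ e • x₀) := by
  let _ := monomialAction χ
  refine ⟨fun _ _ => Finset.mem_univ _, fun t => ?_⟩
  by_cases h : ∃ e, ψ e • x₀.1 = t
  · obtain ⟨e, rfl⟩ := h
    refine ⟨(ψ e • x₀).2, ?_⟩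
    rintro j ⟨e', he'⟩
    left
    obtain ⟨h1, rfl⟩ := Prod.ext_iff.mp he'
    change ψ e' • x₀.1 = ψ e • x₀.1 at h1
    have hmem : ψ (e⁻¹ * e') ∈ Z := by
      obtain ⟨t, ht⟩ := QuotientGroup.mk_surjective x₀.1
      have hN : Z.Normal := ⟨fun n hn g => by
        rw [Subgroup.mem_center_iff.mp (hZ hn) g, mul_inv_cancel_right]; exact hn⟩
      rw [← ht, MulAction.Quotient.smul_mk, MulAction.Quotient.smul_mk, eq_comm, QuotientGroup.eq,
        smul_eq_mul, smul_eq_mul, mul_inv_rev] at h1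
      have h2 := hN.conj_mem _ h1 t
      rw [map_mul, map_inv]
      simpa [mul_assoc] using h2
    have h2 : ψ (e⁻¹ * e') • x₀ = x₀ := by
      have h3 := monomial_smul_of_mem hZ χ ⟨_, hmem⟩ x₀
      rw [hψ _ ⟨_, rfl⟩, one_smul] at h3
      exact h3
    rw [map_mul, mul_smul, map_inv, inv_smul_eq_iff] at h2
    exact congrArg Prod.snd h2
  · refine ⟨0, ?_⟩
    rintro j ⟨e, he⟩
    exact (h ⟨e, congrArg Prod.fst he⟩).elim

theorem exists_character_cocycle [Finite S] [CharP k p] (hp : 2 < p) (hS : IsPGroup p S)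
    {E : Type u} [CommGroup E] (hE : ∀ a : E, a ^ p = 1) (ι : E →* S)
    (hι : Function.Injective ι) (hcent : ι.range ≤ Subgroup.center S)
    (K : Type u) [Field K] [Algebra k K] [CharP K p] {y : MonoidAlgebra K E} (hy : aug y = 1)
    (χ : E →* Multiplicative (ZMod p)) :
    ∃ n, Even n ∧ ∃ ζ ∈ cocycles k S n, ∃ c : K, c ≠ 0 ∧ ∃ m : ℕ, ∀ ψ : E →* S,
      ((∀ e, ι e ∈ ψ.range → χ e = 1) → evHom k y ((y - 1) ^ (p - 1)) ψ ζ = 0) ∧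
      ∀ w : E →* E, (∀ e, ψ e = ι (w e)) →
        evHom k y ((y - 1) ^ (p - 1)) ψ ζ = ell K (χ.comp w) y ^ p ^ m * c := by
  classical
  have := Fintype.ofFinite (S ⧸ ι.range)
  let χ' : ι.range →* Multiplicative (ZMod p) :=
    χ.comp (MonoidHom.ofInjective hι).symm.toMonoidHom
  have hχ' : ∀ e (h : ι e ∈ ι.range), χ' ⟨ι e, h⟩ = χ e := fun e h =>
    congrArg χ ((MonoidHom.ofInjective hι).symm_apply_apply e)
  let _ := monomialAction χ'
  obtain ⟨ζ, hζ, c, hc, h⟩ := exists_sphere_cocycle (T := S ⧸ ι.range) (E := E) k hp hS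
    (fun g s hs => circ_monomial χ' g s hs) K hE
  obtain ⟨m, hm⟩ := hS.index ι.range
  rw [Subgroup.index_eq_card, Nat.card_eq_fintype_card] at hm
  refine ⟨_, even_two_mul _, ζ, hζ, c, hc, m + 1, fun ψ => ⟨fun hψ => ?_, fun w hw => ?_⟩⟩
  · refine (h y hy ψ).1 (QuotientGroup.mk 1, 0) (circ_orbit_monomial hcent χ' ψ ?_ _)
    rintro ⟨_, e, rfl⟩ hz
    exact (hχ' e _).trans (hψ e hz)
  · rw [(h y hy ψ).2 (χ.comp w) fun e x => ?_, hm, pow_succ']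
    have h1 := monomial_smul_of_mem hcent χ' ⟨ι (w e), ⟨_, rfl⟩⟩ x
    rw [hw, MonoidHom.comp_apply, ← hχ' _ ⟨_, rfl⟩]
    exact h1

end Monomial

section Realizable

variable {K : Type u} [Field K] [Algebra k K] {E S : Type u} [CommGroup E] [Group S]

lemma const_mem_cocycles : (fun _ : Fin 0 → S => (1 : k)) ∈ cocycles k S 0 := by
  refine LinearMap.mem_ker.mpr (funext fun x => ?_)
  rw [d_apply, contrD_zero]
  simp

/-- The functions on homomorphisms `E →* S` given by cocycles of even degree. -/
noncomputable def evenValues (E : Type u) [CommGroup E] (S : Type u) [Group S]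
    (y z : MonoidAlgebra K E) : Submonoid ((E →* S) → K) where
  carrier := {f | ∃ n, Even n ∧ ∃ ζ ∈ cocycles k S n, ∀ ψ : E →* S, evHom k y z ψ ζ = f ψ}
  one_mem' := ⟨0, Even.zero, _, const_mem_cocycles k, fun _ => map_one (algebraMap k K)⟩
  mul_mem' := by
    rintro f f' ⟨m, hm, ζ, hζ, h⟩ ⟨n, hn, ζ', hζ', h'⟩
    exact ⟨m + n, hm.add hn, cup k ζ ζ', cup_mem_cocycles k hζ hζ', fun ψ => by
      rw [evHom_cup k y z ψ hn, h, h', Pi.mul_apply]⟩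

end Realizable

section Dedekind

variable {M F : Type*} [Monoid M] [Field F]

lemma sum_eq_of_characters {I J : Type*} [Fintype I] [Fintype J] (u : I → M →* F) (a : I → F)
    (v : J → M →* F) (b : J → F) (h : ∀ m, ∑ i, a i * u i m = ∑ j, b j * v j m) (f : M →* F)
    [DecidablePred (u · = f)] [DecidablePred (v · = f)] :
    ∑ i with u i = f, a i = ∑ j with v j = f, b j := by
  have hl := linearIndependent_iff.mp (linearIndependent_monoidHom M F)
    (∑ i, Finsupp.single (u i) (a i) - ∑ j, Finsupp.single (v j) (b j)) (by
      funext m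
      simp only [map_sub, map_sum, Finsupp.linearCombination_single, Pi.sub_apply,
        Finset.sum_apply, Pi.smul_apply, smul_eq_mul, Pi.zero_apply]
      rw [h, sub_self])
  have hf := DFunLike.congr_fun (sub_eq_zero.mp hl) f
  classical
  simp only [Finsupp.coe_finsetSum, Finset.sum_apply, Finsupp.single_apply] at hf
  rwa [← Finset.sum_filter, ← Finset.sum_filter, Finset.filter_congr_decidable,
    Finset.filter_congr_decidable] at hf

end Dedekind

lemma card_out_mem {Γ : Type*} [Group Γ] (C : Subgroup Γ) (S₀ : Subgroup C) :
    Nat.card {x : Γ ⧸ S₀.map C.subtype // x.out ∈ C} = S₀.index := by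
  rw [Subgroup.index_eq_card]
  refine Nat.card_congr (Equiv.ofBijective
    (fun x => (QuotientGroup.mk (⟨x.1.out, x.2⟩ : C) : C ⧸ S₀)) ⟨?_, ?_⟩)
  · intro x x' h
    rw [QuotientGroup.eq] at h
    refine Subtype.ext ?_
    rw [← QuotientGroup.out_eq' x.1, ← QuotientGroup.out_eq' x'.1, QuotientGroup.eq]
    exact ⟨_, h, rfl⟩
  · intro c
    obtain ⟨c, rfl⟩ := QuotientGroup.mk_surjective c
    obtain ⟨⟨_, s, hs, rfl⟩, h⟩ := QuotientGroup.mk_out_eq_mul (S₀.map C.subtype) (c : Γ)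
    refine ⟨⟨QuotientGroup.mk (c : Γ), ?_⟩, ?_⟩
    · rw [h]
      exact C.mul_mem c.2 s.2
    · rw [eq_comm, QuotientGroup.eq]
      have hs' : s = c⁻¹ * ⟨_, h ▸ C.mul_mem c.2 s.2⟩ := Subtype.ext (by simp [h])
      rwa [← hs']

section Fusion

variable {p : ℕ} [Fact p.Prime] {G : Type u} [Group G] {H : Subgroup G}

/-- Every class in the cohomology of `H` has a `p`-power power which is a restriction. -/
def RestrictionHyp (k : Type u) [Field k] (p : ℕ) {G : Type u} [Group G] (H : Subgroup G) : Prop :=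
  ∀ (n : ℕ) (ζ : cohomology k (↥H) n),
    ∃ (r : ℕ) (z : cocycles k (↥H) n),
      (Submodule.Quotient.mk z : cohomology k (↥H) n) = ζ ∧
      ∃ w : cocycles k G (n * p ^ r),
        resCochain k H.subtype (n * p ^ r) (w : (Fin (n * p ^ r) → G) → k) -
            cupPow k (z : (Fin n → ↥H) → k) (p ^ r)
          ∈ coboundaries k (↥H) (n * p ^ r)

variable {E : Type u} [CommGroup E]

lemma evHom_eq_of_conj (hyp : RestrictionHyp k p H) {K : Type u} [Field K] [Algebra k K]
    [CharP K p] {y z : MonoidAlgebra K E} (hyz : IsEvPair y z) (α β : E →* H) (γ : G)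
    (hαβ : ∀ e, (β e : G) = γ * α e * γ⁻¹) {n : ℕ} (hn : Even n) {ζ : (Fin n → H) → k}
    (hζ : ζ ∈ cocycles k H n) : evHom k y z α ζ = evHom k y z β ζ := by
  obtain ⟨r, z', hz', w, hw⟩ := hyp n (Submodule.Quotient.mk ⟨ζ, hζ⟩)
  have h1 : (z' : (Fin n → H) → k) - ζ ∈ coboundaries k H n :=
    (Submodule.Quotient.eq ((coboundaries k H n).comap (cocycles k H n).subtype)).mp hz'
  have h2 : ∀ ψ : E →* H, evHom k y z (H.subtype.comp ψ) (w : (Fin (n * p ^ r) → G) → k) =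
      evHom k y z ψ ζ ^ p ^ r := by
    intro ψ
    have h3 := evHom_coboundary k hyz ψ hw
    have h4 := evHom_coboundary k hyz ψ h1
    rw [evHom_sub, sub_eq_zero] at h3 h4
    rw [evHom_cupPow k y z ψ hn, h4] at h3
    exact h3
  have h5 := evHom_coboundary k hyz (H.subtype.comp α) (conj_sub_mem_coboundaries k γ⁻¹ w.2)
  rw [evHom_sub, sub_eq_zero, h2] at h5
  have h6 : evHom k y z (H.subtype.comp α) (resCochain k (MulAut.conj γ⁻¹⁻¹).toMonoidHom
      (n * p ^ r) (w : (Fin (n * p ^ r) → G) → k)) =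
      evHom k y z (H.subtype.comp β) (w : (Fin (n * p ^ r) → G) → k) := by
    have : ⇑(H.subtype.comp β) =
        (MulAut.conj γ⁻¹⁻¹).toMonoidHom ∘ ⇑(H.subtype.comp α) := by
      funext e
      simpa using hαβ e
    rw [this]
    rfl
  rw [h6, h2] at h5
  exact (iterateFrobenius_inj K p r h5).symm

theorem exists_conj_of_elementary [CharP k p] [Finite G] (hp : 2 < p) (hyp : RestrictionHyp k p H)
    (hE : ∀ a : E, a ^ p = 1) (α β : E →* H) (hα : Function.Injective α) (γ : G)
    (hαβ : ∀ e, (β e : G) = γ * α e * γ⁻¹) : ∃ h : H, ∀ e, (h : H)⁻¹ * β e * h = α e := by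
  classical
  have hEfin : Finite E := Finite.of_injective α hα
  obtain ⟨K, _, _, _, y, hy, hgen⟩ := exists_generic k (E := E) (p := p)
  set z := (y - 1) ^ (p - 1) with hz
  have hyz : IsEvPair y z := isEvPair_pow hE (by omega) hy
  have hβ : Function.Injective β := fun a b hab => hα (Subtype.ext (by
    have := congrArg Subtype.val hab
    rw [hαβ, hαβ] at this
    exact mul_left_cancel (mul_right_cancel this)))
  set C := Subgroup.centralizer (α.range : Set H) with hC
  have hαC : α.range ≤ C := by
    rintro _ ⟨a, rfl⟩ _ ⟨b, rfl⟩
    rw [← map_mul, ← map_mul, mul_comm]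
  have hαp : IsPGroup p (α.range.subgroupOf C) := by
    rintro ⟨x, a, ha⟩
    refine ⟨1, Subtype.ext (Subtype.ext ?_)⟩
    change (x : H) ^ p ^ 1 = 1
    rw [pow_one, ← show α a = x from ha, ← map_pow, hE, map_one]
  obtain ⟨S₀, hS₀⟩ := hαp.exists_le_sylow
  set S := (S₀ : Subgroup C).map C.subtype with hS
  have hSC : S ≤ C := Subgroup.map_subtype_le _
  have hαS : ∀ a, α a ∈ S := fun a => ⟨⟨α a, hαC ⟨a, rfl⟩⟩, hS₀ ⟨a, rfl⟩, rfl⟩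
  have hSp : IsPGroup p S := S₀.isPGroup'.map _
  let ι : E →* S := α.codRestrict S hαS
  have hι : Function.Injective ι := fun a b hab => hα (congrArg Subtype.val hab)
  have hcent : ι.range ≤ Subgroup.center S := by
    rintro _ ⟨a, rfl⟩
    rw [Subgroup.mem_center_iff]
    intro s
    exact Subtype.ext ((hSC s.2 (α a) ⟨a, rfl⟩).symm)
  have hfinχ : Finite (E →* Multiplicative (ZMod p)) := DFunLike.finite _
  let X := {χ : E →* Multiplicative (ZMod p) // χ ≠ 1}
  have := Fintype.ofFinite X
  choose n hn ζ hζ c hc m hm using fun χ : X =>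
    exists_character_cocycle k hp hSp hE ι hι hcent K hy χ.1
  rw [← hz] at hm
  let θ : (E →* S) → X → K := fun ψ χ => evHom k y z ψ (ζ χ)
  let Θ : (E →* S) → (X → Multiplicative ℕ) →* K := fun ψ =>
    { toFun := fun e => ∏ χ, θ ψ χ ^ (e χ).toAdd
      map_one' := by simp
      map_mul' := fun e e' => by
        rw [← Finset.prod_mul_distrib]
        exact Finset.prod_congr rfl fun χ _ => by rw [Pi.mul_apply, toAdd_mul, pow_add] }
  have hΘ : ∀ e, (fun ψ => Θ ψ e) ∈ evenValues k E S y z := by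
    intro e
    have h : (fun ψ => Θ ψ e) = ∏ χ : X, (fun ψ => θ ψ χ) ^ (e χ).toAdd := by
      funext ψ
      rw [Finset.prod_apply]
      rfl
    rw [h]
    refine Submonoid.prod_mem _ fun χ _ => Submonoid.pow_mem _ ?_ _
    exact ⟨n χ, hn χ, ζ χ, hζ χ, fun _ => rfl⟩
  have hθι : ∀ χ, θ ι χ = ell K χ.1 y ^ p ^ m χ * c χ := fun χ =>
    ((hm χ ι).2 (MonoidHom.id E) fun _ => rfl)
  have key : ∀ ψ : E →* S, Function.Injective ψ → Θ ψ = Θ ι → ψ = ι := by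
    intro ψ hψ hΘψ
    have hθ : ∀ χ, θ ψ χ = θ ι χ := by
      intro χ
      have h := DFunLike.congr_fun hΘψ (Pi.mulSingle χ (Multiplicative.ofAdd 1))
      have h' : ∀ ψ : E →* S, Θ ψ (Pi.mulSingle χ (Multiplicative.ofAdd 1)) = θ ψ χ := by
        intro ψ
        refine (Finset.prod_eq_single χ (fun χ' _ hne => ?_) (by simp)).trans ?_
        · rw [Pi.mulSingle_eq_of_ne hne, toAdd_one, pow_zero]
        · rw [Pi.mulSingle_eq_same, toAdd_ofAdd, pow_one]
      rwa [h', h'] at h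
    have hle : ι.range ≤ ψ.range := by
      rintro _ ⟨a, rfl⟩
      by_contra ha
      obtain ⟨χ, hχ, hχa⟩ := exists_character hE (ψ.range.comap ι) (a := a) ha
      have hχ1 : χ ≠ 1 := fun h => hχa (by rw [h]; rfl)
      have h0 : θ ψ ⟨χ, hχ1⟩ = 0 := (hm ⟨χ, hχ1⟩ ψ).1 fun e he => hχ e he
      rw [hθ, hθι] at h0
      exact mul_ne_zero (pow_ne_zero _ (hgen χ hχ1)) (hc _) h0
    have hrange : ι.range = ψ.range := by
      refine Subgroup.eq_of_le_of_card_ge hle ?_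
      rw [← Nat.card_congr (MonoidHom.ofInjective hι).toEquiv,
        ← Nat.card_congr (MonoidHom.ofInjective hψ).toEquiv]
    have hmem : ∀ a, ψ a ∈ ι.range := fun a => hrange ▸ ⟨a, rfl⟩
    let w : E →* E := (MonoidHom.ofInjective hι).symm.toMonoidHom.comp (ψ.codRestrict _ hmem)
    have hw : ∀ a, ψ a = ι (w a) := fun a =>
      (congrArg Subtype.val ((MonoidHom.ofInjective hι).apply_symm_apply ⟨ψ a, hmem a⟩)).symm
    have hχw : ∀ χ : X, χ.1.comp w = χ.1 := by
      intro χ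
      refine ell_injective hgen (iterateFrobenius_inj K p (m χ) ?_)
      have h := hθ χ
      rw [hθι] at h
      exact mul_right_cancel₀ (hc χ) (((hm χ ψ).2 w hw).symm.trans h)
    refine MonoidHom.ext fun a => ?_
    rw [hw]
    congr 1
    by_contra ha
    obtain ⟨χ, -, hχa⟩ := exists_character hE ⊥ (a := w a * a⁻¹) fun h =>
      ha (mul_inv_eq_one.mp (Subgroup.mem_bot.mp h))
    have h := DFunLike.congr_fun (hχw ⟨χ, fun h => hχa (by rw [h]; rfl)⟩) a
    refine hχa ?_
    rw [map_mul, map_inv, mul_inv_eq_one]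
    exact h
  have hfinα := Fintype.ofFinite {x : H ⧸ S // ∀ a, α a • x = x}
  have hfinβ := Fintype.ofFinite {x : H ⧸ S // ∀ a, β a • x = x}
  have hinj : ∀ (δ : E →* H) (x : H ⧸ S) (hx : ∀ a, δ a • x = x), Function.Injective δ →
      Function.Injective (kapHom δ x hx) := fun δ x hx hδ a b hab => hδ (by
    have h := congrArg Subtype.val hab
    rw [kapHom_coe, kapHom_coe] at h
    exact mul_left_cancel (mul_right_cancel h))
  have hsum : ∀ e, ∑ x : {x : H ⧸ S // ∀ a, α a • x = x}, 1 * Θ (kapHom α x.1 x.2) e =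
      ∑ x : {x : H ⧸ S // ∀ a, β a • x = x}, 1 * Θ (kapHom β x.1 x.2) e := by
    intro e
    obtain ⟨N, hN, ξ, hξ, hev⟩ := hΘ e
    have h := evHom_eq_of_conj k hyp hyz α β γ hαβ hN (transfer_mem_cocycles k S hξ)
    rw [evHom_transfer k α hE hyz hgen hN hξ, evHom_transfer k β hE hyz hgen hN hξ] at h
    simpa only [hev, one_mul] using h
  have hcoef := sum_eq_of_characters _ _ _ _ hsum (Θ ι)
  have hcard : (Finset.univ.filter fun x : {x : H ⧸ S // ∀ a, α a • x = x} =>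
      Θ (kapHom α x.1 x.2) = Θ ι).card = (S₀ : Subgroup C).index := by
    rw [← card_out_mem, ← Nat.card_eq_finsetCard]
    have hout : ∀ x : H ⧸ S, x.out ∈ C ↔ ∀ a, x.out⁻¹ * α a * x.out = α a := by
      intro x
      rw [hC, Subgroup.mem_centralizer_iff]
      constructor
      · intro h a
        rw [mul_assoc, h _ ⟨a, rfl⟩, inv_mul_cancel_left]
      · rintro h _ ⟨a, rfl⟩
        nth_rw 2 [← h a]
        simp [mul_assoc]
    have hfix : ∀ x : H ⧸ S, x.out ∈ C → ∀ a, α a • x = x := by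
      intro x hx a
      nth_rw 2 [← QuotientGroup.out_eq' x]
      rw [← QuotientGroup.out_eq' x, MulAction.Quotient.smul_mk, eq_comm, QuotientGroup.eq,
        smul_eq_mul, ← mul_assoc, QuotientGroup.out_eq', (hout x).mp hx a]
      exact hαS a
    refine Nat.card_congr
      { toFun := fun x => ⟨x.1.1, (hout _).mpr fun a => ?_⟩
        invFun := fun x => ⟨⟨x.1, hfix x.1 x.2⟩, ?_⟩
        left_inv := fun _ => rfl
        right_inv := fun _ => rfl }
    · have h := key _ (hinj α x.1.1 x.1.2 hα) (Finset.mem_filter.mp x.2).2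
      rw [← kapHom_coe α x.1.1 x.1.2, h]
      rfl
    · refine Finset.mem_filter.mpr ⟨Finset.mem_univ _, congrArg Θ (MonoidHom.ext fun a => ?_)⟩
      refine Subtype.ext ?_
      rw [kapHom_coe]
      exact (hout _).mp x.2 a
  have hne : ∃ x : {x : H ⧸ S // ∀ a, β a • x = x}, Θ (kapHom β x.1 x.2) = Θ ι := by
    by_contra hno
    push Not at hno
    rw [Finset.filter_false_of_mem fun x _ => hno x, Finset.sum_empty, Finset.sum_const, hcard,
      nsmul_one, CharP.cast_eq_zero_iff K p] at hcoef
    exact S₀.not_dvd_index hcoef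
  obtain ⟨x, hx⟩ := hne
  refine ⟨x.1.out, fun a => ?_⟩
  rw [← kapHom_coe β x.1 x.2, key _ (hinj β x.1 x.2 hβ) hx]
  rfl

end Fusion

section CriticalSubgroup

variable {p : ℕ} [Fact p.Prime] {Γ : Type*} [Group Γ]

lemma mul_pow_of_commutator {x u e : Γ} (h : u * x = x * u * e) (hx : Commute e x)
    (hu : Commute e u) (n : ℕ) : (x * u) ^ n = x ^ n * u ^ n * e ^ n.choose 2 := by
  have h1 : ∀ n : ℕ, u ^ n * x = x * u ^ n * e ^ n := by
    intro n
    induction n with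
    | zero => simp
    | succ n ih =>
      calc u ^ (n + 1) * x = u * (u ^ n * x) := by rw [pow_succ', mul_assoc]
        _ = (u * x) * u ^ n * e ^ n := by rw [ih]; group
        _ = x * u * (e * u ^ n) * e ^ n := by rw [h]; group
        _ = x * u ^ (n + 1) * e ^ (n + 1) := by
          rw [(hu.pow_right n).eq, pow_succ' u, pow_succ' e]; group
  induction n with
  | zero => simp
  | succ n ih =>
    have hc : Commute (e ^ n.choose 2) (x * u) := (hx.mul_right hu).pow_left _
    calc (x * u) ^ (n + 1) = x ^ n * u ^ n * (e ^ n.choose 2 * (x * u)) := by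
          rw [pow_succ, ih, mul_assoc]
      _ = x ^ n * (u ^ n * x) * u * e ^ n.choose 2 := by rw [hc.eq]; group
      _ = x ^ n * x * u ^ n * (e ^ n * u) * e ^ n.choose 2 := by rw [h1]; group
      _ = x ^ (n + 1) * u ^ (n + 1) * e ^ (n + 1).choose 2 := by
        rw [(hu.pow_left n).eq, pow_succ x, pow_succ u, Nat.choose_succ_succ' n 1,
          Nat.choose_one_right, pow_add]
        group

lemma exists_normal_lt [Finite Γ] {L : Subgroup Γ} (hL : IsPGroup p L) {x y : Γ} (hx : x ∈ L)
    (hy : y ∈ L) (hxy : x * y ≠ y * x) :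
    ∃ K < L, x ∈ K ∧ ∀ g ∈ L, g⁻¹ * x * g ∈ K := by
  have := hL.isNilpotent
  have hne : Subgroup.zpowers (⟨x, hx⟩ : L) ≠ ⊤ := by
    intro h
    obtain ⟨n, hn⟩ := Subgroup.mem_zpowers_iff.mp (h ▸ Subgroup.mem_top (⟨y, hy⟩ : L))
    have hn' : x ^ n = y := congrArg Subtype.val hn
    exact hxy (by rw [← hn', mul_self_zpow, mul_zpow_self])
  obtain ⟨K, hK, hle⟩ := (eq_top_or_exists_le_coatom _).resolve_left hne
  have hN := Subgroup.NormalizerCondition.normal_of_coatom K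
    Group.normalizerCondition_of_isNilpotent hK
  have hxK : (⟨x, hx⟩ : L) ∈ K := hle (Subgroup.mem_zpowers _)
  refine ⟨K.map L.subtype, lt_of_le_of_ne (Subgroup.map_subtype_le _) fun h => hK.1 ?_,
    ⟨_, hxK, rfl⟩, fun g hg => ⟨_, hN.conj_mem _ hxK ⟨g⁻¹, L.inv_mem hg⟩, by simp⟩⟩
  rw [eq_top_iff]
  rintro ⟨l, hl⟩ -
  obtain ⟨l', hl', hl''⟩ := h.ge hl
  rwa [← show l' = ⟨l, hl⟩ from Subtype.ext hl'']

theorem div_pow_eq_one [Finite Γ] (hp : 2 < p) {M : Subgroup Γ} (L : Subgroup Γ)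
    (hL : IsPGroup p L) (hM : ∀ g ∈ L, ∀ m ∈ M, g⁻¹ * m * g ∈ M)
    (hc : ∀ m ∈ M, m ^ p = 1 → ∀ g ∈ L, Commute m g) {x y : Γ} (hx : x ∈ L) (hy : y ∈ L)
    (hxy : x⁻¹ * y ∈ M) (hpow : x ^ p = y ^ p) : (x⁻¹ * y) ^ p = 1 := by
  induction hn : Nat.card L using Nat.strong_induction_on generalizing L x y with
  | _ n ih =>
  by_cases hcomm : x * y = y * x
  · have h : Commute x⁻¹ y := Commute.inv_left hcomm
    rw [h.mul_pow, ← hpow, inv_pow, inv_mul_cancel]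
  · obtain ⟨K, hKL, hxK, hK⟩ := exists_normal_lt hL hx hy hcomm
    have hcard : Nat.card K < n := hn ▸ Set.Finite.card_lt_card (Set.toFinite _) hKL
    have hcM : x⁻¹ * (y⁻¹ * x * y) ∈ M := by
      convert M.mul_mem (hM _ hx _ (M.inv_mem hxy)) hxy using 1
      group
    have hpow' : x ^ p = (y⁻¹ * x * y) ^ p := by
      have h := conj_pow (i := p) (a := y⁻¹) (b := x)
      rw [inv_inv] at h
      rw [h, hpow]
      group
    have hcp := ih _ hcard K (hL.to_le hKL.le) (fun g hg => hM g (hKL.le hg))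
      (fun m hm hm' g hg => hc m hm hm' g (hKL.le hg)) hxK (hK y hy) hcM hpow' rfl
    have hcent := hc _ hcM hcp
    set c := x⁻¹ * (y⁻¹ * x * y) with hcdef
    have hu : x⁻¹ * y ∈ L := L.mul_mem (L.inv_mem hx) hy
    have h1 : (x⁻¹ * y) * x = x * (x⁻¹ * y) * c⁻¹ := by
      rw [hcdef]; group
    have h2 := mul_pow_of_commutator h1 (hcent x hx).inv_left (hcent _ hu).inv_left p
    obtain ⟨e, he⟩ : p ∣ p.choose 2 :=
      (Fact.out : p.Prime).dvd_choose_self two_ne_zero hp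
    rw [mul_inv_cancel_left, he, pow_mul, inv_pow, hcp, inv_one, one_pow, mul_one, ← hpow] at h2
    exact left_eq_mul.mp h2

/-- The elements of order `p` commuting with `V` lie in `V`, and `V` is an elementary abelian normal
subgroup of `Q`. -/
structure IsCritical (p : ℕ) (Q V : Subgroup Γ) : Prop where
  le : V ≤ Q
  conj_mem : ∀ q ∈ Q, ∀ a ∈ V, q * a * q⁻¹ ∈ V
  comm : ∀ a ∈ V, ∀ b ∈ V, Commute a b
  pow_eq_one : ∀ a ∈ V, a ^ p = 1
  mem_of_comm : ∀ x ∈ Q, (∀ a ∈ V, Commute a x) → x ^ p = 1 → x ∈ V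

lemma exists_isCritical_top [Finite Γ] (hp : 2 < p) (hΓ : IsPGroup p Γ) :
    ∃ V : Subgroup Γ, IsCritical p ⊤ V := by
  have hnil := hΓ.isNilpotent
  let Good : Subgroup Γ → Prop := fun V =>
    V.Normal ∧ (∀ a ∈ V, ∀ b ∈ V, Commute a b) ∧ ∀ a ∈ V, a ^ p = 1
  have hbot : Good ⊥ := ⟨inferInstance, fun a ha b hb => by
    rw [Subgroup.mem_bot.mp ha]; exact Commute.one_left _, fun a ha => by
    rw [Subgroup.mem_bot.mp ha, one_pow]⟩
  obtain ⟨V, -, hV⟩ := Finite.exists_le_maximal (p := Good) hbot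
  obtain ⟨hVn, hVc, hVp⟩ := hV.prop
  refine ⟨V, le_top, fun q _ a ha => hVn.conj_mem a ha q, hVc, hVp, ?_⟩
  by_contra! hbad
  let Bad : Γ → Prop := fun x => (∀ a ∈ V, Commute a x) ∧ x ^ p = 1 ∧ x ∉ V
  obtain ⟨x, hx, hmin⟩ := exists_minimalFor_of_wellFoundedLT Bad
    (fun x => Subgroup.normalClosure {x}) (by
      obtain ⟨x, -, h⟩ := hbad
      exact ⟨x, h⟩)
  obtain ⟨hxV, hxp, hxnV⟩ := hx
  have hRn : (Subgroup.centralizer (V : Set Γ)).Normal := inferInstance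
  set R := Subgroup.centralizer (V : Set Γ) with hR
  have hxR : x ∈ R := Subgroup.mem_centralizer_iff.mpr fun a ha => (hxV a ha).eq
  set L := Subgroup.normalClosure {x} with hL
  have hLR : L ≤ R := Subgroup.normalClosure_le_normal (by simpa using hxR)
  have hxL : x ∈ L := Subgroup.subset_normalClosure rfl
  set M := ⁅L, (⊤ : Subgroup Γ)⁆ with hMdef
  have hMn : M.Normal := inferInstance
  have hML : M ≤ L := Subgroup.commutator_le_left _ _
  have hMne : M ≠ L := by
    intro h
    have hlow : ∀ n, L ≤ (⊤ : Subgroup Γ).lowerCentralSeries n := by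
      intro n
      induction n with
      | zero => exact le_top
      | succ n ih =>
        rw [Subgroup.lowerCentralSeries_succ, ← h]
        exact Subgroup.commutator_mono ih le_rfl
    obtain ⟨n, hn⟩ := Subgroup.nilpotent_iff_lowerCentralSeries.mp hnil
    have h1 : x ∈ (⊥ : Subgroup Γ) := hn ▸ hlow n hxL
    rw [Subgroup.mem_bot.mp h1] at hxnV
    exact hxnV V.one_mem
  have hMR : ∀ m ∈ M, m ^ p = 1 → m ∈ V := by
    intro m hm hmp
    by_contra hmV
    have hle : Subgroup.normalClosure {m} ≤ M :=
      Subgroup.normalClosure_le_normal (by simpa using hm)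
    have hbadm : Bad m :=
      ⟨fun a ha => Subgroup.mem_centralizer_iff.mp (hLR (hML hm)) a ha, hmp, hmV⟩
    exact hMne (le_antisymm hML ((hmin hbadm (hle.trans hML)).trans hle))
  have hcomm : ∀ g : Γ, x⁻¹ * (g⁻¹ * x * g) ∈ V := by
    intro g
    have hyR : g⁻¹ * x * g ∈ R := by simpa using hRn.conj_mem x hxR g⁻¹
    have hM : x⁻¹ * (g⁻¹ * x * g) ∈ M := by
      have h := Subgroup.commutator_mem_commutator (L.inv_mem hxL) (Subgroup.mem_top g⁻¹)
      rw [commutatorElement_def] at h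
      convert h using 1
      group
    refine hMR _ hM (div_pow_eq_one hp R (hΓ.to_subgroup R)
      (fun g _ m hm => by simpa using hMn.conj_mem m hm g⁻¹)
      (fun m hm hmp g hg => Subgroup.mem_centralizer_iff.mp hg m (hMR m hm hmp)) hxR hyR hM ?_)
    have h := conj_pow (i := p) (a := g⁻¹) (b := x)
    rw [inv_inv] at h
    rw [h, hxp]
    group
  have hgood : Good (V ⊔ Subgroup.zpowers x) := by
    have hxc : ∀ a ∈ V, ∀ n : ℤ, Commute a (x ^ n) := fun a ha n => (hxV a ha).zpow_right n
    refine ⟨⟨fun w hw g => ?_⟩, fun w hw w' hw' => ?_, fun w hw => ?_⟩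
    · obtain ⟨a, ha, b, ⟨n, rfl⟩, rfl⟩ := Subgroup.mem_sup_of_normal_left.mp hw
      have h : g * (a * x ^ n) * g⁻¹ = (g * a * g⁻¹) * (x * (x⁻¹ * (g * x * g⁻¹))) ^ n := by
        rw [mul_inv_cancel_left, conj_zpow]
        group
      change g * (a * x ^ n) * g⁻¹ ∈ _
      rw [h]
      refine mul_mem (Subgroup.mem_sup_left (hVn.conj_mem _ ha g)) (zpow_mem (mul_mem
        (Subgroup.mem_sup_right (Subgroup.mem_zpowers x)) (Subgroup.mem_sup_left ?_)) n)
      simpa using hcomm g⁻¹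
    · obtain ⟨a, ha, b, ⟨n, rfl⟩, rfl⟩ := Subgroup.mem_sup_of_normal_left.mp hw
      obtain ⟨a', ha', b', ⟨n', rfl⟩, rfl⟩ := Subgroup.mem_sup_of_normal_left.mp hw'
      exact ((hVc a ha a' ha').mul_right (hxc a ha n')).mul_left
        (((hxc a' ha' n).symm).mul_right (Commute.zpow_zpow_self x n n'))
    · obtain ⟨a, ha, b, ⟨n, rfl⟩, rfl⟩ := Subgroup.mem_sup_of_normal_left.mp hw
      change (a * x ^ n) ^ p = 1
      rw [(hxc a ha n).mul_pow, hVp a ha, ← zpow_natCast, zpow_comm, zpow_natCast, hxp, one_zpow,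
        one_mul]
  exact hxnV (hV.le_of_ge hgood le_sup_left (Subgroup.mem_sup_right (Subgroup.mem_zpowers x)))

lemma exists_isCritical [Finite Γ] (hp : 2 < p) {Q : Subgroup Γ} (hQ : IsPGroup p Q) :
    ∃ V, IsCritical p Q V := by
  obtain ⟨V, hV⟩ := exists_isCritical_top hp hQ
  refine ⟨V.map Q.subtype, Subgroup.map_subtype_le _, ?_, ?_, ?_, fun x hx h hxp => ?_⟩
  · rintro q hq - ⟨a, ha, rfl⟩
    exact ⟨_, hV.conj_mem ⟨q, hq⟩ trivial a ha, rfl⟩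
  · rintro - ⟨a, ha, rfl⟩ - ⟨b, hb, rfl⟩
    exact (hV.comm a ha b hb).map Q.subtype
  · rintro - ⟨a, ha, rfl⟩
    rw [← map_pow, hV.pow_eq_one a ha, map_one]
  · refine ⟨⟨x, hx⟩, hV.mem_of_comm _ trivial (fun a ha => Subtype.ext (h a ⟨a, ha, rfl⟩).eq)
      (Subtype.ext hxp), rfl⟩

/-- If `x⁻¹ n x n⁻¹` is fixed by `n`, of `p`-power order, and `n ^ j = 1` for some `j` prime to `p`,
then `n` commutes with `x`. -/
lemma commute_of_commutator_fixed {n x z : Γ} {i j : ℕ} (hj : n ^ j = 1) (hpj : ¬ p ∣ j)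
    (hx : n * x * n⁻¹ = x * z) (hz : n * z * n⁻¹ = z) (hzi : z ^ p ^ i = 1) : Commute n x := by
  have h1 : ∀ m : ℕ, n ^ m * x = x * z ^ m * n ^ m := by
    have hnz : Commute n z := mul_inv_eq_iff_eq_mul.mp hz
    have hnx : n * x = x * z * n := mul_inv_eq_iff_eq_mul.mp hx
    intro m
    induction m with
    | zero => simp
    | succ m ih =>
      calc n ^ (m + 1) * x = n * (n ^ m * x) := by rw [pow_succ', mul_assoc]
        _ = (n * x) * z ^ m * n ^ m := by rw [ih]; group
        _ = x * z * (n * z ^ m) * n ^ m := by rw [hnx]; group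
        _ = x * z ^ (m + 1) * n ^ (m + 1) := by
          rw [(hnz.pow_right m).eq, pow_succ' z, pow_succ' n]; group
  have hzj : z ^ j = 1 := by simpa [hj] using h1 j
  have hcop : Nat.Coprime j (p ^ i) :=
    (((Fact.out : p.Prime).coprime_iff_not_dvd.mpr hpj).symm).pow_right i
  have hz1 : z = 1 := by
    rw [← orderOf_eq_one_iff, ← Nat.dvd_one, ← hcop]
    exact Nat.dvd_gcd (orderOf_dvd_of_pow_eq_one hzj) (orderOf_dvd_of_pow_eq_one hzi)
  rw [hz1, mul_one] at hx
  exact mul_inv_eq_iff_eq_mul.mp hx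

theorem IsCritical.commute [Finite Γ] (hp : 2 < p) {Q V : Subgroup Γ} (hV : IsCritical p Q V)
    (hQ : IsPGroup p Q) {n : Γ} (hnQ : ∀ q ∈ Q, n * q * n⁻¹ ∈ Q) (hnV : ∀ a ∈ V, Commute n a)
    {j : ℕ} (hj : n ^ j = 1) (hpj : ¬ p ∣ j) : ∀ q ∈ Q, Commute n q := by
  have hpow : ∀ q ∈ Q, ∃ i, q ^ p ^ i = 1 := fun q hq => by
    obtain ⟨i, hi⟩ := hQ ⟨q, hq⟩
    exact ⟨i, congrArg Subtype.val hi⟩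
  set R := Q ⊓ Subgroup.centralizer (V : Set Γ) with hR
  have hmemR : ∀ x, x ∈ R ↔ x ∈ Q ∧ ∀ a ∈ V, Commute a x := fun x => by
    rw [hR, Subgroup.mem_inf, Subgroup.mem_centralizer_iff]; rfl
  have hRp : IsPGroup p R := hQ.to_le inf_le_left
  have hnR : ∀ x ∈ R, n * x * n⁻¹ ∈ R := fun x hx => by
    rw [hmemR] at hx ⊢
    refine ⟨hnQ x hx.1, fun a ha => ?_⟩
    have h := (hnV a ha).symm
    exact (h.mul_right (hx.2 a ha)).mul_right h.inv_right
  have hRcomm : ∀ x ∈ R, Commute n x := by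
    intro x
    induction ho : orderOf x using Nat.strong_induction_on generalizing x with
    | _ o ih =>
    intro hx
    by_cases hx1 : x = 1
    · rw [hx1]; exact Commute.one_right n
    have hpo : p ∣ orderOf x := by
      obtain ⟨i, hi⟩ := hpow x ((hmemR x).mp hx).1
      obtain ⟨l, -, hl⟩ := (Nat.dvd_prime_pow (Fact.out : p.Prime)).mp
        (orderOf_dvd_of_pow_eq_one hi)
      have hl0 : l ≠ 0 := by
        rintro rfl
        exact hx1 (orderOf_eq_one_iff.mp (by simpa using hl))
      rw [hl]
      exact dvd_pow_self p hl0
    have hlt : orderOf (x ^ p) < o := by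
      rw [orderOf_pow_of_dvd (Fact.out : p.Prime).ne_zero hpo, ← ho]
      exact Nat.div_lt_self (orderOf_pos x) (Fact.out : p.Prime).one_lt
    have hxp : Commute n (x ^ p) := ih _ hlt _ rfl (R.pow_mem hx p)
    have hzp : (x⁻¹ * (n * x * n⁻¹)) ^ p = 1 :=
      div_pow_eq_one hp (M := R) R hRp (fun g hg m hm => R.mul_mem (R.mul_mem (R.inv_mem hg) hm) hg)
        (fun m hm hmp g hg => ((hmemR g).mp hg).2 m
          (hV.mem_of_comm m ((hmemR m).mp hm).1 ((hmemR m).mp hm).2 hmp)) hx (hnR x hx)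
        (R.mul_mem (R.inv_mem hx) (hnR x hx))
        (by rw [conj_pow, hxp.eq, mul_inv_cancel_right])
    have hzR := (hmemR _).mp (R.mul_mem (R.inv_mem hx) (hnR x hx))
    refine commute_of_commutator_fixed (z := x⁻¹ * (n * x * n⁻¹)) (i := 1) hj hpj
      (mul_inv_cancel_left x _).symm ?_ (by rwa [pow_one])
    rw [(hnV _ (hV.mem_of_comm _ hzR.1 hzR.2 hzp)).eq, mul_inv_cancel_right]
  intro q hq
  have hzR : q⁻¹ * (n * q * n⁻¹) ∈ R := by
    rw [hmemR]
    refine ⟨Q.mul_mem (Q.inv_mem hq) (hnQ q hq), fun a ha => ?_⟩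
    have hb := hV.conj_mem q hq a ha
    calc a * (q⁻¹ * (n * q * n⁻¹)) = q⁻¹ * ((q * a * q⁻¹) * n) * q * n⁻¹ := by group
      _ = q⁻¹ * n * q * (a * n⁻¹) := by rw [← (hnV _ hb).eq]; group
      _ = q⁻¹ * (n * q * n⁻¹) * a := by rw [← (hnV a ha).inv_left.eq]; group
  obtain ⟨i, hi⟩ := hpow _ ((hmemR _).mp hzR).1
  refine commute_of_commutator_fixed hj hpj (mul_inv_cancel_left q _).symm ?_ hi
  rw [(hRcomm _ hzR).eq, mul_inv_cancel_right]

end CriticalSubgroup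

section FixedPoints

open scoped Pointwise

variable {p : ℕ} {G : Type*} [Group G]

/-- `S` is maximal among the `p`-subgroups of the subgroup `W`. -/
def IsMaxPSubgroup (p : ℕ) (S W : Subgroup G) : Prop :=
  Maximal (fun S : Subgroup G => S ≤ W ∧ IsPGroup p S) S

lemma exists_isMaxPSubgroup [Finite G] {Q W : Subgroup G} (hQ : IsPGroup p Q) (hQW : Q ≤ W) :
    ∃ S, Q ≤ S ∧ IsMaxPSubgroup p S W :=
  Finite.exists_le_maximal (p := fun S : Subgroup G => S ≤ W ∧ IsPGroup p S) ⟨hQW, hQ⟩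

lemma IsMaxPSubgroup.mono {S W W' : Subgroup G} (hS : IsMaxPSubgroup p S W) (hSW : S ≤ W')
    (hW : W' ≤ W) : IsMaxPSubgroup p S W' :=
  ⟨⟨hSW, hS.prop.2⟩, fun _ hT h => hS.le_of_ge ⟨hT.1.trans hW, hT.2⟩ h⟩

lemma mem_conj_smul {g x : G} {S : Subgroup G} : x ∈ MulAut.conj g • S ↔ g⁻¹ * x * g ∈ S := by
  rw [Subgroup.mem_pointwise_smul_iff_inv_smul_mem, ← map_inv, MulAut.smul_def, MulAut.conj_apply,
    inv_inv]

lemma isPGroup_conj_smul {S : Subgroup G} (hS : IsPGroup p S) (g : G) :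
    IsPGroup p (MulAut.conj g • S : Subgroup G) :=
  hS.map _

lemma IsMaxPSubgroup.conj_smul {S W : Subgroup G} (hS : IsMaxPSubgroup p S W) {g : G}
    (hg : g ∈ W) : IsMaxPSubgroup p (MulAut.conj g • S) W := by
  refine ⟨⟨fun x hx => ?_, isPGroup_conj_smul hS.prop.2 g⟩, fun T hT h x hx => ?_⟩
  · have h := W.mul_mem (W.mul_mem hg (hS.prop.1 (mem_conj_smul.mp hx))) (W.inv_mem hg)
    convert h using 1
    group
  · have hle : S ≤ MulAut.conj g⁻¹ • T := fun s hs => by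
      rw [mem_conj_smul]
      refine h (mem_conj_smul.mpr ?_)
      convert hs using 1
      group
    refine mem_conj_smul.mpr (hS.le_of_ge ⟨fun y hy => ?_, isPGroup_conj_smul hT.2 g⁻¹⟩ hle ?_)
    · have h := W.mul_mem (W.mul_mem (W.inv_mem hg) (hT.1 (mem_conj_smul.mp hy))) hg
      convert h using 1
      group
    · rw [mem_conj_smul]
      convert hx using 1
      group

/-- A maximal `p`-subgroup of `W`, as a Sylow subgroup of the group `W`. -/
def IsMaxPSubgroup.sylow {S W : Subgroup G} (hS : IsMaxPSubgroup p S W) : Sylow p W where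
  __ := S.subgroupOf W
  isPGroup' := hS.prop.2.comap_of_injective _ W.subtype_injective
  is_maximal' {T} hT h := by
    refine le_antisymm (fun t ht => ?_) h
    refine hS.le_of_ge ⟨Subgroup.map_subtype_le T, hT.map _⟩ (fun s hs => ?_) ⟨t, ht, rfl⟩
    exact ⟨⟨s, hS.prop.1 hs⟩, h hs, rfl⟩

lemma IsMaxPSubgroup.mem_sylow {S W : Subgroup G} (hS : IsMaxPSubgroup p S W) (w : W) :
    w ∈ hS.sylow ↔ (w : G) ∈ S := Iff.rfl

/-- The elements acting on `V` by conjugation like some element of `Q`. -/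
def innerOn {Q V : Subgroup G} (hV : IsCritical p Q V) : Subgroup G where
  carrier := {g | ∃ q ∈ Q, ∀ a ∈ V, g * a * g⁻¹ = q * a * q⁻¹}
  one_mem' := ⟨1, Q.one_mem, fun _ _ => rfl⟩
  mul_mem' := by
    rintro g g' ⟨q, hq, h⟩ ⟨q', hq', h'⟩
    refine ⟨q * q', Q.mul_mem hq hq', fun a ha => ?_⟩
    calc g * g' * a * (g * g')⁻¹ = g * (g' * a * g'⁻¹) * g⁻¹ := by group
      _ = q * (q' * a * q'⁻¹) * q⁻¹ := by rw [h' a ha, h _ (hV.conj_mem q' hq' a ha)]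
      _ = q * q' * a * (q * q')⁻¹ := by group
  inv_mem' := by
    rintro g ⟨q, hq, h⟩
    refine ⟨q⁻¹, Q.inv_mem hq, fun a ha => ?_⟩
    have h1 := h _ (hV.conj_mem q⁻¹ (Q.inv_mem hq) a ha)
    rw [inv_inv] at h1
    rw [inv_inv, inv_inv]
    calc g⁻¹ * a * g = g⁻¹ * (q * (q⁻¹ * a * q) * q⁻¹) * g := by group
      _ = g⁻¹ * (g * (q⁻¹ * a * q) * g⁻¹) * g := by rw [h1]
      _ = q⁻¹ * a * q := by group

lemma IsCritical.centralizer_le_innerOn {Q V : Subgroup G} (hV : IsCritical p Q V) :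
    Subgroup.centralizer (V : Set G) ≤ innerOn hV := fun c hc =>
  ⟨1, Q.one_mem, fun a ha => by
    rw [← Subgroup.mem_centralizer_iff.mp hc a ha]; group⟩

lemma IsCritical.le_innerOn {Q V : Subgroup G} (hV : IsCritical p Q V) : Q ≤ innerOn hV :=
  fun q hq => ⟨q, hq, fun _ _ => rfl⟩

lemma conj_smul_eq_iff {X : Type*} [MulAction G X] {g s : G} {z : X} :
    (g⁻¹ * s * g) • z = z ↔ s • g • z = g • z := by
  rw [mul_assoc, mul_smul, mul_smul, inv_smul_eq_iff]

variable [Fact p.Prime] [Finite G]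

lemma IsMaxPSubgroup.exists_conj {S W Q : Subgroup G} (hS : IsMaxPSubgroup p S W)
    (hQ : IsPGroup p Q) (hQW : Q ≤ W) : ∃ w ∈ W, ∀ q ∈ Q, w⁻¹ * q * w ∈ S := by
  obtain ⟨T, hT⟩ := (hQ.comap_of_injective W.subtype W.subtype_injective).exists_le_sylow
  obtain ⟨w, rfl⟩ := MulAction.exists_smul_eq W hS.sylow T
  refine ⟨w, w.2, fun q hq => ?_⟩
  have h : (⟨q, hQW hq⟩ : W) ∈ MulAut.conj w • hS.sylow.toSubgroup := hT hq
  exact (hS.mem_sylow _).mp (mem_conj_smul.mp h)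

lemma IsMaxPSubgroup.exists_eq_mul {T N D : Subgroup G} (hT : IsMaxPSubgroup p T N)
    (hD : ∀ g ∈ N, ∀ d ∈ D, g * d * g⁻¹ ∈ D) (hpow : ∀ g ∈ N, ∃ i : ℕ, g ^ p ^ i ∈ D) {g : G}
    (hg : g ∈ N) : ∃ d ∈ D, ∃ t ∈ T, g = d * t := by
  have hDn : (D.subgroupOf N).Normal := ⟨fun d hd n => hD n n.2 d hd⟩
  have hquot : IsPGroup p (N ⧸ D.subgroupOf N) := by
    intro x
    obtain ⟨n, rfl⟩ := QuotientGroup.mk_surjective x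
    obtain ⟨i, hi⟩ := hpow n n.2
    refine ⟨i, ?_⟩
    rw [← QuotientGroup.mk_pow, QuotientGroup.eq_one_iff]
    exact hi
  obtain ⟨i, hi⟩ := IsPGroup.iff_card.mp hquot
  have htop : D.subgroupOf N ⊔ hT.sylow.toSubgroup = ⊤ := by
    rw [← Subgroup.index_eq_one]
    have h1 : (D.subgroupOf N ⊔ hT.sylow.toSubgroup).index ∣ p ^ i :=
      hi ▸ Subgroup.index_dvd_of_le le_sup_left
    have h2 : (D.subgroupOf N ⊔ hT.sylow.toSubgroup).index ∣ hT.sylow.index :=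
      Subgroup.index_dvd_of_le le_sup_right
    obtain ⟨l, -, hl⟩ := (Nat.dvd_prime_pow (Fact.out : p.Prime)).mp h1
    rcases Nat.eq_zero_or_pos l with rfl | hl0
    · simpa using hl
    · exact absurd ((hl ▸ dvd_pow_self p hl0.ne').trans h2) hT.sylow.not_dvd_index
  have hmem : (⟨g, hg⟩ : N) ∈ D.subgroupOf N ⊔ hT.sylow.toSubgroup := htop ▸ Subgroup.mem_top _
  obtain ⟨d, hd, t, ht, hdt⟩ := Subgroup.mem_sup_of_normal_left.mp hmem
  exact ⟨d, hd, t, ht, (congrArg Subtype.val hdt).symm⟩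

lemma exists_mem_normalizer_of_lt {S Q : Subgroup G} (hS : IsPGroup p S) (hQS : Q < S) :
    Q < S ⊓ Subgroup.normalizer (Q : Set G) := by
  have := hS.isNilpotent
  have hlt : Q.subgroupOf S < ⊤ := by
    rw [lt_top_iff_ne_top, Ne, Subgroup.subgroupOf_eq_top]
    exact not_le_of_gt hQS
  obtain ⟨s, hs, hsQ⟩ := SetLike.exists_of_lt (Group.normalizerCondition_of_isNilpotent _ hlt)
  refine lt_of_le_of_ne (le_inf hQS.le Subgroup.le_normalizer) fun h => hsQ ?_
  have hmem : (s : G) ∈ S ⊓ Subgroup.normalizer (Q : Set G) := by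
    refine ⟨s.2, Subgroup.mem_normalizer_iff.mpr fun q => ?_⟩
    have hconj := Subgroup.mem_normalizer_iff.mp hs
    constructor
    · intro hq
      exact (hconj ⟨q, hQS.le hq⟩).mp hq
    · intro hq
      have hqS : q ∈ S := by
        have h := S.mul_mem (S.mul_mem (S.inv_mem s.2) (hQS.le hq)) s.2
        convert h using 1
        group
      exact (hconj ⟨q, hqS⟩).mpr hq
  rw [← h] at hmem
  exact hmem

lemma exists_pow_mem_centralizer (hp : 2 < p) {Q V : Subgroup G} (hV : IsCritical p Q V)
    (hQ : IsPGroup p Q) {g : G} (hg : g ∈ innerOn hV ⊓ Subgroup.normalizer (Q : Set G)) :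
    ∃ i : ℕ, g ^ p ^ i ∈ Subgroup.centralizer (Q : Set G) := by
  obtain ⟨⟨q, hq, h⟩, hgQ⟩ := hg
  have hpow : ∀ m : ℕ, ∀ a ∈ V, g ^ m * a * (g ^ m)⁻¹ = q ^ m * a * (q ^ m)⁻¹ := by
    intro m
    induction m with
    | zero => simp
    | succ m ih =>
      intro a ha
      calc g ^ (m + 1) * a * (g ^ (m + 1))⁻¹ = g ^ m * (g * a * g⁻¹) * (g ^ m)⁻¹ := by
            rw [pow_succ]; group
        _ = q ^ m * (q * a * q⁻¹) * (q ^ m)⁻¹ := by rw [h a ha, ih _ (hV.conj_mem q hq a ha)]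
        _ = q ^ (m + 1) * a * (q ^ (m + 1))⁻¹ := by rw [pow_succ]; group
  obtain ⟨i, hi⟩ := hQ ⟨q, hq⟩
  have hi' : q ^ p ^ i = 1 := congrArg Subtype.val hi
  obtain ⟨b, j, hj, hbj⟩ := Nat.exists_eq_pow_mul_and_not_dvd (orderOf_pos (g ^ p ^ i)).ne' p
    (Fact.out : p.Prime).ne_one
  refine ⟨i + b, Subgroup.mem_centralizer_iff.mpr fun x hx => ?_⟩
  have hcV : ∀ a ∈ V, Commute (g ^ p ^ i) a := fun a ha => by
    have h := hpow (p ^ i) a ha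
    rw [hi', one_mul, inv_one, mul_one] at h
    exact mul_inv_eq_iff_eq_mul.mp h
  rw [pow_add, pow_mul]
  refine (hV.commute hp hQ (fun q hq => ?_) (fun a ha => (hcV a ha).pow_left _) (j := j) ?_ hj x
    hx).symm.eq
  · exact (Subgroup.mem_normalizer_iff.mp (pow_mem (pow_mem hgQ _) _) q).mp hq
  · rw [← pow_mul, ← hbj, pow_orderOf_eq_one]

variable (X : Type*) [MulAction G X]

/-- The centralizer of `Q` is transitive on the fixed points of `Q`. -/
def IsCentrallyTransitive (Q : Subgroup G) : Prop :=
  ∀ x y : X, (∀ q ∈ Q, q • x = x) → (∀ q ∈ Q, q • y = y) →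
    ∃ c ∈ Subgroup.centralizer (Q : Set G), c • x = y

variable {X}

lemma exists_isMaxPSubgroup_fixing (hfix : ∀ S : Subgroup G, IsPGroup p S →
      ∃ z : X, ∀ s ∈ S, s • z = z) {Q V : Subgroup G} (hQ : IsPGroup p Q)
    (hV : IsCritical p Q V) (hVt : IsCentrallyTransitive X V) {x : X}
    (hx : ∀ q ∈ Q, q • x = x) :
    ∃ S, Q ≤ S ∧ IsMaxPSubgroup p S (innerOn hV) ∧ ∀ s ∈ S, s • x = x := by
  obtain ⟨S, hQS, hS⟩ := exists_isMaxPSubgroup hQ hV.le_innerOn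
  obtain ⟨z, hz⟩ := hfix S hS.prop.2
  obtain ⟨c, hc, rfl⟩ := hVt z x (fun a ha => hz a (hQS (hV.le ha))) fun a ha => hx a (hV.le ha)
  have hcS := hS.conj_smul (hV.centralizer_le_innerOn hc)
  set J := innerOn hV ⊓ MulAction.stabilizer G (c • z) with hJ
  have hcSJ : MulAut.conj c • S ≤ J := le_inf hcS.prop.1 fun s hs => by
    exact conj_smul_eq_iff.mp (hz _ (mem_conj_smul.mp hs))
  obtain ⟨j, hj, h⟩ := (hcS.mono hcSJ inf_le_left).exists_conj hQ (le_inf hV.le_innerOn hx)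
  exact ⟨MulAut.conj j • MulAut.conj c • S, fun q hq => mem_conj_smul.mpr (h q hq),
    hcS.conj_smul hj.1, fun s hs =>
      (((hcS.mono hcSJ inf_le_left).conj_smul hj).prop.1 hs).2⟩

theorem isCentrallyTransitive_of_isPGroup (hp : 2 < p) (hfix : ∀ S : Subgroup G, IsPGroup p S →
      ∃ z : X, ∀ s ∈ S, s • z = z)
    (helem : ∀ V : Subgroup G, (∀ a ∈ V, ∀ b ∈ V, Commute a b) → (∀ a ∈ V, a ^ p = 1) →
      IsCentrallyTransitive X V) (Q : Subgroup G) (hQ : IsPGroup p Q) :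
    IsCentrallyTransitive X Q := by
  induction Q using WellFoundedGT.induction with
  | _ Q ih =>
  obtain ⟨V, hV⟩ := exists_isCritical hp hQ
  have hVt := helem V hV.comm hV.pow_eq_one
  set C := Subgroup.centralizer (V : Set G) with hC
  set D := Subgroup.centralizer (Q : Set G) with hD
  set N := innerOn hV ⊓ Subgroup.normalizer (Q : Set G) with hN
  have hDn : ∀ g ∈ N, ∀ d ∈ D, g * d * g⁻¹ ∈ D := by
    intro g hg d hd
    refine Subgroup.mem_centralizer_iff.mpr fun q hq => ?_
    have hq' : g⁻¹ * q * g ∈ Q := by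
      have h := (Subgroup.mem_normalizer_iff.mp (inv_mem hg.2) q).mp hq
      rwa [inv_inv] at h
    have h := Subgroup.mem_centralizer_iff.mp hd _ hq'
    calc q * (g * d * g⁻¹) = g * ((g⁻¹ * q * g) * d) * g⁻¹ := by group
      _ = g * (d * (g⁻¹ * q * g)) * g⁻¹ := by rw [h]
      _ = g * d * g⁻¹ * q := by group
  have hpow : ∀ g ∈ N, ∃ i : ℕ, g ^ p ^ i ∈ D := fun g hg =>
    exists_pow_mem_centralizer hp hV hQ hg
  intro x y hx hy
  by_cases hmax : IsMaxPSubgroup p Q (innerOn hV)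
  · obtain ⟨c, hc, rfl⟩ := hVt x y (fun a ha => hx a (hV.le ha)) fun a ha => hy a (hV.le ha)
    have hcJ := hV.centralizer_le_innerOn hc
    have hQJ : Q ≤ innerOn hV ⊓ MulAction.stabilizer G x := le_inf hV.le_innerOn hx
    have hQc : MulAut.conj c⁻¹ • Q ≤ innerOn hV ⊓ MulAction.stabilizer G x := by
      refine le_inf (hmax.conj_smul ((innerOn hV).inv_mem hcJ)).prop.1 fun q hq => ?_
      have h := conj_smul_eq_iff.mp (hy _ (mem_conj_smul.mp hq))
      rwa [inv_smul_smul] at h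
    obtain ⟨j, hj, h⟩ := (hmax.mono hQJ inf_le_left).exists_conj (isPGroup_conj_smul hQ c⁻¹) hQc
    have hm : (c * j)⁻¹ ∈ Subgroup.normalizer (Q : Set G) := by
      refine Subgroup.mem_normalizer_fintype fun q hq => ?_
      have h' := h (c⁻¹ * q * c) (mem_conj_smul.mpr (by
        simpa [mul_assoc] using hq))
      simpa [mul_assoc] using h'
    obtain ⟨d, hd, q, hq, hdq⟩ := (hmax.mono (le_inf hV.le_innerOn Subgroup.le_normalizer)
      inf_le_left).exists_eq_mul hDn hpow (g := c * j)
      ⟨mul_mem hcJ hj.1, by simpa using inv_mem hm⟩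
    refine ⟨d, hd, ?_⟩
    calc d • x = (d * q) • x := by rw [mul_smul, hx q hq]
      _ = c • j • x := by rw [← hdq, mul_smul]
      _ = c • x := by rw [show j • x = x from hj.2]
  · have hlt : ∀ {w : X}, (∀ q ∈ Q, q • w = w) → ∃ R, Q < R ∧ IsPGroup p R ∧ R ≤ N ∧
        ∀ r ∈ R, r • w = w := by
      intro w hw
      obtain ⟨S, hQS, hS, hSw⟩ := exists_isMaxPSubgroup_fixing hfix hQ hV hVt hw
      have hQS' : Q < S := lt_of_le_of_ne hQS fun h => hmax (h ▸ hS)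
      exact ⟨_, exists_mem_normalizer_of_lt hS.prop.2 hQS', hS.prop.2.to_le inf_le_left,
        inf_le_inf_right _ hS.prop.1, fun r hr => hSw r hr.1⟩
    obtain ⟨R, hQR, hR, hRN, hRx⟩ := hlt hx
    obtain ⟨R', hQR', hR', hRN', hRy⟩ := hlt hy
    obtain ⟨T, hRT, hT⟩ := exists_isMaxPSubgroup hR' hRN'
    obtain ⟨z, hz⟩ := hfix T hT.prop.2
    obtain ⟨n, hn, hnT⟩ := hT.exists_conj hR hRN
    obtain ⟨d, hd, t, ht, rfl⟩ := hT.exists_eq_mul hDn hpow hn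
    obtain ⟨c, hc, hcx⟩ := ih R hQR hR x (d • z) hRx fun r hr => by
      refine conj_smul_eq_iff.mp (hz _ ?_)
      have h := T.mul_mem (T.mul_mem ht (hnT r hr)) (T.inv_mem ht)
      convert h using 1
      group
    obtain ⟨c', hc', rfl⟩ := ih R' hQR' hR' z y (fun r hr => hz r (hRT hr)) hRy
    have hle : ∀ {R : Subgroup G}, Q < R → Subgroup.centralizer (R : Set G) ≤ D := fun h =>
      Subgroup.centralizer_le h.le
    refine ⟨c' * d⁻¹ * c, D.mul_mem (D.mul_mem (hle hQR' hc') (D.inv_mem hd)) (hle hQR hc), ?_⟩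
    rw [mul_smul, mul_smul, hcx, inv_smul_smul]

end FixedPoints

section Control

variable {p : ℕ} [Fact p.Prime] {G : Type u} [Group G] [Finite G] {H : Subgroup G}

lemma isCentrallyTransitive_of_elementary [CharP k p] (hp : 2 < p) (hyp : RestrictionHyp k p H)
    {V : Subgroup G} (hVc : ∀ a ∈ V, ∀ b ∈ V, Commute a b) (hVp : ∀ a ∈ V, a ^ p = 1) :
    IsCentrallyTransitive (G ⧸ H) V := by
  intro x y hx hy
  obtain ⟨a, rfl⟩ := QuotientGroup.mk_surjective x
  obtain ⟨b, rfl⟩ := QuotientGroup.mk_surjective y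
  let _ : CommGroup V :=
    { (inferInstance : Group V) with
      mul_comm := fun v w => Subtype.ext (hVc v v.2 w w.2).eq }
  have hmem : ∀ (g : G), (∀ v ∈ V, v • (QuotientGroup.mk g : G ⧸ H) = QuotientGroup.mk g) →
      ∀ v : V, (MulAut.conj g⁻¹).toMonoidHom.comp V.subtype v ∈ H := fun g hg v => by
    have h := QuotientGroup.eq.mp (hg v v.2).symm
    simpa [mul_assoc] using h
  let conjHom (g : G) (hg : ∀ v ∈ V, v • (QuotientGroup.mk g : G ⧸ H) = QuotientGroup.mk g) :
      V →* H := ((MulAut.conj g⁻¹).toMonoidHom.comp V.subtype).codRestrict H (hmem g hg)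
  have hconj : ∀ g hg v, (conjHom g hg v : G) = g⁻¹ * v * g := fun g hg v => by
    change g⁻¹ * v * g⁻¹⁻¹ = _
    rw [inv_inv]
  obtain ⟨h, hh⟩ := exists_conj_of_elementary k hp hyp (E := V)
    (fun v => Subtype.ext (hVp v v.2)) (conjHom a hx) (conjHom b hy) (fun v w hvw => by
      have h := congrArg Subtype.val hvw
      rw [hconj a hx, hconj a hx] at h
      exact Subtype.ext (mul_left_cancel (mul_right_cancel h))) (b⁻¹ * a) (fun v => by
      rw [hconj a hx, hconj b hy]; group)
  refine ⟨b * h * a⁻¹, Subgroup.mem_centralizer_iff.mpr fun v hv => ?_, ?_⟩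
  · have h1 := congrArg Subtype.val (hh ⟨v, hv⟩)
    simp only [Subgroup.coe_mul, Subgroup.coe_inv, hconj a hx, hconj b hy] at h1
    calc v * (b * h * a⁻¹) = b * h * ((h : G)⁻¹ * (b⁻¹ * v * b) * h) * a⁻¹ := by group
      _ = b * h * (a⁻¹ * v * a) * a⁻¹ := by rw [h1]
      _ = b * h * a⁻¹ * v := by group
  · change ((b * h * a⁻¹ * a : G) : G ⧸ H) = b
    rw [inv_mul_cancel_right, QuotientGroup.mk_mul_of_mem b h.2]

lemma exists_fixed_quotient {P : Sylow p G} (hPH : (P : Subgroup G) ≤ H) {S : Subgroup G}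
    (hS : IsPGroup p S) : ∃ z : G ⧸ H, ∀ s ∈ S, s • z = z := by
  have hndvd : ¬ p ∣ Nat.card (G ⧸ H) := fun h =>
    P.not_dvd_index (h.trans (Subgroup.index_dvd_of_le hPH))
  obtain ⟨z, hz⟩ := hS.nonempty_fixed_point_of_prime_not_dvd_card (G ⧸ H) hndvd
  exact ⟨z, fun s hs => hz ⟨s, hs⟩⟩

theorem controls_fusion_of_restrictionHyp [CharP k p] (hp : 2 < p) {P : Sylow p G}
    (hPH : (P : Subgroup G) ≤ H) (hyp : RestrictionHyp k p H) {Q : Subgroup G}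
    (hQP : Q ≤ (P : Subgroup G)) (g : G) (hg : ∀ x ∈ Q, g * x * g⁻¹ ∈ (P : Subgroup G)) :
    ∃ h ∈ H, ∀ x ∈ Q, h * x * h⁻¹ = g * x * g⁻¹ := by
  obtain ⟨c, hc, hcg⟩ := isCentrallyTransitive_of_isPGroup (X := G ⧸ H) hp
    (fun S hS => exists_fixed_quotient hPH hS)
    (fun V hVc hVp => isCentrallyTransitive_of_elementary k hp hyp hVc hVp) Q
    (P.isPGroup'.to_le hQP) (QuotientGroup.mk 1) (QuotientGroup.mk g⁻¹)
    (fun q hq => by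
      change ((q * 1 : G) : G ⧸ H) = _
      rw [QuotientGroup.eq]
      simpa using hPH (hQP hq))
    (fun q hq => by
      change ((q * g⁻¹ : G) : G ⧸ H) = _
      rw [QuotientGroup.eq]
      simpa [mul_assoc] using H.inv_mem (hPH (hg q hq)))
  refine ⟨g * c, ?_, fun x hx => ?_⟩
  · have h : ((c * 1 : G) : G ⧸ H) = (g⁻¹ : G) := hcg
    simpa using QuotientGroup.eq.mp h.symm
  · calc g * c * x * (g * c)⁻¹ = g * (c * x) * c⁻¹ * g⁻¹ := by group
      _ = g * x * g⁻¹ := by rw [← Subgroup.mem_centralizer_iff.mp hc x hx]; group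

end Control

/-- **Mislin's theorem, group-realized case, `p` odd.**  Let `p` be an odd prime, `G` a
finite group, `H ≤ G` a subgroup, `P` a Sylow `p`-subgroup of `G` with `P ≤ H`, and `k` a
field of characteristic `p`.  Suppose that for every `n ≥ 0` and every class
`ζ ∈ H^n(H,k)` there is `r ≥ 0` such that the cup power `ζ^{p^r} ∈ H^{n·p^r}(H,k)` lies
in the image of restriction `H^{n·p^r}(G,k) → H^{n·p^r}(H,k)`; at cocycle level: for some
cocycle `z` representing `ζ` there exists a `G`-cocycle `w` with
`res(w) - z^{⌣ p^r}` a coboundary.  Then `H` controls `p`-fusion in `G`. -/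
theorem mislin_control_fusion
    (p : ℕ) [Fact p.Prime] (hp : Odd p)
    (G : Type u) [Group G] [Finite G] (H : Subgroup G)
    (P : Sylow p G) (hPH : (P : Subgroup G) ≤ H)
    [Field k] [CharP k p]
    (hyp : ∀ (n : ℕ) (ζ : cohomology k (↥H) n),
      ∃ (r : ℕ) (z : cocycles k (↥H) n),
        (Submodule.Quotient.mk z : cohomology k (↥H) n) = ζ ∧
        ∃ w : cocycles k G (n * p ^ r),
          resCochain k H.subtype (n * p ^ r) (w : (Fin (n * p ^ r) → G) → k) -
              cupPow k (z : (Fin n → ↥H) → k) (p ^ r)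
            ∈ coboundaries k (↥H) (n * p ^ r)) :
    ∀ Q : Subgroup G, Q ≤ (P : Subgroup G) → ∀ g : G,
      (∀ x ∈ Q, g * x * g⁻¹ ∈ (P : Subgroup G)) →
      ∃ h ∈ H, ∀ x ∈ Q, h * x * h⁻¹ = g * x * g⁻¹ := by
  have hp2 : 2 < p := (Fact.out : p.Prime).two_le.lt_of_ne fun h => by
    rw [← h] at hp
    exact absurd hp (by decide)
  intro Q hQ g hg
  exact controls_fusion_of_restrictionHyp k hp2 hPH hyp hQ g hg

end MislinExplicit
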